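/- Let a and b be rational numbers such that none of a, b, and a + b is an integer. Then the number B(a, b) = Γ(a)Γ(b)/Γ(a + b) is transcendental. -/

import Mathlib

section
open Polynomial

namespace SB

/-- the derivation x(1-x) d/dx on polynomials -/
noncomputable def th (f : ℂ[X]) : ℂ[X] := X * (1 - X) * derivative f

noncomputable def rhoP (a b : ℂ) : ℂ[X] := C a - C (a + b) * X

lemma th_add (f g : ℂ[X]) : th (f + g) = th f + th g := by simp [th]; ring
lemma th_mul (f g : ℂ[X]) : th (f * g) = th f * g + f * th g := by simp [th]; ring

lemma alg_deg (a b : ℂ) (hab : ∀ n : ℤ, a + b ≠ n) (f g : ℂ[X]) (hg : g ≠ 0) (hf : f ≠ 0) (d : ℕ)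
    (h : g * th f - f * th g + rhoP a b * f * g + (d : ℂ[X]) * g ^ 2 = 0) :
    f.natDegree < g.natDegree := by
  by_contra hlt
  push Not at hlt
  set n := f.natDegree
  set m := g.natDegree
  have e0 : (g * derivative f * X - g * derivative f * X * X - f * derivative g * X
      + f * derivative g * X * X + C a * (f * g) - C (a + b) * (f * g * X)
      + C (d : ℂ) * g ^ 2).coeff (n + m + 1) = 0 := by
    rw [← coeff_zero (n + m + 1), ← h]
    congr 1
    simp [th, rhoP]; ring
  have hd1 : derivative f * X = derivative f * X := rfl
  have c1 : (g * derivative f * X).coeff (n + m + 1) = 0 := by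
    rw [coeff_mul_X]
    by_cases hn : n = 0
    · have : derivative f = 0 := by
        rw [eq_C_of_natDegree_eq_zero hn]; simp
      simp [this]
    · apply coeff_eq_zero_of_natDegree_lt
      refine lt_of_le_of_lt natDegree_mul_le ?_
      have := natDegree_derivative_lt hn
      change m + _ < _
      omega
  have c2 : (f * derivative g * X).coeff (n + m + 1) = 0 := by
    rw [coeff_mul_X]
    by_cases hn : m = 0
    · have : derivative g = 0 := by
        rw [eq_C_of_natDegree_eq_zero hn]; simp
      simp [this]
    · apply coeff_eq_zero_of_natDegree_lt
      refine lt_of_le_of_lt natDegree_mul_le ?_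
      have := natDegree_derivative_lt hn
      change n + _ < _
      omega
  have lead : ∀ (u v : ℂ[X]), (u * derivative v * X * X).coeff (u.natDegree + v.natDegree + 1)
      = v.natDegree * u.leadingCoeff * v.leadingCoeff := by
    intro u v
    rw [coeff_mul_X, mul_assoc]
    have : (derivative v * X).natDegree ≤ v.natDegree := by
      by_cases hn : v.natDegree = 0
      · have : derivative v = 0 := by
          rw [eq_C_of_natDegree_eq_zero hn]; simp
        simp [this]
      · refine natDegree_mul_le.trans ?_
        have := natDegree_derivative_lt hn
        simp; omega
    rw [coeff_mul_add_eq_of_natDegree_le le_rfl this]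
    rcases Nat.eq_zero_or_pos v.natDegree with h0 | h0
    · rw [h0]; simp
    · obtain ⟨k, hk⟩ := Nat.exists_eq_succ_of_ne_zero h0.ne'
      have : (derivative v * X).coeff v.natDegree = v.natDegree * v.leadingCoeff := by
        rw [hk, Nat.succ_eq_add_one, coeff_mul_X, coeff_derivative, leadingCoeff, hk]; push_cast; ring
      rw [this, coeff_natDegree]; ring
  have c3 := lead g f
  have c4 := lead f g
  have c5 : (C a * (f * g)).coeff (n + m + 1) = 0 := by
    rw [coeff_C_mul, coeff_eq_zero_of_natDegree_lt, mul_zero]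
    refine lt_of_le_of_lt natDegree_mul_le ?_
    omega
  have c6 : (C (a + b) * (f * g * X)).coeff (n + m + 1) = (a + b) * (f.leadingCoeff * g.leadingCoeff) := by
    rw [coeff_C_mul, coeff_mul_X, coeff_mul_add_eq_of_natDegree_le le_rfl le_rfl]; rfl
  have c7 : (C (d : ℂ) * g ^ 2).coeff (n + m + 1) = 0 := by
    rw [coeff_C_mul, coeff_eq_zero_of_natDegree_lt, mul_zero]
    refine lt_of_le_of_lt natDegree_pow_le ?_
    change 2 * m < _
    omega
  rw [show g.natDegree + f.natDegree + 1 = n + m + 1 by omega] at c3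
  change (f * derivative g * X * X).coeff (n + m + 1) = _ at c4
  simp only [coeff_add, coeff_sub] at e0
  rw [c1, c2, c3, c4, c5, c6, c7] at e0
  have l1 : f.leadingCoeff ≠ 0 := by simpa using hf
  have l2 : g.leadingCoeff ≠ 0 := by simpa using hg
  have : (a + b) * (f.leadingCoeff * g.leadingCoeff) = ((m : ℂ) - n) * (f.leadingCoeff * g.leadingCoeff) := by
    linear_combination -e0
  have := mul_right_cancel₀ (mul_ne_zero l1 l2) this
  exact hab (m - n) (by rw [this]; push_cast; ring)

lemma alg_ne (a b : ℂ) (ha : ∀ n : ℤ, a ≠ n) (hb : ∀ n : ℤ, b ≠ n) (hab : ∀ n : ℤ, a + b ≠ n)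
    (f g : ℂ[X]) (hg : g ≠ 0) (d : ℕ) (hd : 1 ≤ d) :
    g * th f - f * th g + rhoP a b * f * g + (d : ℂ[X]) * g ^ 2 ≠ 0 := by
  intro h
  have hdd : (d : ℂ[X]) ≠ 0 := by exact_mod_cast (by omega : d ≠ 0)
  have hf : f ≠ 0 := by
    rintro rfl
    simp [th] at h
    rcases h with h | h
    · omega
    · exact hg h
  have hdeg := alg_deg a b hab f g hg hf d h
  obtain ⟨x, hx⟩ : ∃ x, f.rootMultiplicity x < g.rootMultiplicity x := by
    by_contra hcon
    push Not at hcon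
    have : g.roots ≤ f.roots := by
      rw [Multiset.le_iff_count]; intro x; simpa using hcon x
    have := Multiset.card_le_card this
    rw [(splits_iff_card_roots.mp (IsAlgClosed.splits g)), (splits_iff_card_roots.mp (IsAlgClosed.splits f))] at this
    omega
  obtain ⟨f1, hf1, hf1'⟩ := exists_eq_pow_rootMultiplicity_mul_and_not_dvd f hf x
  obtain ⟨g1, hg1, hg1'⟩ := exists_eq_pow_rootMultiplicity_mul_and_not_dvd g hg x
  rw [dvd_iff_isRoot, IsRoot.def] at hf1' hg1'
  set s := f.rootMultiplicity x
  obtain ⟨r, hr⟩ : ∃ r, g.rootMultiplicity x = s + (r + 1) := ⟨g.rootMultiplicity x - s - 1, by omega⟩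
  rw [hr] at hg1
  set q : ℂ[X] := X - C x with hq
  have hq0 : q ≠ 0 := X_sub_C_ne_zero x
  have dq : ∀ n : ℕ, q * derivative (q ^ n) = (n : ℂ[X]) * q ^ n := by
    intro n
    cases n with
    | zero => simp
    | succ n => rw [derivative_pow]; simp [hq]; ring
  have df : q * derivative f = q ^ s * ((s : ℂ[X]) * f1 + q * derivative f1) := by
    conv_lhs => rw [hf1]
    rw [derivative_mul]; linear_combination f1 * dq s
  have dg : q * derivative g = q ^ (s + (r + 1)) * (((s + (r + 1) : ℕ) : ℂ[X]) * g1 + q * derivative g1) := by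
    conv_lhs => rw [hg1]
    rw [derivative_mul]; linear_combination g1 * dq (s + (r+1))
  have main : X * (1 - X) * (q * (g1 * derivative f1 - f1 * derivative g1) - ((r + 1 : ℕ) : ℂ[X]) * (f1 * g1))
      + q * (rhoP a b * f1 * g1 + (d : ℂ[X]) * (q ^ (r + 1) * g1 ^ 2)) = 0 := by
    have h2 : q ^ (s + s + (r + 1)) * (X * (1 - X) * (q * (g1 * derivative f1 - f1 * derivative g1) - ((r + 1 : ℕ) : ℂ[X]) * (f1 * g1))
      + q * (rhoP a b * f1 * g1 + (d : ℂ[X]) * (q ^ (r + 1) * g1 ^ 2))) = 0 := by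
      have : q * (g * th f - f * th g + rhoP a b * f * g + (d : ℂ[X]) * g ^ 2) = 0 := by rw [h, mul_zero]
      have h3 : q * (g * th f - f * th g + rhoP a b * f * g + (d : ℂ[X]) * g ^ 2) =
        X * (1 - X) * (g * (q * derivative f) - f * (q * derivative g)) + q * (rhoP a b * f * g + (d : ℂ[X]) * g ^ 2) := by
        simp [th]; ring
      rw [h3, df, dg] at this
      rw [← this]
      have e1 : f = q ^ s * f1 := hf1
      have e2 : g = q ^ (s + (r+1)) * g1 := hg1
      rw [e1, e2]
      push_cast
      ring
    exact (mul_eq_zero.mp h2).resolve_left (pow_ne_zero _ hq0)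
  have ev := congrArg (eval x) main
  simp [hq] at ev
  have rne : (r : ℂ) + 1 ≠ 0 := by exact_mod_cast Nat.succ_ne_zero r
  simp only [hf1', hg1', rne, or_false] at ev
  rcases ev with rfl | ev
  · -- x = 0
    have hqX : q = X := by simp [hq]
    rw [hqX] at main
    have h4 : X * ((1 - X) * (X * (g1 * derivative f1 - f1 * derivative g1) - ((r + 1 : ℕ) : ℂ[X]) * (f1 * g1))
      + (rhoP a b * f1 * g1 + (d : ℂ[X]) * (X ^ (r + 1) * g1 ^ 2))) = 0 := by rw [← main]; ring
    have h5 := congrArg (eval 0) ((mul_eq_zero.mp h4).resolve_left X_ne_zero)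
    simp [rhoP] at h5
    have : (a - ((r:ℂ) + 1)) * (eval 0 f1 * eval 0 g1) = 0 := by linear_combination h5
    rcases mul_eq_zero.mp this with h6 | h6
    · exact ha (r + 1) (by push_cast; linear_combination h6)
    · exact (mul_ne_zero hf1' hg1') h6
  · have hx1 : x = 1 := by linear_combination -ev
    subst hx1
    have h4 : q * (-X * (q * (g1 * derivative f1 - f1 * derivative g1) - ((r + 1 : ℕ) : ℂ[X]) * (f1 * g1))
      + (rhoP a b * f1 * g1 + (d : ℂ[X]) * (q ^ (r + 1) * g1 ^ 2))) = 0 := by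
      rw [← main]; simp [hq]; ring
    have h5 := congrArg (eval 1) ((mul_eq_zero.mp h4).resolve_left hq0)
    simp [rhoP, hq] at h5
    have : (b - ((r:ℂ) + 1)) * (eval 1 f1 * eval 1 g1) = 0 := by linear_combination -h5
    rcases mul_eq_zero.mp this with h6 | h6
    · exact hb (r + 1) (by push_cast; linear_combination h6)
    · exact (mul_ne_zero hf1' hg1') h6

end SB
end

section
open Polynomial

namespace SB

noncomputable def nab (a b : ℂ) (D : ℕ) (p : ℕ → ℂ[X]) : ℕ → ℂ[X] := fun j =>
  th (p j) + C ((D : ℂ) - j) * rhoP a b * p j + C ((j : ℂ) + 1) * p (j + 1)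

lemma nab_add (a b : ℂ) (D : ℕ) (p q : ℕ → ℂ[X]) : nab a b D (p + q) = nab a b D p + nab a b D q := by
  funext j; simp [nab, th_add]; ring

lemma nab_smul (a b : ℂ) (D : ℕ) (g : ℂ[X]) (p : ℕ → ℂ[X]) :
    nab a b D (g • p) = th g • p + g • nab a b D p := by
  funext j; simp [nab, th_mul]; ring

lemma nab_zero (a b : ℂ) (D : ℕ) : nab a b D 0 = 0 := by
  funext j; simp [nab, th]

lemma nab_supp (a b : ℂ) (D d : ℕ) (p : ℕ → ℂ[X]) (h : ∀ j, d < j → p j = 0) :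
    ∀ j, d < j → nab a b D p j = 0 := by
  intro j hj
  simp [nab, h j hj, h (j+1) (by omega), th]

/-- saturation of the span -/
noncomputable def satW (s : Set (ℕ → ℂ[X])) : Submodule ℂ[X] (ℕ → ℂ[X]) where
  carrier := {w | ∃ g : ℂ[X], g ≠ 0 ∧ g • w ∈ Submodule.span ℂ[X] s}
  zero_mem' := ⟨1, one_ne_zero, by simp⟩
  add_mem' := by
    rintro u v ⟨g, hg, hu⟩ ⟨k, hk, hv⟩
    refine ⟨g * k, mul_ne_zero hg hk, ?_⟩
    rw [smul_add]
    refine Submodule.add_mem _ ?_ ?_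
    · rw [mul_comm, mul_smul]; exact Submodule.smul_mem _ _ hu
    · rw [mul_smul]; exact Submodule.smul_mem _ _ hv
  smul_mem' := by
    rintro c u ⟨g, hg, hu⟩
    refine ⟨g, hg, ?_⟩
    rw [smul_comm]; exact Submodule.smul_mem _ _ hu

lemma satW_sat (s : Set (ℕ → ℂ[X])) (g : ℂ[X]) (hg : g ≠ 0) (w : ℕ → ℂ[X]) (h : g • w ∈ satW s) : w ∈ satW s := by
  obtain ⟨k, hk, h⟩ := h
  exact ⟨k * g, mul_ne_zero hk hg, by rw [mul_smul]; exact h⟩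

lemma span_le_satW (s : Set (ℕ → ℂ[X])) (w) (h : w ∈ Submodule.span ℂ[X] s) : w ∈ satW s :=
  ⟨1, one_ne_zero, by simpa using h⟩

lemma satW_stable (a b : ℂ) (D r : ℕ) (p : ℕ → ℂ[X])
    (hr : (nab a b D)^[r] p ∈ satW (Set.range fun i : Fin r => (nab a b D)^[i] p))
    (w) (hw : w ∈ satW (Set.range fun i : Fin r => (nab a b D)^[i] p)) :
    nab a b D w ∈ satW (Set.range fun i : Fin r => (nab a b D)^[i] p) := by
  set s := Set.range fun i : Fin r => (nab a b D)^[i] p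
  have key : ∀ v, v ∈ Submodule.span ℂ[X] s → nab a b D v ∈ satW s := by
    intro v hv
    induction hv using Submodule.span_induction with
    | mem x hx =>
      obtain ⟨i, rfl⟩ := hx
      simp only []
      rw [← Function.iterate_succ_apply' (nab a b D)]
      by_cases h : (i : ℕ) + 1 < r
      · exact span_le_satW _ _ (Submodule.subset_span ⟨⟨i + 1, h⟩, rfl⟩)
      · have : (i : ℕ).succ = r := by have := i.2; omega
        rw [this]; exact hr
    | zero => rw [nab_zero]; exact Submodule.zero_mem _
    | add x y _ _ hx hy => rw [nab_add]; exact Submodule.add_mem _ hx hy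
    | smul c x hx' hx =>
      rw [nab_smul]
      exact Submodule.add_mem _ (Submodule.smul_mem _ _ (span_le_satW _ _ hx')) (Submodule.smul_mem _ _ hx)
  obtain ⟨g, hg, h⟩ := id hw
  have h1 := key _ h
  rw [nab_smul] at h1
  apply satW_sat s g hg
  have := Submodule.sub_mem _ h1 (Submodule.smul_mem _ (th g) hw)
  simpa using this

lemma nab_det_ne (a b : ℂ) (ha : ∀ n : ℤ, a ≠ n) (hb : ∀ n : ℤ, b ≠ n) (hab : ∀ n : ℤ, a + b ≠ n)
    (D : ℕ) (p : ℕ → ℂ[X]) (hp : p D ≠ 0) (hp' : ∀ j, D < j → p j = 0) :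
    (Matrix.of fun i j : Fin (D + 1) => (nab a b D)^[i] p j).det ≠ 0 := by
  intro hdet
  rw [← Matrix.exists_vecMul_eq_zero_iff] at hdet
  obtain ⟨v, hv0, hv⟩ := hdet
  have hsupp : ∀ i j, D < j → (nab a b D)^[i] p j = 0 := by
    intro i
    induction i with
    | zero => simpa using hp'
    | succ i ih => rw [Function.iterate_succ_apply']; exact nab_supp a b D D _ ih
  have hrel : ∑ i : Fin (D+1), v i • (nab a b D)^[i] p = 0 := by
    funext j
    by_cases hj : D < j
    · simp [hsupp _ j hj]
    · have := congrFun hv ⟨j, by omega⟩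
      simpa [Matrix.vecMul, dotProduct] using this
  -- top index
  have hex : ∃ r : Fin (D+1), v r ≠ 0 ∧ ∀ i, r < i → v i = 0 := by
    have hne : (Finset.univ.filter fun i => v i ≠ 0).Nonempty := by
      by_contra h
      rw [Finset.not_nonempty_iff_eq_empty, Finset.filter_eq_empty_iff] at h
      apply hv0; funext i; simpa using h (Finset.mem_univ i)
    refine ⟨_, (Finset.mem_filter.mp (Finset.max'_mem _ hne)).2, ?_⟩
    intro i hi
    by_contra h
    have := Finset.le_max' (Finset.univ.filter fun i => v i ≠ 0) i (Finset.mem_filter.mpr ⟨Finset.mem_univ i, h⟩)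
    exact absurd hi (not_lt.mpr this)
  obtain ⟨r, hr0, hr⟩ := hex
  set s := Set.range fun i : Fin (r : ℕ) => (nab a b D)^[i] p with hs
  have hrW : (nab a b D)^[(r : ℕ)] p ∈ satW s := by
    refine ⟨v r, hr0, ?_⟩
    have h1 : v r • (nab a b D)^[(r:ℕ)] p = - ∑ i ∈ Finset.univ.erase r, v i • (nab a b D)^[(i:ℕ)] p := by
      rw [eq_neg_iff_add_eq_zero, Finset.add_sum_erase _ (fun i : Fin (D+1) => v i • (nab a b D)^[(i:ℕ)] p) (Finset.mem_univ r)]; exact hrel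
    rw [h1]
    refine Submodule.neg_mem _ (Submodule.sum_mem _ ?_)
    intro i hi
    rcases lt_trichotomy i r with h | h | h
    · exact Submodule.smul_mem _ _ (Submodule.subset_span ⟨⟨i, h⟩, rfl⟩)
    · exact absurd h (Finset.ne_of_mem_erase hi)
    · rw [hr i h]; simp
  have hst := satW_stable a b D r p hrW
  have hrpos : 0 < (r : ℕ) := by
    by_contra h0
    have h0 : (r : ℕ) = 0 := by omega
    obtain ⟨g, hg, h⟩ := hrW
    have : s = ∅ := by
      rw [hs, Set.range_eq_empty_iff, h0]; infer_instance
    rw [this, Submodule.span_empty, Submodule.mem_bot, h0] at h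
    have := congrFun h D
    simp [hg, hp] at this
  have hpW : p ∈ satW s := span_le_satW _ _ (Submodule.subset_span ⟨⟨0, hrpos⟩, rfl⟩)
  have hdesc : ∀ e ≤ D, ∃ w ∈ satW s, w (D - e) ≠ 0 ∧ ∀ j, D - e < j → w j = 0 := by
    intro e
    induction e with
    | zero => intro _; exact ⟨p, hpW, by simpa using hp, by simpa using hp'⟩
    | succ e ih =>
      intro he
      obtain ⟨w, hw, h1, h2⟩ := ih (by omega)
      obtain ⟨d, hd⟩ : ∃ d, D - e = d + 1 := ⟨D - e - 1, by omega⟩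
      rw [hd] at h1 h2
      have hd' : D - (e + 1) = d := by omega
      rw [hd']
      set g := w (d+1)
      refine ⟨g • nab a b D w - (th g + C ((D : ℂ) - (d + 1 : ℕ)) * rhoP a b * g) • w,
        Submodule.sub_mem _ (Submodule.smul_mem _ _ (hst _ hw)) (Submodule.smul_mem _ _ hw), ?_, ?_⟩
      · have h3 := alg_ne a b ha hb hab (w d) g h1 (d + 1) (by omega)
        convert h3 using 1
        simp only [nab, Pi.sub_apply, Pi.smul_apply, smul_eq_mul]
        push_cast
        simp only [map_sub, map_add, map_natCast, map_one]
        ring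
      · intro j hj
        rcases Nat.lt_or_ge (d+1) j with h | h
        · simp [h2 j h, nab_supp a b D (d+1) w h2 j h]
        · have : j = d + 1 := by omega
          subst this
          simp only [nab, Pi.sub_apply, Pi.smul_apply, smul_eq_mul, h2 (d+1+1) (by omega)]
          ring
  have hdesc' : ∀ d : Fin (D+1), ∃ w ∈ Submodule.span ℂ[X] s, w d ≠ 0 ∧ ∀ j, (d:ℕ) < j → w j = 0 := by
    intro d
    obtain ⟨w, ⟨g, hg, hw⟩, h1, h2⟩ := hdesc (D - d) (by omega)
    rw [show D - (D - (d:ℕ)) = d by have := d.2; omega] at h1 h2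
    exact ⟨g • w, hw, by simp [hg, h1], fun j hj => by simp [h2 j hj]⟩
  choose w hw1 hw2 hw3 using hdesc'
  have hli : LinearIndependent ℂ[X] w := by
    rw [Fintype.linearIndependent_iff]
    intro c hc
    by_contra hcon
    push Not at hcon
    have hne : (Finset.univ.filter fun i => c i ≠ 0).Nonempty := by
      obtain ⟨i, hi⟩ := hcon
      exact ⟨i, by simpa using hi⟩
    set d := (Finset.univ.filter fun i => c i ≠ 0).max' hne with hd
    have hcd : c d ≠ 0 := (Finset.mem_filter.mp (Finset.max'_mem _ hne)).2
    have h1 := congrFun hc d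
    simp only [Finset.sum_apply, Pi.smul_apply, smul_eq_mul, Pi.zero_apply] at h1
    rw [Finset.sum_eq_single d] at h1
    · exact (mul_ne_zero hcd (hw2 d)) h1
    · intro i _ hi
      rcases lt_or_gt_of_ne hi with h | h
      · rw [hw3 i d h, mul_zero]
      · have : c i = 0 := by
          by_contra h'
          have := Finset.le_max' (Finset.univ.filter fun i => c i ≠ 0) i (Finset.mem_filter.mpr ⟨Finset.mem_univ i, h'⟩)
          exact absurd h (not_lt.mpr this)
        rw [this, zero_mul]
    · simp
  classical
  have : Fintype s := Set.fintypeRange _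
  have hcard := linearIndependent_le_span_aux' w hli s (by
    rintro _ ⟨i, rfl⟩; exact hw1 i)
  have : Fintype.card s ≤ r := by
    refine le_trans ?_ (Fintype.card_fin r).le
    convert Fintype.card_range_le (fun i : Fin (r : ℕ) => (nab a b D)^[i] p)
  rw [Fintype.card_fin] at hcard
  have := r.2
  omega

end SB
end

section
open PowerSeries

namespace SB

/-- binomial coefficients of (1-x)^(b-1), b = q / N -/
def eF (F : Type) [Field F] (N q : ℕ) : ℕ → F
  | 0 => 1
  | (k + 1) => (((k : F) + 1) - (q : F) / N) / ((k : F) + 1) * eF F N q k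

noncomputable def E0 (F : Type) [Field F] (N q : ℕ) : F⟦X⟧ := PowerSeries.mk (eF F N q)
noncomputable def U0 (F : Type) [Field F] (N p q : ℕ) : F⟦X⟧ :=
  PowerSeries.mk fun k => eF F N q k / ((p : F) / N + k)

noncomputable def ES (F : Type) [Field F] (N p q : ℕ) (hN : N ≠ 0) : F⟦X⟧ := X ^ p * expand N hN (E0 F N q)
noncomputable def YS (F : Type) [Field F] (N p q : ℕ) (hN : N ≠ 0) : F⟦X⟧ := (1 - X ^ N) * ES F N p q hN
noncomputable def US (F : Type) [Field F] (N p q : ℕ) (hN : N ≠ 0) : F⟦X⟧ := X ^ p * expand N hN (U0 F N p q)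

lemma map_eF {F G : Type} [Field F] [Field G] (s : F →+* G) (N q k : ℕ) : s (eF F N q k) = eF G N q k := by
  induction k with
  | zero => simp [eF]
  | succ k ih => simp [eF, ih]

lemma map_YS {F G : Type} [Field F] [Field G] (s : F →+* G) (N p q : ℕ) (hN : N ≠ 0) :
    PowerSeries.map s (YS F N p q hN) = YS G N p q hN := by
  have : PowerSeries.map s (E0 F N q) = E0 G N q := by
    ext k; simp [E0, map_eF]
  simp [YS, ES, map_expand, this]

lemma map_US {F G : Type} [Field F] [Field G] (s : F →+* G) (N p q : ℕ) (hN : N ≠ 0) :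
    PowerSeries.map s (US F N p q hN) = US G N p q hN := by
  have : PowerSeries.map s (U0 F N p q) = U0 G N p q := by
    ext k; simp [U0, map_eF]
  simp [US, map_expand, this]

/-- t d/dt divided by N -/
noncomputable def DN (N : ℕ) : Derivation ℂ ℂ⟦X⟧ ℂ⟦X⟧ := (C (1 / (N : ℂ)) * X) • derivative ℂ

lemma DN_coeff (N : ℕ) (f : ℂ⟦X⟧) (n : ℕ) : coeff n (DN N f) = (n : ℂ) / N * coeff n f := by
  simp only [DN, Derivation.smul_apply, smul_eq_mul, mul_assoc]
  rw [coeff_C_mul]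
  cases n with
  | zero => simp
  | succ n =>
    rw [coeff_succ_X_mul, coeff_derivative]; push_cast; ring

lemma DN_expand (N : ℕ) (hN : N ≠ 0) (f : ℂ⟦X⟧) : DN N (expand N hN f) = expand N hN (DN 1 f) := by
  have hN' : (N : ℂ) ≠ 0 := by exact_mod_cast hN
  ext n
  rw [DN_coeff]
  by_cases h : N ∣ n
  · obtain ⟨m, rfl⟩ := h
    rw [coeff_expand_mul, coeff_expand_mul, DN_coeff]
    push_cast; field_simp
  · rw [coeff_expand_of_not_dvd _ _ _ h, coeff_expand_of_not_dvd _ _ _ h, mul_zero]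

lemma DN_Xpow (N p : ℕ) : DN N (X ^ p) = C ((p : ℂ) / N) * X ^ p := by
  ext n; rw [DN_coeff, coeff_C_mul, coeff_X_pow]; split_ifs with h <;> simp [h]

lemma DN_E0 (N q : ℕ) : (1 - X) * DN 1 (E0 ℂ N q) = C (1 - (q : ℂ) / N) * X * E0 ℂ N q := by
  ext n
  rw [sub_mul, map_sub, one_mul, mul_assoc, coeff_C_mul, DN_coeff]
  cases n with
  | zero => simp
  | succ n =>
    rw [coeff_succ_X_mul, coeff_succ_X_mul, DN_coeff]
    have : (n : ℂ) + 1 ≠ 0 := by exact_mod_cast Nat.succ_ne_zero n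
    simp only [E0, coeff_mk, eF]
    push_cast; field_simp; ring

lemma DN_U0 (N p q : ℕ) (hN : N ≠ 0) (hp : 0 < p) :
    C ((p : ℂ) / N) * U0 ℂ N p q + DN 1 (U0 ℂ N p q) = E0 ℂ N q := by
  ext n
  rw [map_add, coeff_C_mul, DN_coeff]
  simp only [U0, E0, coeff_mk]
  have hN' : (N : ℂ) ≠ 0 := by exact_mod_cast hN
  have : (p : ℂ) / N + n ≠ 0 := by
    have h2 : (p : ℂ) + n * N ≠ 0 := by exact_mod_cast (by positivity : 0 < p + n * N).ne'
    intro h; apply h2; field_simp at h; linear_combination h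
  rw [Nat.cast_one, div_one, ← add_mul, mul_div_cancel₀ _ this]

noncomputable def TH (N : ℕ) : Derivation ℂ ℂ⟦X⟧ ℂ⟦X⟧ := ((1 - X ^ N : ℂ⟦X⟧)) • DN N

lemma TH_X (N : ℕ) (hN : N ≠ 0) : TH N (X ^ N) = X ^ N * (1 - X ^ N) := by
  have hN' : (N : ℂ) ≠ 0 := by exact_mod_cast hN
  simp only [TH, Derivation.smul_apply, smul_eq_mul]
  rw [DN_Xpow, div_self hN']; simp; ring

lemma TH_ES (N p q : ℕ) (hN : N ≠ 0) : TH N (ES ℂ N p q hN) =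
    (C ((p : ℂ) / N) * (1 - X ^ N) + C (1 - (q : ℂ) / N) * X ^ N) * ES ℂ N p q hN := by
  have h := congrArg (expand N hN) (DN_E0 N q)
  simp only [map_mul, map_sub, map_one, expand_X, expand_C] at h
  simp only [TH, Derivation.smul_apply, smul_eq_mul, ES, Derivation.leibniz, DN_expand, DN_Xpow]
  simp only [map_sub, map_one]
  linear_combination X ^ p * h

lemma TH_YS (N p q : ℕ) (hN : N ≠ 0) : TH N (YS ℂ N p q hN) =
    (C ((p : ℂ) / N) - C ((p : ℂ) / N + (q : ℂ) / N) * X ^ N) * YS ℂ N p q hN := by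
  rw [YS, Derivation.leibniz, map_sub, TH_X N hN, TH_ES]
  simp
  ring

lemma TH_US (N p q : ℕ) (hN : N ≠ 0) (hp : 0 < p) : TH N (US ℂ N p q hN) = YS ℂ N p q hN := by
  have h := congrArg (expand N hN) (DN_U0 N p q hN hp)
  simp only [map_mul, map_add, expand_C] at h
  simp only [TH, Derivation.smul_apply, smul_eq_mul, US, Derivation.leibniz, DN_expand, DN_Xpow, YS, ES, ← h]
  ring

lemma TH_dvd (N m : ℕ) (f : ℂ⟦X⟧) (h : X ^ m ∣ f) : X ^ m ∣ TH N f := by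
  simp only [TH, Derivation.smul_apply, smul_eq_mul]
  apply Dvd.dvd.mul_left
  rw [X_pow_dvd_iff] at h ⊢
  intro k hk
  rw [DN_coeff, h k hk, mul_zero]

/-- polynomials evaluated at t^N -/
noncomputable def pS {F : Type} [Field F] (N : ℕ) (f : Polynomial F) : F⟦X⟧ := Polynomial.aeval (X ^ N : F⟦X⟧) f

noncomputable def evS {F : Type} [Field F] (N p q : ℕ) (hN : N ≠ 0) (D : ℕ) (P : ℕ → Polynomial F) (β : F) : F⟦X⟧ :=
  ∑ j ∈ Finset.range (D + 1), pS N (P j) * YS F N p q hN ^ (D - j) * (US F N p q hN + C β) ^ j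

lemma TH_pS (N : ℕ) (hN : N ≠ 0) (f : Polynomial ℂ) : TH N (pS N f) = pS N (th f) := by
  rw [pS, Derivation.map_aeval, TH_X N hN]
  simp [pS, th]; ring

lemma TH_evS (N p q : ℕ) (hN : N ≠ 0) (hp : 0 < p) (D : ℕ) (P : ℕ → Polynomial ℂ) (hP : ∀ j, D < j → P j = 0) (β : ℂ) :
    TH N (evS N p q hN D P β) = evS N p q hN D (nab ((p:ℂ)/N) ((q:ℂ)/N) D P) β := by
  set Y := YS ℂ N p q hN
  set U := US ℂ N p q hN + C β
  have hU : TH N U = Y := by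
    simp only [U, map_add, TH_US N p q hN hp]
    have : TH N (C β) = 0 := by
      have := (TH N).map_algebraMap β
      simpa [PowerSeries.algebraMap_apply] using this
    rw [this, add_zero]
  set ρ : ℂ⟦X⟧ := (C ((p : ℂ) / N) - C ((p : ℂ) / N + (q : ℂ) / N) * X ^ N)
  have hY : TH N Y = ρ * Y := TH_YS N p q hN
  have h1 : ∀ j, j ≤ D → TH N (pS N (P j) * Y ^ (D - j) * U ^ j) = pS N (th (P j)) * Y ^ (D - j) * U ^ j
      + C ((D : ℂ) - j) * ρ * (pS N (P j) * Y ^ (D - j) * U ^ j) + (j : ℂ⟦X⟧) * pS N (P j) * Y ^ (D - j + 1) * U ^ (j - 1) := by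
    intro j hj
    simp only [Derivation.leibniz, Derivation.leibniz_pow, hY, hU, TH_pS N hN, smul_eq_mul, nsmul_eq_mul]
    have : (C ((D : ℂ) - j)) = ((D - j : ℕ) : ℂ⟦X⟧) := by
      rw [← Nat.cast_sub hj]; simp
    rw [this]
    rcases Nat.eq_zero_or_pos (D - j) with h0 | h0
    · rw [h0]; simp; ring
    · obtain ⟨k, hk⟩ := Nat.exists_eq_succ_of_ne_zero h0.ne'
      rw [hk]
      simp only [Nat.succ_eq_add_one, Nat.add_sub_cancel]
      ring
  simp only [evS]
  rw [map_sum, Finset.sum_congr rfl (fun j hj => h1 j (by simpa [Nat.lt_succ_iff] using hj))]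
  rw [Finset.sum_add_distrib]
  have h2 : ∑ j ∈ Finset.range (D + 1), (j : ℂ⟦X⟧) * pS N (P j) * Y ^ (D - j + 1) * U ^ (j - 1)
     = ∑ j ∈ Finset.range (D + 1), ((j : ℂ⟦X⟧) + 1) * pS N (P (j + 1)) * Y ^ (D - j) * U ^ j := by
    rw [Finset.sum_range_succ', Finset.sum_range_succ]
    have hD : pS N (P (D + 1)) = 0 := by rw [hP _ (by omega)]; simp [pS]
    rw [hD]
    simp only [Nat.cast_zero, zero_mul, mul_zero, add_zero]
    apply Finset.sum_congr rfl
    intro j hj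
    have : j < D := by simpa using hj
    rw [show D - (j + 1) + 1 = D - j by omega]
    push_cast; simp
  rw [h2, ← Finset.sum_add_distrib]
  apply Finset.sum_congr rfl
  intro j hj
  have : pS N (nab ((p:ℂ)/N) ((q:ℂ)/N) D P j) = pS N (th (P j)) + C ((D : ℂ) - j) * ρ * pS N (P j) +
     ((j : ℂ⟦X⟧) + 1) * pS N (P (j + 1)) := by
    simp only [nab, rhoP, pS, map_add, map_mul, map_sub, Polynomial.aeval_C, Polynomial.aeval_X, ρ]
    simp [PowerSeries.algebraMap_apply]
  rw [this]; ring

end SB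
end

section
open PowerSeries

namespace SB

lemma nab_natDegree (a b : ℂ) (D L : ℕ) (P : ℕ → Polynomial ℂ) (hP : ∀ j, (P j).natDegree ≤ L) (j : ℕ) :
    (nab a b D P j).natDegree ≤ L + 1 := by
  have h1 : (th (P j)).natDegree ≤ L + 1 := by
    by_cases hn : (P j).natDegree = 0
    · have : Polynomial.derivative (P j) = 0 := by
        rw [Polynomial.eq_C_of_natDegree_eq_zero hn]; simp
      simp [th, this]
    · refine Polynomial.natDegree_mul_le.trans ?_
      have h2 := Polynomial.natDegree_derivative_lt hn
      have h3 : (Polynomial.X * (1 - Polynomial.X) : Polynomial ℂ).natDegree ≤ 2 := by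
        compute_degree
      have := hP j
      omega
  have h2 : (Polynomial.C ((D : ℂ) - j) * rhoP a b * P j).natDegree ≤ L + 1 := by
    refine Polynomial.natDegree_mul_le.trans ?_
    have : (Polynomial.C ((D : ℂ) - j) * rhoP a b).natDegree ≤ 1 := by
      unfold rhoP; compute_degree
    have := hP j
    omega
  have h3 : (Polynomial.C ((j : ℂ) + 1) * P (j + 1)).natDegree ≤ L + 1 := by
    refine Polynomial.natDegree_C_mul_le _ _ |>.trans ?_
    have := hP (j + 1); omega
  exact Polynomial.natDegree_add_le_of_degree_le (Polynomial.natDegree_add_le_of_degree_le h1 h2) h3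

lemma YS_eq (N p q : ℕ) (hN : N ≠ 0) : ∃ V : ℂ⟦X⟧, constantCoeff V = 1 ∧ YS ℂ N p q hN = X ^ p * V := by
  refine ⟨(1 - X ^ N) * expand N hN (E0 ℂ N q), ?_, ?_⟩
  · rw [map_mul, constantCoeff_expand]
    have : constantCoeff (E0 ℂ N q) = 1 := by
      rw [← coeff_zero_eq_constantCoeff_apply]; simp only [E0, coeff_mk, eF]
    simp [hN, this]
  · rw [YS, ES]; ring

lemma zero_est_aux (N p q : ℕ) (hN : N ≠ 0) (hp : 0 < p)
    (ha : ∀ n : ℤ, (p : ℂ) / N ≠ n) (hb : ∀ n : ℤ, (q : ℂ) / N ≠ n)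
    (hab : ∀ n : ℤ, (p : ℂ) / N + (q : ℂ) / N ≠ n) (D L m k : ℕ) (P : ℕ → Polynomial ℂ)
    (hL : ∀ j, (P j).natDegree ≤ L) (h0 : P D ≠ 0) (h1 : ∀ j, D < j → P j = 0)
    (hdvd : X ^ m ∣ YS ℂ N p q hN ^ k * evS N p q hN D P 0) :
    m ≤ N * ((D + 1) * (L + D)) + p * (D + k) := by
  set a : ℂ := (p : ℂ) / N
  set b : ℂ := (q : ℂ) / N
  set M : Matrix (Fin (D+1)) (Fin (D+1)) (Polynomial ℂ) := Matrix.of fun i j : Fin (D + 1) => (nab a b D)^[i] P j with hM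
  have hdet := nab_det_ne a b ha hb hab D P h0 h1
  change M.det ≠ 0 at hdet
  set Y := YS ℂ N p q hN
  have hsupp : ∀ i j, D < j → (nab a b D)^[i] P j = 0 := by
    intro i
    induction i with
    | zero => simpa using h1
    | succ i ih => rw [Function.iterate_succ_apply']; exact nab_supp a b D D _ ih
  have hd : ∀ i, X ^ m ∣ Y ^ k * evS N p q hN D ((nab a b D)^[i] P) 0 := by
    intro i
    induction i with
    | zero => exact hdvd
    | succ i ih =>
      have e1 := TH_evS N p q hN hp D ((nab a b D)^[i] P) (hsupp i) 0
      rw [Function.iterate_succ_apply', ← e1]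
      have e2 := TH_dvd N m _ ih
      rw [Derivation.leibniz, Derivation.leibniz_pow, TH_YS] at e2
      set f := evS N p q hN D ((nab a b D)^[i] P) 0
      simp only [smul_eq_mul, nsmul_eq_mul] at e2
      refine (dvd_add_left ?_).mp e2
      rcases Nat.eq_zero_or_pos k with hk | hk
      · rw [hk]; simp
      · obtain ⟨k', rfl⟩ := Nat.exists_eq_succ_of_ne_zero hk.ne'
        refine (ih.mul_left (((k' + 1 : ℕ) : ℂ⟦X⟧) * ((C ((p : ℂ) / N) - C ((p : ℂ) / N + (q : ℂ) / N) * X ^ N)))).trans (dvd_of_eq ?_)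
        simp only [Nat.succ_eq_add_one, Nat.add_sub_cancel, Y]
        ring
  -- matrix
  let φ : Polynomial ℂ →+* ℂ⟦X⟧ := (Polynomial.aeval (X ^ N : ℂ⟦X⟧)).toRingHom
  have hφ : ∀ f, φ f = pS N f := fun f => rfl
  set M' := M.map φ
  set y : Fin (D+1) → ℂ⟦X⟧ := fun j => Y ^ k * (Y ^ (D - j) * US ℂ N p q hN ^ (j:ℕ)) with hy
  have hMy : ∀ i, X ^ m ∣ (M'.mulVec y) i := by
    intro i
    refine (hd i).trans (dvd_of_eq ?_)
    simp only [evS, Matrix.mulVec, dotProduct, hy]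
    rw [Finset.sum_range, Finset.mul_sum]
    apply Finset.sum_congr rfl
    intro j _
    simp [M', M, hφ, Y]; ring
  have hdetY : X ^ m ∣ pS N M.det * Y ^ (D + k) := by
    have e : (M'.adjugate.mulVec (M'.mulVec y)) 0 = pS N M.det * Y ^ (D + k) := by
      rw [Matrix.mulVec_mulVec, Matrix.adjugate_mul, Matrix.smul_mulVec, Matrix.one_mulVec]
      have : M'.det = pS N M.det := by rw [← hφ, RingHom.map_det]; rfl
      simp only [this, hy, Pi.smul_apply, smul_eq_mul, Fin.val_zero, Nat.sub_zero, pow_zero, mul_one]; ring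
    rw [← e]
    simp only [Matrix.mulVec, dotProduct]
    exact Finset.dvd_sum fun i _ => (hMy i).mul_left _
  -- degree
  have hdeg : M.det.natDegree ≤ (D + 1) * (L + D) := by
    have hent : ∀ i, i ≤ D → ∀ j, ((nab a b D)^[i] P j).natDegree ≤ L + i := by
      intro i
      induction i with
      | zero => intro _ j; simpa using hL j
      | succ i ih => 
        intro hi j
        rw [Function.iterate_succ_apply']
        exact nab_natDegree a b D (L + i) _ (ih (by omega)) j
    rw [Matrix.det_apply]
    refine Polynomial.natDegree_sum_le_of_forall_le _ _ ?_
    intro s _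
    refine (Polynomial.natDegree_smul_le _ _).trans ?_
    refine (Polynomial.natDegree_prod_le _ _).trans ?_
    refine (Finset.sum_le_card_nsmul _ _ (L + D) ?_).trans (by simp)
    intro i _
    refine (hent (s i) (by have := (s i).2; omega) i).trans ?_
    have := (s i).2; omega
  obtain ⟨g, hg, hg'⟩ := Polynomial.exists_eq_pow_rootMultiplicity_mul_and_not_dvd M.det hdet 0
  set r := M.det.rootMultiplicity 0
  have hr : r ≤ M.det.natDegree := by
    have := Polynomial.rootMultiplicity_le_iff hdet 0 (M.det.natDegree)
    rw [this]
    intro h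
    have := Polynomial.natDegree_le_of_dvd h hdet
    simp at this
  obtain ⟨V, hV1, hV2⟩ := YS_eq N p q hN
  have hW : pS N M.det * Y ^ (D + k) = X ^ (N * r + p * (D + k)) * (pS N g * V ^ (D + k)) := by
    rw [hg]
    simp only [pS, map_mul, map_pow, Polynomial.aeval_X, map_zero, sub_zero]
    rw [show Y = X ^ p * V from hV2, mul_pow, ← pow_mul, ← pow_mul]; ring
  rw [hW, X_pow_dvd_iff] at hdetY
  by_contra hcon
  have hlt : N * r + p * (D + k) < m := by
    have := Nat.mul_le_mul_left N (hr.trans hdeg)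
    omega
  have h3 := hdetY _ hlt
  rw [coeff_X_pow_mul', if_pos le_rfl, Nat.sub_self, coeff_zero_eq_constantCoeff_apply, map_mul, map_pow, hV1, one_pow, mul_one] at h3
  apply hg'
  have h4 : constantCoeff (pS N g) = Polynomial.eval 0 g := by
    have : (constantCoeff (R := ℂ)) (pS N g) = Polynomial.eval₂ ((constantCoeff (R := ℂ)).comp (algebraMap ℂ ℂ⟦X⟧)) ((constantCoeff (R := ℂ)) (X ^ N)) g := by
      rw [← Polynomial.hom_eval₂]; rfl
    rw [this, Polynomial.eval]
    congr 1
    simp [hN]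
  rw [Polynomial.dvd_iff_isRoot, Polynomial.IsRoot.def, ← h4, h3]

theorem zero_est (N p q : ℕ) (hN : N ≠ 0) (hp : 0 < p)
    (ha : ∀ n : ℤ, (p : ℂ) / N ≠ n) (hb : ∀ n : ℤ, (q : ℂ) / N ≠ n)
    (hab : ∀ n : ℤ, (p : ℂ) / N + (q : ℂ) / N ≠ n) (J L m : ℕ) (P : ℕ → Polynomial ℂ)
    (hL : ∀ j, (P j).natDegree ≤ L) (h0 : ∃ j ≤ J, P j ≠ 0)
    (hdvd : X ^ m ∣ evS N p q hN J P 0) :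
    m ≤ N * ((J + 1) * (L + J)) + p * J := by
  classical
  set d := Nat.findGreatest (fun j => P j ≠ 0) J with hd
  obtain ⟨j0, hj0, hj0'⟩ := h0
  have hdJ : d ≤ J := Nat.findGreatest_le J
  have hPd : P d ≠ 0 := Nat.findGreatest_spec (P := fun j => P j ≠ 0) hj0 hj0'
  have hPj : ∀ j, d < j → j ≤ J → P j = 0 := by
    intro j h1 h2
    by_contra h
    exact absurd (Nat.le_findGreatest (P := fun j => P j ≠ 0) h2 h) (by omega)
  set P' : ℕ → Polynomial ℂ := fun j => if j ≤ d then P j else 0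
  have e : evS N p q hN J P 0 = YS ℂ N p q hN ^ (J - d) * evS N p q hN d P' 0 := by
    simp only [evS]
    rw [Finset.mul_sum]
    rw [← Finset.sum_subset (Finset.range_subset_range.mpr (show d + 1 ≤ J + 1 by omega))]
    · apply Finset.sum_congr rfl
      intro j hj
      have hj : j ≤ d := by simpa [Nat.lt_succ_iff] using hj
      simp only [P', if_pos hj]
      rw [show J - j = (J - d) + (d - j) by omega, pow_add]; ring
    · intro j h1 h2
      rw [hPj j (by simpa using h2) (by simpa [Nat.lt_succ_iff] using h1)]
      simp [pS]
  rw [e] at hdvd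
  have := zero_est_aux N p q hN hp ha hb hab d L m (J - d) P' (fun j => by
    simp only [P']; split_ifs <;> simp [hL]) (by simpa [P'] using hPd) (fun j hj => by simp [P', hj]) hdvd
  rw [show d + (J - d) = J by omega] at this
  refine this.trans ?_
  gcongr

end SB
end

section
open PowerSeries

namespace SB

/-! integrality -/

noncomputable def intSub (F : Type) [Field F] (N : ℕ) : Subring F⟦X⟧ where
  carrier := {f | ∀ n, IsIntegral ℤ ((N : F) ^ n * (n.factorial : F) * coeff n f)}
  zero_mem' := by intro n; simp [isIntegral_zero]
  one_mem' := by
    intro n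
    rw [coeff_one]
    split_ifs with h
    · subst h; simp [isIntegral_one]
    · simp [isIntegral_zero]
  add_mem' := by
    intro f g hf hg n
    rw [map_add, mul_add]
    exact (hf n).add (hg n)
  neg_mem' := by
    intro f hf n
    rw [map_neg, mul_neg]
    exact (hf n).neg
  mul_mem' := by
    intro f g hf hg n
    rw [coeff_mul, Finset.mul_sum]
    refine IsIntegral.sum _ ?_
    rintro ⟨i, j⟩ hij
    have hij : i + j = n := by simpa using hij
    subst hij
    have : (N : F) ^ (i + j) * ((i + j).factorial : F) * (coeff i f * coeff j g) =
      (((i+j).choose j : ℤ) : F) * (((N : F) ^ i * (i.factorial : F) * coeff i f) * ((N : F) ^ j * (j.factorial : F) * coeff j g)) := by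
      rw [← Nat.add_choose_mul_factorial_mul_factorial i j]
      push_cast; ring
    rw [this]
    exact (isIntegral_algebraMap (R := ℤ) (A := F)).mul ((hf i).mul (hg j))

lemma intSub_Xpow (F : Type) [Field F] (N k : ℕ) : (X : F⟦X⟧) ^ k ∈ intSub F N := by
  intro n
  rw [coeff_X_pow]
  split_ifs
  · have : (N : F) ^ n * (n.factorial : F) * 1 = ((N ^ n * n.factorial : ℕ) : F) := by push_cast; ring
    rw [this]
    simpa using (isIntegral_algebraMap (R := ℤ) (A := F) (x := ((N ^ n * n.factorial : ℕ) : ℤ)))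
  · simp [isIntegral_zero]

lemma intSub_C (F : Type) [Field F] (N : ℕ) (c : F) (hc : IsIntegral ℤ c) : (C c : F⟦X⟧) ∈ intSub F N := by
  intro n
  rw [coeff_C]
  split_ifs with h
  · subst h; simpa using hc
  · simp [isIntegral_zero]

lemma eF_int (F : Type) [Field F] [CharZero F] (N q : ℕ) (hN : N ≠ 0) (k : ℕ) :
    ∃ z : ℤ, (N : F) ^ k * (k.factorial : F) * eF F N q k = z := by
  have hN' : (N : F) ≠ 0 := by exact_mod_cast hN
  induction k with
  | zero => exact ⟨1, by simp [eF]⟩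
  | succ k ih =>
    obtain ⟨z, hz⟩ := ih
    refine ⟨(N * (k + 1) - q) * z, ?_⟩
    have : (k : F) + 1 ≠ 0 := by exact_mod_cast Nat.succ_ne_zero k
    push_cast
    rw [← hz, Nat.factorial_succ, eF]
    push_cast
    field_simp
    ring

lemma intSub_ES (F : Type) [Field F] [CharZero F] (N p q : ℕ) (hN : N ≠ 0) :
    ES F N p q hN ∈ intSub F N := by
  refine Subring.mul_mem _ (intSub_Xpow F N p) ?_
  intro n
  by_cases h : N ∣ n
  · obtain ⟨m, rfl⟩ := h
    rw [coeff_expand_mul, E0, coeff_mk]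
    obtain ⟨z, hz⟩ := eF_int F N q hN m
    have hm : m ≤ N * m := Nat.le_mul_of_pos_left m (Nat.pos_of_ne_zero hN)
    obtain ⟨c, hc⟩ := Nat.factorial_dvd_factorial hm
    have : (N : F) ^ (N * m) * ((N * m).factorial : F) * eF F N q m = ((N ^ (N * m - m) * c * z : ℤ) : F) := by
      rw [hc]; push_cast; rw [← hz]
      conv_lhs => rw [show N * m = (N * m - m) + m by omega, pow_add]
      ring
    rw [this]; exact isIntegral_algebraMap
  · rw [coeff_expand_of_not_dvd _ _ _ h]; simp [isIntegral_zero]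

lemma intSub_YS (F : Type) [Field F] [CharZero F] (N p q : ℕ) (hN : N ≠ 0) :
    YS F N p q hN ∈ intSub F N :=
  Subring.mul_mem _ (Subring.sub_mem _ (Subring.one_mem _) (intSub_Xpow F N N)) (intSub_ES F N p q hN)

lemma intSub_US (F : Type) [Field F] [CharZero F] (N p q : ℕ) (hN : N ≠ 0) (hp : 0 < p) :
    US F N p q hN ∈ intSub F N := by
  have hN' : (N : F) ≠ 0 := by exact_mod_cast hN
  intro n
  rw [US, coeff_X_pow_mul']
  split_ifs with hpn
  swap
  · simp [isIntegral_zero]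
  by_cases h : N ∣ n - p
  · obtain ⟨m, hm⟩ := h
    rw [hm, coeff_expand_mul, U0, coeff_mk]
    have hn : n = N * m + p := by omega
    obtain ⟨z, hz⟩ := eF_int F N q hN m
    have hmn : m + 1 ≤ n := by
      have : m ≤ N * m := Nat.le_mul_of_pos_left m (Nat.pos_of_ne_zero hN)
      omega
    obtain ⟨k, rfl⟩ := Nat.exists_eq_succ_of_ne_zero (by omega : n ≠ 0)
    obtain ⟨c, hc⟩ := Nat.factorial_dvd_factorial (by omega : m ≤ k)
    have hk : (k : F) + 1 ≠ 0 := by exact_mod_cast Nat.succ_ne_zero k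
    have hden : (p : F) / N + m = ((k : F) + 1) / N := by
      have : ((k : F) + 1) = N * m + p := by exact_mod_cast hn
      rw [this]; field_simp; ring
    have : (N : F) ^ (k.succ) * (k.succ.factorial : F) * (eF F N q m / ((p : F) / N + m)) = ((N * N * N ^ (k - m) * c * z : ℤ) : F) := by
      rw [hden, Nat.factorial_succ, hc]; push_cast; rw [← hz]
      rw [show k.succ = (k - m) + m + 1 by omega, pow_add, pow_add]
      field_simp
    rw [this]; exact isIntegral_algebraMap
  · rw [coeff_expand_of_not_dvd _ _ _ h]; simp [isIntegral_zero]

lemma intSub_pS (F : Type) [Field F] (N : ℕ) (f : Polynomial F) (hf : ∀ i, IsIntegral ℤ (f.coeff i)) :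
    pS N f ∈ intSub F N := by
  rw [pS, Polynomial.aeval_eq_sum_range]
  refine Subring.sum_mem _ fun i _ => ?_
  rw [PowerSeries.smul_eq_C_mul, ← pow_mul]
  exact Subring.mul_mem _ (intSub_C F N _ (hf i)) (intSub_Xpow F N _)

lemma evS_int (F : Type) [Field F] [CharZero F] (N p q : ℕ) (hN : N ≠ 0) (hp : 0 < p) (J : ℕ)
    (P : ℕ → Polynomial F) (hP : ∀ j i, IsIntegral ℤ ((P j).coeff i)) (δ : ℕ) (β : F) (hβ : IsIntegral ℤ ((δ : F) * β)) (n : ℕ) :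
    IsIntegral ℤ ((N : F) ^ n * (n.factorial : F) * ((δ : F) ^ J * coeff n (evS N p q hN J P β))) := by
  have hδ : IsIntegral ℤ (δ : F) := by
    simpa using (isIntegral_algebraMap (R := ℤ) (A := F) (x := (δ : ℤ)))
  have : C ((δ : F) ^ J) * evS N p q hN J P β ∈ intSub F N := by
    have e : C ((δ : F) ^ J) * evS N p q hN J P β = ∑ j ∈ Finset.range (J + 1), pS N (P j) * (C (δ : F) * YS F N p q hN) ^ (J - j)
        * (C (δ : F) * US F N p q hN + C ((δ : F) * β)) ^ j := by
      rw [evS, Finset.mul_sum]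
      apply Finset.sum_congr rfl
      intro j hj
      have hj : j ≤ J := by simpa [Nat.lt_succ_iff] using hj
      rw [map_mul, ← mul_add, mul_pow, mul_pow]
      rw [map_pow]
      conv_lhs => rw [show J = (J - j) + j by omega, pow_add]
      rw [show J - j + j - j = J - j by omega]; ring
    rw [e]
    refine Subring.sum_mem _ fun j _ => ?_
    refine Subring.mul_mem _ (Subring.mul_mem _ (intSub_pS F N _ (hP j)) (Subring.pow_mem _ ?_ _)) (Subring.pow_mem _ ?_ _)
    · exact Subring.mul_mem _ (intSub_C F N _ hδ) (intSub_YS F N p q hN)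
    · exact Subring.add_mem _ (Subring.mul_mem _ (intSub_C F N _ hδ) (intSub_US F N p q hN hp)) (intSub_C F N _ hβ)
  have := this n
  rwa [coeff_C_mul] at this

lemma map_evS {F G : Type} [Field F] [Field G] (s : F →+* G) (N p q : ℕ) (hN : N ≠ 0) (J : ℕ)
    (P : ℕ → Polynomial F) (β : F) :
    PowerSeries.map s (evS N p q hN J P β) = evS N p q hN J (fun j => (P j).map s) (s β) := by
  simp only [evS, map_sum, map_mul, map_pow, map_add, map_YS, map_US, PowerSeries.map_C]
  apply Finset.sum_congr rfl
  intro j _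
  congr 2
  simp only [pS, Polynomial.aeval_def, Polynomial.eval₂_map]
  rw [Polynomial.hom_eval₂]
  congr 1
  · ext c; simp
  · simp

end SB
end

section
open PowerSeries

namespace SB

/-- majorant bound at radius 1/2 -/
def Bd (f : ℂ⟦X⟧) (A : ℝ) : Prop := ∀ n, ∑ i ∈ Finset.range n, ‖coeff i f‖ * (1 / 2) ^ i ≤ A

lemma Bd.nonneg {f A} (h : Bd f A) : 0 ≤ A := by simpa using h 0
lemma Bd.mono {f A B} (h : Bd f A) (hAB : A ≤ B) : Bd f B := fun n => (h n).trans hAB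

lemma Bd.add {f g A B} (hf : Bd f A) (hg : Bd g B) : Bd (f + g) (A + B) := by
  intro n
  refine le_trans ?_ (add_le_add (hf n) (hg n))
  rw [← Finset.sum_add_distrib]
  refine Finset.sum_le_sum fun i _ => ?_
  rw [map_add, ← add_mul]
  gcongr
  exact norm_add_le _ _

lemma Bd.zero : Bd 0 0 := by intro n; simp

lemma Bd.mul {f g A B} (hf : Bd f A) (hg : Bd g B) : Bd (f * g) (A * B) := by
  intro n
  refine le_trans ?_ (mul_le_mul (hf n) (hg n) (Finset.sum_nonneg fun i _ => by positivity) hf.nonneg)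
  rw [Finset.sum_mul_sum]
  calc ∑ i ∈ Finset.range n, ‖coeff i (f * g)‖ * (1 / 2) ^ i
      ≤ ∑ i ∈ Finset.range n, ∑ x ∈ Finset.HasAntidiagonal.antidiagonal i, (‖coeff x.1 f‖ * (1 / 2) ^ x.1) * (‖coeff x.2 g‖ * (1 / 2) ^ x.2) := by
        refine Finset.sum_le_sum fun i _ => ?_
        rw [coeff_mul]
        refine (mul_le_mul_of_nonneg_right (norm_sum_le _ _) (by positivity)).trans ?_
        rw [Finset.sum_mul]
        refine Finset.sum_le_sum fun x hx => ?_
        have : x.1 + x.2 = i := by simpa using hx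
        rw [norm_mul, ← this, pow_add]
        exact le_of_eq (by ring)
    _ = ∑ x ∈ (Finset.range n).sigma (fun i => Finset.HasAntidiagonal.antidiagonal i), (‖coeff x.2.1 f‖ * (1 / 2) ^ x.2.1) * (‖coeff x.2.2 g‖ * (1 / 2) ^ x.2.2) := by
        rw [Finset.sum_sigma]
    _ = ∑ x ∈ ((Finset.range n).sigma (fun i => Finset.HasAntidiagonal.antidiagonal i)).image (fun x => x.2), (‖coeff x.1 f‖ * (1 / 2) ^ x.1) * (‖coeff x.2 g‖ * (1 / 2) ^ x.2) := by
        rw [Finset.sum_image]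
        rintro ⟨i, x⟩ hx ⟨j, y⟩ hy hxy
        simp at hx hy hxy
        subst hxy
        have : i = j := by omega
        subst this; rfl
    _ ≤ ∑ x ∈ Finset.range n ×ˢ Finset.range n, (‖coeff x.1 f‖ * (1 / 2) ^ x.1) * (‖coeff x.2 g‖ * (1 / 2) ^ x.2) := by
        refine Finset.sum_le_sum_of_subset_of_nonneg ?_ (fun _ _ _ => by positivity)
        intro x hx
        simp at hx ⊢
        omega
    _ = _ := by rw [Finset.sum_product]

lemma Bd.const (c : ℂ) : Bd (C c) ‖c‖ := by
  intro n
  rcases n with _ | n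
  · simp
  · rw [Finset.sum_range_succ']
    simp [coeff_C]

lemma Bd.pow {f A} (hf : Bd f A) (k : ℕ) : Bd (f ^ k) (A ^ k) := by
  induction k with
  | zero => simpa using Bd.const 1
  | succ k ih => rw [pow_succ, pow_succ]; exact ih.mul hf

lemma Bd.sum {ι : Type} (s : Finset ι) (f : ι → ℂ⟦X⟧) (A : ι → ℝ) (h : ∀ i ∈ s, Bd (f i) (A i)) :
    Bd (∑ i ∈ s, f i) (∑ i ∈ s, A i) := by
  classical
  induction s using Finset.induction_on with
  | empty => simpa using Bd.zero
  | insert i s hi ih =>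
    rw [Finset.sum_insert hi, Finset.sum_insert hi]
    exact (h i (by simp)).add (ih fun j hj => h j (by simp [hj]))

lemma Bd.of_coeff {f : ℂ⟦X⟧} {c : ℝ} (h : ∀ n, ‖coeff n f‖ ≤ c) : Bd f (2 * c) := by
  intro n
  have hc : 0 ≤ c := (norm_nonneg _).trans (h 0)
  calc _ ≤ ∑ i ∈ Finset.range n, c * (1/2 : ℝ) ^ i := Finset.sum_le_sum fun i _ => by gcongr; exact h i
    _ = c * ∑ i ∈ Finset.range n, (1/2 : ℝ) ^ i := by rw [Finset.mul_sum]
    _ ≤ c * 2 := by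
      gcongr
      have := (summable_geometric_two).sum_le_tsum (Finset.range n) (fun i _ => by positivity)
      rwa [tsum_geometric_two] at this
    _ = _ := by ring

lemma Bd.Xpow (k : ℕ) : Bd (X ^ k) 1 := by
  intro n
  calc _ = ∑ i ∈ Finset.range n, if i = k then (1/2 : ℝ) ^ i else 0 := by
        refine Finset.sum_congr rfl fun i _ => ?_
        rw [coeff_X_pow]; split_ifs <;> simp
    _ ≤ 1 := by
      rw [Finset.sum_ite_eq']
      split_ifs
      · exact pow_le_one₀ (by norm_num) (by norm_num)
      · norm_num

lemma eF_norm (N q : ℕ) (hqN : q < N) (k : ℕ) : ‖eF ℂ N q k‖ ≤ 1 := by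
  induction k with
  | zero => simp [eF]
  | succ k ih =>
    have hN : (0:ℝ) < N := by exact_mod_cast (by omega : 0 < N)
    rw [eF, norm_mul]
    refine mul_le_one₀ ?_ (norm_nonneg _) ih
    have : (((k:ℂ) + 1) - (q : ℂ) / N) / ((k : ℂ) + 1) = (((((k:ℝ) + 1) - (q : ℝ) / N) / ((k : ℝ) + 1) : ℝ) : ℂ) := by push_cast; rfl
    rw [this, Complex.norm_real, Real.norm_eq_abs]
    have h1 : (q : ℝ) / N ≤ 1 := by rw [div_le_one hN]; exact_mod_cast hqN.le
    have h2 : 0 ≤ (q : ℝ) / N := by positivity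
    have hk : (0:ℝ) ≤ k := Nat.cast_nonneg k
    rw [abs_of_nonneg (div_nonneg (by linarith) (by linarith)), div_le_one (by linarith)]
    linarith

lemma Bd_ES (N p q : ℕ) (hN : N ≠ 0) (hqN : q < N) : Bd (ES ℂ N p q hN) 2 := by
  have : Bd (expand N hN (E0 ℂ N q)) (2 * 1) := by
    apply Bd.of_coeff
    intro n
    rw [coeff_expand]
    split_ifs
    · simpa [E0] using eF_norm N q hqN _
    · simp
  simpa [ES] using (Bd.Xpow p).mul this

lemma Bd_YS (N p q : ℕ) (hN : N ≠ 0) (hqN : q < N) : Bd (YS ℂ N p q hN) 4 := by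
  have h1 : Bd (1 - X ^ N) (1 + 1) := by
    have := (Bd.const 1).add ((Bd.const (-1)).mul (Bd.Xpow N))
    simpa [sub_eq_add_neg] using this
  refine (h1.mul (Bd_ES N p q hN hqN)).mono (by norm_num)

lemma Bd_US (N p q : ℕ) (hN : N ≠ 0) (hp : 0 < p) (hqN : q < N) : Bd (US ℂ N p q hN) (2 * N) := by
  have hN' : (0:ℝ) < N := by exact_mod_cast Nat.pos_of_ne_zero hN
  have : Bd (expand N hN (U0 ℂ N p q)) (2 * N) := by
    apply Bd.of_coeff
    intro n
    rw [coeff_expand]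
    split_ifs
    · rw [U0, coeff_mk, norm_div]
      set k := n / N
      have h1 : ‖(p : ℂ) / N + k‖ = (p : ℝ) / N + k := by
        have : (p : ℂ) / N + k = (((p : ℝ) / N + k : ℝ) : ℂ) := by push_cast; rfl
        rw [this, Complex.norm_real, Real.norm_eq_abs, abs_of_nonneg (by positivity)]
      rw [h1, div_le_iff₀ (by positivity)]
      refine (eF_norm N q hqN k).trans ?_
      have : (1:ℝ) ≤ p := by exact_mod_cast hp
      rw [mul_add, mul_div_cancel₀ _ hN'.ne']
      have : (0:ℝ) ≤ N * k := by positivity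
      linarith
    · simp
  simpa [US] using (Bd.Xpow p).mul this

lemma Bd_pS (N L : ℕ) (f : Polynomial ℂ) (hL : f.natDegree ≤ L) (H : ℝ) (hH : ∀ i, ‖f.coeff i‖ ≤ H) :
    Bd (pS N f) ((L + 1) * H) := by
  rw [pS, Polynomial.aeval_eq_sum_range' (Nat.lt_succ_of_le hL)]
  have := Bd.sum (Finset.range (L.succ)) (fun i => f.coeff i • (X ^ N : ℂ⟦X⟧) ^ i) (fun _ => H) (by
    intro i _
    rw [PowerSeries.smul_eq_C_mul, ← pow_mul]
    have := ((Bd.const (f.coeff i)).mul (Bd.Xpow (N * i)))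
    rw [mul_one] at this
    exact this.mono (hH i))
  simpa using this

lemma Bd_evS (N p q : ℕ) (hN : N ≠ 0) (hp : 0 < p) (hqN : q < N) (J L : ℕ) (P : ℕ → Polynomial ℂ)
    (hL : ∀ j, (P j).natDegree ≤ L) (H : ℝ) (hH : ∀ j i, ‖(P j).coeff i‖ ≤ H) (β : ℂ) (M : ℝ) (hM : 4 * N + ‖β‖ ≤ M) :
    Bd (evS N p q hN J P β) ((J + 1) * (L + 1) * H * M ^ J) := by
  have hN' : (1:ℝ) ≤ N := by exact_mod_cast Nat.pos_of_ne_zero hN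
  have hβ := norm_nonneg β
  have hM0 : 0 ≤ M := by linarith
  have := Bd.sum (Finset.range (J + 1)) (fun j => pS N (P j) * YS ℂ N p q hN ^ (J - j) * (US ℂ N p q hN + C β) ^ j)
    (fun _ => (L + 1) * H * M ^ J) (by
    intro j hj
    have hj : j ≤ J := by simpa [Nat.lt_succ_iff] using hj
    have h1 := Bd_pS N L (P j) (hL j) H (hH j)
    have h2 := ((Bd_YS N p q hN hqN).mono (show (4:ℝ) ≤ M by linarith)).pow (J - j)
    have h3 := (((Bd_US N p q hN hp hqN).add (Bd.const β)).mono (show 2 * (N:ℝ) + ‖β‖ ≤ M by linarith)).pow j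
    refine ((h1.mul h2).mul h3).mono (le_of_eq ?_)
    rw [mul_assoc _ (M ^ _) (M ^ _), ← pow_add, show J - j + j = J by omega])
  refine Bd.mono this (le_of_eq ?_)
  simp; ring

/-! evaluation -/

def Ev (t : ℂ) (f : ℂ⟦X⟧) (v : ℂ) : Prop :=
  Summable (fun n => ‖coeff n f * t ^ n‖) ∧ HasSum (fun n => coeff n f * t ^ n) v

lemma Ev.add {t f g u v} (hf : Ev t f u) (hg : Ev t g v) : Ev t (f + g) (u + v) := by
  refine ⟨?_, ?_⟩
  · refine Summable.of_nonneg_of_le (fun _ => norm_nonneg _) (fun n => ?_) (hf.1.add hg.1)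
    rw [map_add, add_mul]; exact norm_add_le _ _
  · convert hf.2.add hg.2 using 2 with n
    rw [map_add, add_mul]

lemma Ev.mul {t f g u v} (hf : Ev t f u) (hg : Ev t g v) : Ev t (f * g) (u * v) := by
  have e : ∀ n, coeff n (f * g) * t ^ n = ∑ x ∈ Finset.HasAntidiagonal.antidiagonal n, (coeff x.1 f * t ^ x.1) * (coeff x.2 g * t ^ x.2) := by
    intro n
    rw [coeff_mul, Finset.sum_mul]
    refine Finset.sum_congr rfl fun x hx => ?_
    have : x.1 + x.2 = n := by simpa using hx
    rw [← this, pow_add]; ring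
  have h1 := summable_norm_sum_mul_antidiagonal_of_summable_norm hf.1 hg.1
  have h2 := tsum_mul_tsum_eq_tsum_sum_antidiagonal_of_summable_norm hf.1 hg.1
  refine ⟨?_, ?_⟩
  · simpa only [e] using h1
  · simp only [e]
    rw [hf.2.tsum_eq, hg.2.tsum_eq] at h2
    rw [h2]
    exact h1.of_norm.hasSum

lemma Ev.const (t c : ℂ) : Ev t (C c) c := by
  have h : ∀ n, n ≠ 0 → coeff n (C c) * t ^ n = 0 := by
    intro n hn; simp [coeff_C, hn]
  refine ⟨?_, ?_⟩
  · refine summable_of_ne_finset_zero (s := {0}) ?_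
    intro n hn; rw [h n (by simpa using hn), norm_zero]
  · convert hasSum_single 0 h using 1; simp

lemma Ev.Xpow (t : ℂ) (k : ℕ) : Ev t (X ^ k) (t ^ k) := by
  have h : ∀ n, n ≠ k → coeff n (X ^ k) * t ^ n = 0 := by
    intro n hn; simp [coeff_X_pow, hn]
  refine ⟨?_, ?_⟩
  · refine summable_of_ne_finset_zero (s := {k}) ?_
    intro n hn; rw [h n (by simpa using hn), norm_zero]
  · convert hasSum_single k h using 1; simp [coeff_X_pow]

lemma Ev.pow {t f v} (hf : Ev t f v) (k : ℕ) : Ev t (f ^ k) (v ^ k) := by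
  induction k with
  | zero => simpa using Ev.const t 1
  | succ k ih => rw [pow_succ, pow_succ]; exact ih.mul hf

lemma Ev.sum {t} {ι : Type} (s : Finset ι) (f : ι → ℂ⟦X⟧) (v : ι → ℂ) (h : ∀ i ∈ s, Ev t (f i) (v i)) :
    Ev t (∑ i ∈ s, f i) (∑ i ∈ s, v i) := by
  classical
  induction s using Finset.induction_on with
  | empty => simpa using Ev.const t 0
  | insert i s hi ih =>
    rw [Finset.sum_insert hi, Finset.sum_insert hi]
    exact (h i (by simp)).add (ih fun j hj => h j (by simp [hj]))

lemma Ev.pS (t : ℂ) (N : ℕ) (f : Polynomial ℂ) : Ev t (SB.pS N f) (f.eval (t ^ N)) := by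
  rw [SB.pS, Polynomial.aeval_eq_sum_range, Polynomial.eval_eq_sum_range]
  refine Ev.sum _ _ _ fun i _ => ?_
  rw [PowerSeries.smul_eq_C_mul, ← pow_mul, ← pow_mul]
  exact (Ev.const t _).mul (Ev.Xpow t _)

lemma Ev.expand {t : ℂ} {N : ℕ} (hN : N ≠ 0) {f : ℂ⟦X⟧} {v : ℂ} (h : Ev (t ^ N) f v) : Ev t (PowerSeries.expand N hN f) v := by
  have hinj : Function.Injective (fun m : ℕ => N * m) := fun a b h => Nat.eq_of_mul_eq_mul_left (Nat.pos_of_ne_zero hN) h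
  have e : ∀ m, coeff (N * m) (PowerSeries.expand N hN f) * t ^ (N * m) = coeff m f * (t ^ N) ^ m := by
    intro m; rw [coeff_expand_mul, pow_mul]
  have hz : ∀ n, n ∉ Set.range (fun m : ℕ => N * m) → coeff n (PowerSeries.expand N hN f) * t ^ n = 0 := by
    intro n hn
    rw [coeff_expand_of_not_dvd, zero_mul]
    rintro ⟨m, rfl⟩; exact hn ⟨m, rfl⟩
  refine ⟨?_, ?_⟩
  · rw [← hinj.summable_iff (f := fun n => ‖coeff n (PowerSeries.expand N hN f) * t ^ n‖) (fun n hn => by rw [hz n hn, norm_zero])]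
    refine h.1.congr fun m => ?_
    simp only [Function.comp]; rw [e]
  · rw [← hinj.hasSum_iff hz]
    convert h.2 using 2 with m
    exact e m

lemma Ev.evS {t : ℂ} {N p q : ℕ} {hN : N ≠ 0} {y u : ℂ} (hy : Ev t (YS ℂ N p q hN) y) (hu : Ev t (US ℂ N p q hN) u)
    (J : ℕ) (P : ℕ → Polynomial ℂ) (β : ℂ) :
    Ev t (SB.evS N p q hN J P β) (∑ j ∈ Finset.range (J + 1), (P j).eval (t ^ N) * y ^ (J - j) * (u + β) ^ j) :=
  Ev.sum _ _ _ fun j _ => ((Ev.pS t N (P j)).mul (hy.pow _)).mul ((hu.add (Ev.const t β)).pow _)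

lemma Ev.bound {t : ℂ} (ht : ‖t‖ ≤ 1 / 2) {f : ℂ⟦X⟧} {v : ℂ} {A : ℝ} (hB : Bd f A) (h : Ev t f v) (m : ℕ) (hm : X ^ m ∣ f) :
    ‖v‖ ≤ (2 * ‖t‖) ^ m * A := by
  have hA := hB.nonneg
  rw [← h.2.tsum_eq]
  refine (norm_tsum_le_tsum_norm h.1).trans ?_
  refine h.1.tsum_le_of_sum_range_le fun n => ?_
  rw [X_pow_dvd_iff] at hm
  refine le_trans ?_ (mul_le_mul_of_nonneg_left (hB n) (by positivity))
  rw [Finset.mul_sum]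
  refine Finset.sum_le_sum fun i _ => ?_
  rcases Nat.lt_or_ge i m with hi | hi
  · rw [hm i hi]; simp
  · rw [norm_mul, norm_pow]
    have : ‖t‖ ^ i = (2 * ‖t‖) ^ i * (1/2) ^ i := by rw [← mul_pow]; congr 1; ring
    rw [this]
    have h2 : (2 * ‖t‖) ^ i ≤ (2 * ‖t‖) ^ m := pow_le_pow_of_le_one (by positivity) (by linarith) hi
    calc ‖coeff i f‖ * ((2 * ‖t‖) ^ i * (1/2) ^ i) = (2 * ‖t‖) ^ i * (‖coeff i f‖ * (1/2) ^ i) := by ring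
      _ ≤ _ := by gcongr

lemma Bd.coeff_le {f : ℂ⟦X⟧} {A : ℝ} (hB : Bd f A) (n : ℕ) : ‖coeff n f‖ ≤ 2 ^ n * A := by
  have h := (Finset.single_le_sum (f := fun i => ‖coeff i f‖ * (1/2:ℝ)^i) (fun i _ => by positivity) (Finset.self_mem_range_succ n)).trans (hB (n+1))
  have h2 : (0:ℝ) < 2 ^ n := by positivity
  calc ‖coeff n f‖ = 2 ^ n * (‖coeff n f‖ * (1/2) ^ n) := by
        rw [one_div, inv_pow]; field_simp
    _ ≤ _ := by gcongr

end SB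
end

section
namespace SB
open MeasureTheory Set intervalIntegral Topology

/-- incomplete beta kernel integral -/
noncomputable def hI (a b : ℝ) (x : ℂ) : ℂ :=
  ∫ s in (0:ℝ)..1, ((s ^ (a-1) : ℝ) : ℂ) * (1 - (s:ℂ) * x) ^ ((b-1 : ℝ) : ℂ)

lemma slit_seg {x : ℂ} (hx : 1 - x ∈ Complex.slitPlane) {s : ℝ} (h0 : 0 ≤ s) (h1 : s ≤ 1) :
    1 - (s:ℂ) * x ∈ Complex.slitPlane := by
  rcases eq_or_lt_of_le h0 with rfl | h0
  · simp
  rw [Complex.mem_slitPlane_iff] at *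
  simp at *
  rcases hx with h | h
  · left; nlinarith
  · right; exact ⟨h0.ne', h⟩

lemma ii_rpow {a : ℝ} (ha : 0 < a) : IntervalIntegrable (fun s : ℝ => s ^ (a-1)) volume 0 1 :=
  intervalIntegrable_rpow' (by linarith)

lemma ii_mul {a : ℝ} (ha : 0 < a) {g : ℝ → ℂ} (hg : ContinuousOn g (Icc 0 1)) :
    IntervalIntegrable (fun s : ℝ => ((s ^ (a-1) : ℝ) : ℂ) * g s) volume 0 1 := by
  have h1 : IntervalIntegrable (fun s : ℝ => ((s ^ (a-1) : ℝ) : ℂ)) volume 0 1 :=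
    ⟨(ii_rpow ha).1.ofReal, (ii_rpow ha).2.ofReal⟩
  apply h1.mul_continuousOn
  rwa [uIcc_of_le zero_le_one]

lemma cont_seg {x : ℂ} (hx : 1 - x ∈ Complex.slitPlane) (c : ℂ) :
    ContinuousOn (fun s : ℝ => (1 - (s:ℂ) * x) ^ c) (Icc 0 1) := by
  intro s hs
  apply ContinuousAt.continuousWithinAt
  apply ContinuousAt.cpow (f := fun s : ℝ => 1 - (s:ℂ) * x) _ continuousAt_const
  · exact slit_seg hx hs.1 hs.2
  · fun_prop

lemma hI_deriv {a : ℝ} (ha : 0 < a) (b : ℝ) {x : ℂ} (hx : 1 - x ∈ Complex.slitPlane) :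
    HasDerivAt (hI a b) (∫ s in (0:ℝ)..1, ((s ^ (a-1) : ℝ) : ℂ) *
      (((b-1:ℝ):ℂ) * (1 - (s:ℂ) * x) ^ (((b-1 : ℝ) : ℂ) - 1) * (-(s:ℂ)))) x := by
  have hopen : IsOpen {y : ℂ | 1 - y ∈ Complex.slitPlane} :=
    Complex.isOpen_slitPlane.preimage (by fun_prop)
  obtain ⟨ρ, hρ, hball⟩ := Metric.nhds_basis_closedBall.mem_iff.1 (hopen.mem_nhds hx)
  have hcont : ContinuousOn (fun z : ℝ × ℂ => ((b-1:ℝ):ℂ) * (1 - (z.1:ℂ) * z.2) ^ (((b-1 : ℝ) : ℂ) - 1) * (-(z.1:ℂ)))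
      (Icc 0 1 ×ˢ Metric.closedBall x ρ) := by
    intro z hz
    apply ContinuousAt.continuousWithinAt
    refine ContinuousAt.mul (ContinuousAt.mul continuousAt_const (ContinuousAt.cpow (f := fun z : ℝ × ℂ => 1 - (z.1:ℂ) * z.2) (by fun_prop) continuousAt_const ?_)) (by fun_prop)
    exact slit_seg (hball hz.2) hz.1.1 hz.1.2
  obtain ⟨M, hM⟩ := (isCompact_Icc.prod (isCompact_closedBall x ρ)).exists_bound_of_continuousOn hcont
  have hsub : ∀ s : ℝ, s ∈ uIoc (0:ℝ) 1 → s ∈ Icc (0:ℝ) 1 := by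
    intro s hs; rw [uIoc_of_le zero_le_one] at hs; exact ⟨hs.1.le, hs.2⟩
  refine (intervalIntegral.hasDerivAt_integral_of_dominated_loc_of_deriv_le (s := Metric.closedBall x ρ)
    (bound := fun s => s ^ (a-1) * M)
    (F' := fun x s => ((s ^ (a-1) : ℝ) : ℂ) *
      (((b-1:ℝ):ℂ) * (1 - (s:ℂ) * x) ^ (((b-1 : ℝ) : ℂ) - 1) * (-(s:ℂ))))
    (Metric.closedBall_mem_nhds x hρ) ?_ ?_ ?_ ?_ ?_ ?_).2
  · filter_upwards [Metric.closedBall_mem_nhds x hρ] with y hy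
    have := (ii_mul ha (cont_seg (hball hy) ((b-1:ℝ):ℂ)))
    rw [intervalIntegrable_iff] at this
    exact this.aestronglyMeasurable
  · exact ii_mul ha (cont_seg hx _)
  · have : ContinuousOn (fun s : ℝ => (((b-1:ℝ):ℂ) * (1 - (s:ℂ) * x) ^ (((b-1 : ℝ) : ℂ) - 1) * (-(s:ℂ)))) (Icc 0 1) :=
      (continuousOn_const.mul (cont_seg hx _)).mul (by fun_prop)
    have := ii_mul ha this
    rw [intervalIntegrable_iff] at this
    exact this.aestronglyMeasurable
  · refine Filter.Eventually.of_forall fun s hs y hy => ?_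
    have hs' := hsub s hs
    rw [norm_mul, Complex.norm_real, Real.norm_of_nonneg (Real.rpow_nonneg hs'.1 _)]
    exact mul_le_mul_of_nonneg_left (hM (s, y) ⟨hs', hy⟩) (Real.rpow_nonneg hs'.1 _)
  · exact (ii_rpow ha).mul_const M
  · refine Filter.Eventually.of_forall fun s hs y hy => ?_
    have hs' := hsub s hs
    have h1 : HasDerivAt (fun x : ℂ => 1 - (s:ℂ) * x) (-(s:ℂ)) y := by
      simpa using ((hasDerivAt_id y).const_mul (s:ℂ)).const_sub 1
    exact (h1.cpow_const (c := ((b-1:ℝ):ℂ)) (slit_seg (hball hy) hs'.1 hs'.2)).const_mul _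

lemma hI_ode {a : ℝ} (ha : 0 < a) (b : ℝ) {x : ℂ} (hx : 1 - x ∈ Complex.slitPlane) :
    ∃ d, HasDerivAt (hI a b) d x ∧ a * hI a b x + x * d = (1 - x) ^ ((b-1:ℝ):ℂ) := by
  refine ⟨_, hI_deriv ha b hx, ?_⟩
  unfold hI
  rw [← intervalIntegral.integral_const_mul, ← intervalIntegral.integral_const_mul,
    ← intervalIntegral.integral_add]
  rotate_left
  · exact (ii_mul ha (cont_seg hx _)).const_mul _
  · exact (ii_mul ha ((continuousOn_const.mul (cont_seg hx _)).mul (by fun_prop))).const_mul _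
  have hft := integral_eq_sub_of_hasDerivAt_of_le (a := 0) (b := 1) zero_le_one
    (f := fun s : ℝ => ((s ^ a : ℝ) : ℂ) * (1 - (s:ℂ) * x) ^ ((b-1 : ℝ) : ℂ))
    (f' := fun s : ℝ => (a:ℂ) * (((s ^ (a-1) : ℝ) : ℂ) * (1 - (s:ℂ) * x) ^ ((b-1 : ℝ) : ℂ)) +
      x * (((s ^ (a-1) : ℝ) : ℂ) *
      (((b-1:ℝ):ℂ) * (1 - (s:ℂ) * x) ^ (((b-1 : ℝ) : ℂ) - 1) * (-(s:ℂ))))) ?_ ?_ ?_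
  · rw [hft]; simp [Real.zero_rpow ha.ne']
  · refine ContinuousOn.mul ?_ (cont_seg hx _)
    exact Complex.continuous_ofReal.comp_continuousOn
      (Real.continuous_rpow_const ha.le).continuousOn
  · intro s hs
    have h1 : HasDerivAt (fun s : ℝ => ((s ^ a : ℝ) : ℂ)) ((a * s^(a-1) : ℝ) : ℂ) s :=
      (Real.hasDerivAt_rpow_const (Or.inl hs.1.ne')).ofReal_comp
    have h2 : HasDerivAt (fun z : ℂ => 1 - z * x) (-x) (s:ℂ) := by
      simpa using ((hasDerivAt_id (s:ℂ)).mul_const x).const_sub 1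
    have h3 := (h2.cpow_const (c := ((b-1:ℝ):ℂ)) (slit_seg hx hs.1.le hs.2.le)).comp_ofReal
    refine (h1.mul h3).congr_deriv ?_
    have h4 : ((s ^ a : ℝ) : ℂ) = ((s ^ (a-1) : ℝ):ℂ) * s := by
      rw [← Complex.ofReal_mul, ← Real.rpow_add_one hs.1.ne']; simp
    rw [h4]; push_cast; ring
  · exact ((ii_mul ha (cont_seg hx _)).const_mul _).add
      ((ii_mul ha ((continuousOn_const.mul (cont_seg hx _)).mul (by fun_prop))).const_mul _)

/-- size bound -/
lemma ii_abs {b : ℝ} (hb : 0 < b) : IntervalIntegrable (fun v : ℝ => |v| ^ (b-1)) volume (-1) 1 := by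
  have h : IntervalIntegrable (fun v : ℝ => |v| ^ (b-1)) volume 0 1 := by
    refine (ii_rpow hb).congr ?_
    intro v hv
    rw [uIoc_of_le zero_le_one] at hv
    simp [abs_of_pos hv.1]
  have h2 : IntervalIntegrable (fun v : ℝ => |v| ^ (b-1)) volume (-1) 0 := by
    have := h.symm.comp_sub_left 0
    simpa using this
  exact h2.trans h

lemma hI_bound {a b : ℝ} (ha : 0 < a) (ha1 : a < 1) (hb : 0 < b) (hb1 : b < 1) :
    ∃ C : ℝ, 0 < C ∧ ∀ x : ℂ, 1 - x ∈ Complex.slitPlane → ‖hI a b x‖ ≤ C * (1 + ‖x‖) := by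
  have hA0 : 0 ≤ ∫ s in (0:ℝ)..1, s ^ (a-1) :=
    intervalIntegral.integral_nonneg zero_le_one fun s hs => Real.rpow_nonneg hs.1 _
  have hB0 : 0 ≤ ∫ v in (-1:ℝ)..1, |v| ^ (b-1) :=
    intervalIntegral.integral_nonneg (by norm_num) fun s hs => Real.rpow_nonneg (abs_nonneg _) _
  set A := ∫ s in (0:ℝ)..1, s ^ (a-1) with hA
  set B := ∫ v in (-1:ℝ)..1, |v| ^ (b-1) with hB
  refine ⟨2 * A + 2 * B + 1, by positivity, fun x hx => ?_⟩
  obtain ⟨c, hc0, hc1, hcR, hcs⟩ : ∃ c : ℝ, 0 < c ∧ c ≤ 1 ∧ 1 / c ≤ 1 + ‖x‖ ∧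
      (∀ s : ℝ, 0 ≤ s → s ≤ 1 → |s - c| ≤ ‖1 - (s:ℂ) * x‖ ∧ (s ≤ c/2 → 1/2 ≤ ‖1 - (s:ℂ) * x‖)) := by
    have key : ∀ s : ℝ, 0 ≤ s → |1 - s * ‖x‖| ≤ ‖1 - (s:ℂ) * x‖ := by
      intro s hs
      have := abs_norm_sub_norm_le (1:ℂ) ((s:ℂ)*x)
      rwa [norm_one, norm_mul, Complex.norm_real, Real.norm_of_nonneg hs] at this
    have hx0 := norm_nonneg x
    rcases le_total ‖x‖ 1 with h | h
    · refine ⟨1, one_pos, le_rfl, by linarith, fun s h0 h1 => ⟨?_, fun h2 => ?_⟩⟩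
      · refine le_trans ?_ (key s h0)
        rw [abs_of_nonpos (by linarith), abs_of_nonneg (by nlinarith)]
        nlinarith
      · refine le_trans ?_ (key s h0)
        exact le_trans (by nlinarith) (le_abs_self _)
    · have hx1 : 0 < ‖x‖ := by linarith
      refine ⟨1 / ‖x‖, by positivity, by rw [div_le_one hx1]; exact h, by simp, fun s h0 h1 => ⟨?_, fun h2 => ?_⟩⟩
      · refine le_trans ?_ (key s h0)
        have : |1 - s * ‖x‖| = ‖x‖ * |s - 1 / ‖x‖| := by
          rw [← abs_of_pos hx1, ← abs_mul, abs_of_pos hx1, mul_sub, mul_one_div_cancel hx1.ne', abs_sub_comm, mul_comm]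
        rw [this]
        exact le_mul_of_one_le_left (abs_nonneg _) h
      · refine le_trans ?_ (key s h0)
        refine le_trans ?_ (le_abs_self _)
        rw [le_div_iff₀ (by norm_num), le_div_iff₀ hx1] at h2
        linarith
  have hD : IntervalIntegrable (fun s : ℝ => |s - c| ^ (b-1)) volume 0 1 := by
    have h1 : IntervalIntegrable (fun v : ℝ => |v| ^ (b-1)) volume (0 - c) (1 - c) := by
      apply (ii_abs hb).mono_set
      rw [uIcc_of_le (by linarith), uIcc_of_le (by linarith)]
      exact Icc_subset_Icc (by linarith) (by linarith)
    have := h1.comp_sub_right c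
    simpa using this
  have hDB : ∫ s in (0:ℝ)..1, |s - c| ^ (b-1) ≤ B := by
    rw [intervalIntegral.integral_comp_sub_right (fun v => |v| ^ (b-1)) c]
    exact intervalIntegral.integral_mono_interval (by linarith) (by linarith) (by linarith)
      (Filter.Eventually.of_forall fun v => Real.rpow_nonneg (abs_nonneg _) _) (ii_abs hb)
  have hint : IntervalIntegrable (fun s : ℝ => 2 * s ^ (a-1) + 2 * (1 + ‖x‖) * |s - c| ^ (b-1)) volume 0 1 :=
    ((ii_rpow ha).const_mul 2).add (hD.const_mul _)
  have hmain : ‖hI a b x‖ ≤ ∫ s in (0:ℝ)..1, (2 * s ^ (a-1) + 2 * (1 + ‖x‖) * |s - c| ^ (b-1)) := by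
    apply intervalIntegral.norm_integral_le_of_norm_le zero_le_one _ hint
    have : ∀ᵐ s : ℝ, s ≠ c := by simp [ae_iff, measure_singleton]
    filter_upwards [this] with s hsc hs
    obtain ⟨hs0, hs1⟩ := hs
    have hp := hcs s hs0.le hs1
    have hsa : 0 ≤ s ^ (a-1) := Real.rpow_nonneg hs0.le _
    rw [norm_mul, Complex.norm_real, Real.norm_of_nonneg hsa, Complex.norm_cpow_real]
    have hpos : 0 ≤ |s - c| ^ (b-1) := Real.rpow_nonneg (abs_nonneg _) _
    rcases le_total s (c/2) with h | h
    · have : ‖1 - (s:ℂ) * x‖ ^ (b-1) ≤ 2 := by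
        calc ‖1 - (s:ℂ) * x‖ ^ (b-1) ≤ (1/2:ℝ) ^ (b-1) :=
              Real.rpow_le_rpow_of_nonpos (by norm_num) (hp.2 h) (by linarith)
          _ ≤ (1/2:ℝ) ^ (-1:ℝ) := Real.rpow_le_rpow_of_exponent_ge (by norm_num) (by norm_num) (by linarith)
          _ = 2 := by rw [Real.rpow_neg_one]; norm_num
      have h3 := norm_nonneg x
      have : 0 ≤ 2 * (1 + ‖x‖) * |s - c| ^ (b-1) := by positivity
      nlinarith
    · have h1 : s ^ (a-1) ≤ 2 * (1 + ‖x‖) := by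
        calc s ^ (a-1) ≤ (c/2) ^ (a-1) :=
              Real.rpow_le_rpow_of_nonpos (by positivity) h (by linarith)
          _ ≤ (c/2) ^ (-1:ℝ) := Real.rpow_le_rpow_of_exponent_ge (by positivity) (by linarith) (by linarith)
          _ = 2 * (1 / c) := by rw [Real.rpow_neg_one]; field_simp
          _ ≤ _ := by linarith
      have h2 : ‖1 - (s:ℂ) * x‖ ^ (b-1) ≤ |s - c| ^ (b-1) :=
        Real.rpow_le_rpow_of_nonpos (abs_pos.2 (sub_ne_zero.2 hsc)) hp.1 (by linarith)
      have h3 : 0 ≤ ‖1 - (s:ℂ) * x‖ ^ (b-1) := Real.rpow_nonneg (norm_nonneg _) _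
      have := mul_le_mul h1 h2 h3 (by linarith [norm_nonneg x])
      linarith
  refine hmain.trans ?_
  rw [intervalIntegral.integral_add ((ii_rpow ha).const_mul 2) (hD.const_mul _),
    intervalIntegral.integral_const_mul, intervalIntegral.integral_const_mul]
  have h3 := norm_nonneg x
  have h4 := mul_le_mul_of_nonneg_left hDB (by positivity : 0 ≤ 2 * (1 + ‖x‖))
  nlinarith
end SB
end

section
namespace SB
open MeasureTheory Set intervalIntegral Topology

lemma hI_lderiv {a : ℝ} (ha : 0 < a) (b : ℝ) {x : ℂ} (hx : 1 - x ∈ Complex.slitPlane) (hx0 : x ≠ 0)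
    {Lf : ℂ → ℂ} (hL : HasDerivAt Lf x⁻¹ x) :
    HasDerivAt (fun z => Complex.exp (a * Lf z) * hI a b z)
      (Complex.exp (a * Lf x) * x⁻¹ * (1 - x) ^ ((b-1:ℝ):ℂ)) x := by
  obtain ⟨d, hd, hode⟩ := hI_ode ha b hx
  refine ((hL.const_mul (a:ℂ)).cexp.mul hd).congr_deriv ?_
  rw [← hode]; field_simp

noncomputable def Bc (a b : ℝ) : ℂ :=
  Complex.exp (a * Complex.log (1/2)) * hI a b (1/2) + Complex.exp (b * Complex.log (1/2)) * hI b a (1/2)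

lemma Bc_comm (a b : ℝ) : Bc a b = Bc b a := by rw [Bc, Bc, add_comm]

lemma hI_func {a b : ℝ} (ha : 0 < a) (hb : 0 < b) {x : ℂ} (hx : x ∈ Complex.slitPlane)
    (hx1 : 1 - x ∈ Complex.slitPlane) :
    Complex.exp (a * Complex.log x) * hI a b x + Complex.exp (b * Complex.log (1 - x)) * hI b a (1 - x)
      = Bc a b := by
  set Ω : Set ℂ := {x | x ∈ Complex.slitPlane ∧ 1 - x ∈ Complex.slitPlane} with hΩ
  have hop : IsOpen Ω := Complex.isOpen_slitPlane.inter
    (Complex.isOpen_slitPlane.preimage (f := fun x : ℂ => 1 - x) (by fun_prop))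
  have hhalf : (1/2 : ℂ) ∈ Ω := by
    refine ⟨?_, ?_⟩ <;> rw [Complex.mem_slitPlane_iff] <;> left <;> norm_num
  have hstar : StarConvex ℝ (1/2 : ℂ) Ω := by
    intro y hy s t hs ht hst
    rcases hs.eq_or_lt with rfl | hs
    · have : t = 1 := by linarith
      subst this; simpa using hy
    rcases ht.eq_or_lt with rfl | ht
    · have : s = 1 := by linarith
      subst this; simpa using hhalf
    simp only [hΩ, mem_ofPred_eq, Complex.mem_slitPlane_iff] at hy ⊢
    simp at hy ⊢
    obtain ⟨h1, h2⟩ := hy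
    by_cases him : y.im = 0
    · simp [him] at h1 h2 ⊢
      constructor
      · positivity
      · nlinarith
    · constructor <;> right <;> exact ⟨ht.ne', him⟩
  set f : ℂ → ℂ := fun x => Complex.exp (a * Complex.log x) * hI a b x +
    Complex.exp (b * Complex.log (1 - x)) * hI b a (1 - x) with hf
  have hd : ∀ y ∈ Ω, HasDerivAt f 0 y := by
    intro y hy
    have hy0 : y ≠ 0 := Complex.slitPlane_ne_zero hy.1
    have hy1 : 1 - y ≠ 0 := Complex.slitPlane_ne_zero hy.2
    have h1 := hI_lderiv ha b hy.2 hy0 (Complex.hasDerivAt_log hy.1)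
    have h2 := hI_lderiv hb a (x := 1 - y) (by simpa using hy.1) hy1 (Complex.hasDerivAt_log hy.2)
    have h3 : HasDerivAt (fun z : ℂ => 1 - z) (-1) y := by
      simpa using (hasDerivAt_id y).const_sub 1
    have h4 := h2.comp y h3
    refine (h1.add h4).congr_deriv ?_
    have e1 : ∀ (c : ℝ) (z : ℂ), z ≠ 0 → z ^ ((c-1:ℝ):ℂ) = Complex.exp (c * Complex.log z) * z⁻¹ := by
      intro c z hz
      push_cast
      rw [Complex.cpow_sub _ _ hz, Complex.cpow_one, Complex.cpow_def_of_ne_zero hz, div_eq_mul_inv, mul_comm (Complex.log z)]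
    rw [e1 b _ hy1, sub_sub_cancel, e1 a _ hy0]
    ring
  have := hop.is_const_of_deriv_eq_zero (hstar.isPathConnected hhalf).isConnected.isPreconnected
    (f := f) (fun y hy => (hd y hy).differentiableAt.differentiableWithinAt)
    (fun y hy => (hd y hy).deriv) (x := x) (y := 1/2) ⟨hx, hx1⟩ hhalf
  refine this.trans ?_
  simp only [hf, Bc]
  norm_num

lemma hI_half (a b : ℝ) : Complex.exp (a * Complex.log (1/2)) * hI a b (1/2) =
    ∫ x in (0:ℝ)..(1/2), (x:ℂ) ^ ((a:ℂ) - 1) * (1 - (x:ℂ)) ^ ((b:ℂ) - 1) := by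
  have h := intervalIntegral.integral_comp_mul_right (a := 0) (b := 1)
    (fun x : ℝ => (x:ℂ) ^ ((a:ℂ) - 1) * (1 - (x:ℂ)) ^ ((b:ℂ) - 1)) (c := (1/2:ℝ)) (by norm_num)
  rw [zero_mul, one_mul, eq_inv_smul_iff₀ (by norm_num)] at h
  rw [← h, hI, ← intervalIntegral.integral_const_mul, ← intervalIntegral.integral_smul]
  apply intervalIntegral.integral_congr_ae
  refine Filter.Eventually.of_forall fun s hs => ?_
  rw [uIoc_of_le zero_le_one] at hs
  have h0 : ((s * (1/2) : ℝ) : ℂ) ^ ((a:ℂ) - 1) = ((s ^ (a-1) : ℝ):ℂ) * (Complex.exp (a * Complex.log (1/2)) * 2) := by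
    have : ((a:ℂ) - 1) = ((a - 1 : ℝ) : ℂ) := by push_cast; ring
    rw [this, ← Complex.ofReal_cpow (mul_nonneg hs.1.le (by norm_num)), Real.mul_rpow hs.1.le (by norm_num)]
    rw [Real.rpow_sub_one (x := 1/2) (by norm_num) a]
    have h2 : Complex.exp (a * Complex.log (1/2)) = (((1/2:ℝ)^a : ℝ) : ℂ) := by
      rw [Complex.ofReal_cpow (by norm_num), Complex.cpow_def_of_ne_zero (by norm_num)]
      push_cast; rw [mul_comm]
    rw [h2]; push_cast; ring
  rw [h0]
  simp only [Complex.real_smul]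
  push_cast
  ring_nf

lemma Bc_eq_beta {a b : ℝ} (ha : 0 < a) (hb : 0 < b) : Bc a b = Complex.betaIntegral a b := by
  have hconv := Complex.betaIntegral_convergent (u := a) (v := b) (by simpa) (by simpa)
  rw [Bc, hI_half, hI_half, Complex.betaIntegral]
  rw [← intervalIntegral.integral_add_adjacent_intervals (a := 0) (b := (1/2:ℝ)) (c := 1)]
  · congr 1
    have := intervalIntegral.integral_comp_sub_left (a := 0) (b := 1/2)
      (fun x : ℝ => (x:ℂ) ^ ((a:ℂ) - 1) * (1 - (x:ℂ)) ^ ((b:ℂ) - 1)) 1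
    rw [show (1 - 1/2 : ℝ) = 1/2 by norm_num, sub_zero] at this
    rw [← this]
    apply intervalIntegral.integral_congr
    intro x hx
    simp only
    push_cast
    rw [sub_sub_cancel, mul_comm]
  · apply hconv.mono_set
    rw [uIcc_of_le (by norm_num), uIcc_of_le (by norm_num)]
    exact Icc_subset_Icc (by norm_num) (by norm_num)
  · apply hconv.mono_set
    rw [uIcc_of_le (by norm_num), uIcc_of_le (by norm_num)]
    exact Icc_subset_Icc (by norm_num) (by norm_num)

lemma Bc_ne {a b : ℝ} (ha : 0 < a) (hb : 0 < b) : Bc a b ≠ 0 := by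
  rw [Bc_eq_beta ha hb, Complex.betaIntegral_eq_Gamma_mul_div _ _ (by simpa) (by simpa)]
  have h : ∀ z : ℂ, 0 < z.re → Complex.Gamma z ≠ 0 := fun z hz => Complex.Gamma_ne_zero_of_re_pos hz
  exact div_ne_zero (mul_ne_zero (h _ (by simpa)) (h _ (by simpa))) (h _ (by simp; linarith))

lemma choose_eF (N q : ℕ) (k : ℕ) :
    Ring.choose ((1 - (q:ℂ)/N) + k - 1) k = eF ℂ N q k := by
  have h1 : Ring.choose ((1 - (q:ℂ)/N) + k - 1) k = Ring.multichoose (1 - (q:ℂ)/N) k := by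
    rw [Ring.choose]; congr 1; ring
  rw [h1]
  have h2 : ∀ k, (k.factorial : ℂ) * Ring.multichoose (1 - (q:ℂ)/N) k = (ascPochhammer ℂ k).eval (1 - (q:ℂ)/N) := by
    intro k
    rw [← nsmul_eq_mul, Ring.factorial_nsmul_multichoose_eq_ascPochhammer,
      Polynomial.ascPochhammer_smeval_eq_eval]
  have h3 : ∀ k, (ascPochhammer ℂ k).eval (1 - (q:ℂ)/N) = (k.factorial : ℂ) * eF ℂ N q k := by
    intro k
    induction k with
    | zero => simp [eF]
    | succ k ih =>
      rw [ascPochhammer_succ_eval, ih, eF, Nat.factorial_succ]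
      have : (k:ℂ) + 1 ≠ 0 := by exact_mod_cast Nat.succ_ne_zero k
      push_cast
      field_simp
      ring
  have h4 := (h2 k).trans (h3 k)
  exact mul_left_cancel₀ (by exact_mod_cast Nat.factorial_ne_zero k) h4

lemma Ev_E0 {N q : ℕ} (hqN : q < N) {x : ℂ} (hx : ‖x‖ < 1) :
    Ev x (E0 ℂ N q) ((1 - x) ^ (((q:ℝ)/N - 1 : ℝ) : ℂ)) := by
  refine ⟨?_, ?_⟩
  · refine Summable.of_nonneg_of_le (fun _ => norm_nonneg _) (fun n => ?_)
      (summable_geometric_of_lt_one (norm_nonneg x) hx)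
    rw [E0, PowerSeries.coeff_mk, norm_mul, norm_pow]
    exact mul_le_of_le_one_left (by positivity) (eF_norm N q hqN n)
  · have h := (Complex.one_div_one_sub_cpow_hasFPowerSeriesOnBall_zero (1 - (q:ℂ)/N)).hasSum
      (y := x) (by simpa [← ofReal_norm_eq_enorm, ← ENNReal.ofReal_one, ENNReal.ofReal_lt_ofReal_iff] using hx)
    simp only [FormalMultilinearSeries.ofScalars_apply_eq, choose_eF, zero_add, smul_eq_mul] at h
    have e : (1 - x) ^ (((q:ℝ)/N - 1 : ℝ) : ℂ) = 1 / (1 - x) ^ (1 - (q:ℂ)/N) := by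
      rw [one_div, ← Complex.cpow_neg]; congr 1; push_cast; ring
    rw [e]
    simpa [E0] using h

lemma Ev_U0 {N p q : ℕ} (hp : 0 < p) (hqN : q < N) {x : ℂ} (hx : ‖x‖ < 1) :
    Ev x (U0 ℂ N p q) (hI ((p:ℝ)/N) ((q:ℝ)/N) x) := by
  have hN : (0:ℝ) < N := by exact_mod_cast (by omega : 0 < N)
  have hpN : (0:ℝ) < (p:ℝ)/N := by have : (0:ℝ) < p := by exact_mod_cast hp
                                   positivity
  set a := (p:ℝ)/N with ha
  have hb : ∀ n : ℕ, ‖eF ℂ N q n / ((p:ℂ)/N + n)‖ ≤ 1 / a := by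
    intro n
    rw [norm_div]
    have : ‖(p:ℂ)/N + n‖ = a + n := by
      have : (p:ℂ)/N + n = ((a + n : ℝ):ℂ) := by simp [ha]
      rw [this, Complex.norm_real, Real.norm_of_nonneg (by positivity)]
    rw [this]
    have h1 : a ≤ a + n := by simp
    exact div_le_div₀ zero_le_one (eF_norm N q hqN n) hpN h1
  refine ⟨?_, ?_⟩
  · refine Summable.of_nonneg_of_le (fun _ => norm_nonneg _) (fun n => ?_)
      ((summable_geometric_of_lt_one (norm_nonneg x) hx).mul_left (1/a))
    rw [U0, PowerSeries.coeff_mk, norm_mul, norm_pow]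
    exact mul_le_mul_of_nonneg_right (hb n) (by positivity)
  · have hsub : ∀ s : ℝ, s ∈ uIoc (0:ℝ) 1 → 0 < s ∧ s ≤ 1 := by
      intro s hs; rw [uIoc_of_le zero_le_one] at hs; exact hs
    have hint : ∀ n : ℕ, IntervalIntegrable (fun s : ℝ => ((s ^ (a-1) : ℝ):ℂ) * ((eF ℂ N q n) * ((s:ℂ)*x)^n)) volume 0 1 :=
      fun n => ii_mul hpN (by fun_prop)
    have h := intervalIntegral.hasSum_integral_of_dominated_convergence (μ := volume) (a := 0) (b := 1)
      (F := fun n s => ((s ^ (a-1) : ℝ):ℂ) * ((eF ℂ N q n) * ((s:ℂ)*x)^n))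
      (f := fun s => ((s ^ (a-1) : ℝ):ℂ) * (1 - (s:ℂ)*x) ^ (((q:ℝ)/N - 1 : ℝ) : ℂ))
      (fun n s => s ^ (a-1) * ‖x‖^n) ?_ ?_ ?_ ?_ ?_
    · refine (congrArg (fun g : ℕ → ℂ => HasSum g (hI a ((q:ℝ)/N) x)) (funext fun n => ?_)).mpr h
      have e1 : ∫ s in (0:ℝ)..1, ((s ^ (a-1) : ℝ):ℂ) * ((eF ℂ N q n) * ((s:ℂ)*x)^n) =
          ∫ s in (0:ℝ)..1, ((eF ℂ N q n) * x^n) * ((s ^ (a + n - 1) : ℝ):ℂ) := by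
        apply intervalIntegral.integral_congr_ae
        refine Filter.Eventually.of_forall fun s hs => ?_
        have : s ^ (a + n - 1) = s ^ (a-1) * s ^ n := by
          rw [← Real.rpow_add_natCast (hsub s hs).1.ne']; congr 1; ring
        simp only [this]; push_cast; ring
      rw [e1, intervalIntegral.integral_const_mul, intervalIntegral.integral_ofReal,
        integral_rpow (Or.inl (by have : (0:ℝ) ≤ n := by positivity
                                  linarith))]
      have h0 : a + n - 1 + 1 = a + n := by ring
      rw [h0, Real.zero_rpow (by positivity), Real.one_rpow, U0, PowerSeries.coeff_mk]
      have : (p:ℂ)/N = ((a:ℝ):ℂ) := by simp [ha]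
      rw [this]; push_cast; ring
    · intro n
      exact (intervalIntegrable_iff.1 (hint n)).aestronglyMeasurable
    · intro n
      refine Filter.Eventually.of_forall fun s hs => ?_
      obtain ⟨h0, h1⟩ := hsub s hs
      rw [norm_mul, Complex.norm_real, Real.norm_of_nonneg (Real.rpow_nonneg h0.le _)]
      refine mul_le_mul_of_nonneg_left ?_ (Real.rpow_nonneg h0.le _)
      rw [norm_mul, norm_pow, norm_mul, Complex.norm_real, Real.norm_of_nonneg h0.le]
      calc _ ≤ 1 * (1 * ‖x‖)^n := by
            gcongr
            exact eF_norm N q hqN n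
        _ = _ := by simp
    · exact Filter.Eventually.of_forall fun s hs =>
        (summable_geometric_of_lt_one (norm_nonneg x) hx).mul_left _
    · simp_rw [tsum_mul_left]
      exact (ii_rpow hpN).mul_const _
    · refine Filter.Eventually.of_forall fun s hs => ?_
      obtain ⟨h0, h1⟩ := hsub s hs
      have hsx : ‖(s:ℂ) * x‖ < 1 := by
        rw [norm_mul, Complex.norm_real, Real.norm_of_nonneg h0.le]
        nlinarith [norm_nonneg x]
      have := (Ev_E0 hqN hsx).2.mul_left ((s ^ (a-1) : ℝ):ℂ)
      simpa [E0] using this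
end SB
end

section
namespace SB
open Set Topology Filter Finset

lemma key_ineq_aux {X Y a b α : ℝ} (hX : 0 < X) (hXY : X ≤ Y) (h1 : 1 ≤ X + Y)
    (hb : 0 < b) (hb1 : b < 1) (hα : 0 < α) (ha : α ≤ a) (hab : α ≤ 1 - a - b) :
    (X ^ (a-1) * Y ^ (b-1)) ^ 2 ≤ 16 * (X ^ (α-1) / (1 + (X ^ α)^2)) ^ 2 := by
  have hY : 0 < Y := by linarith
  have h0 : 0 ≤ X ^ (a-1) * Y ^ (b-1) := by positivity
  have h2 : X ^ (a-1) * Y ^ (b-1) ≤ 4 * (X ^ (α-1) / (1 + (X ^ α)^2)) := by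
    have hXa : 0 < X ^ α := by positivity
    rcases le_total X 1 with h | h
    · have e1 : X ^ α ≤ 1 := Real.rpow_le_one hX.le h hα.le
      have e2 : X ^ (a-1) ≤ X ^ (α-1) := Real.rpow_le_rpow_of_exponent_ge hX h (by linarith)
      have e3 : Y ^ (b-1) ≤ 2 := by
        calc Y ^ (b-1) ≤ (1/2:ℝ) ^ (b-1) :=
              Real.rpow_le_rpow_of_nonpos (by norm_num) (by linarith) (by linarith)
          _ ≤ (1/2:ℝ) ^ (-1:ℝ) := Real.rpow_le_rpow_of_exponent_ge (by norm_num) (by norm_num) (by linarith)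
          _ = 2 := by rw [Real.rpow_neg_one]; norm_num
      have e4 : X ^ (a-1) * Y ^ (b-1) ≤ X ^ (α-1) * 2 := by gcongr
      have e5 : X ^ (α-1) * 2 ≤ 4 * (X ^ (α-1) / (1 + (X ^ α)^2)) := by
        have : 0 < X ^ (α-1) := by positivity
        rw [← mul_div_assoc, le_div_iff₀ (by positivity)]
        nlinarith [mul_le_mul_of_nonneg_left (by nlinarith : (X ^ α)^2 ≤ 1) this.le]
      linarith
    · have e1 : 1 ≤ X ^ α := Real.one_le_rpow h hα.le
      have e3 : Y ^ (b-1) ≤ X ^ (b-1) := Real.rpow_le_rpow_of_nonpos hX hXY (by linarith)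
      have e4 : X ^ (a-1) * Y ^ (b-1) ≤ X ^ (a-1) * X ^ (b-1) := by gcongr
      rw [← Real.rpow_add hX] at e4
      have e5 : X ^ (a - 1 + (b-1)) ≤ X ^ (-α - 1) := Real.rpow_le_rpow_of_exponent_le h (by linarith)
      have e6 : X ^ (-α-1) * (X^α)^2 = X ^ (α-1) := by
        rw [← Real.rpow_natCast, ← Real.rpow_mul hX.le, ← Real.rpow_add hX]; congr 1; push_cast; ring
      have e7 : X ^ (-α-1) ≤ 4 * (X ^ (α-1) / (1 + (X ^ α)^2)) := by
        have : 0 < X ^ (-α-1) := by positivity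
        rw [← mul_div_assoc, le_div_iff₀ (by positivity), ← e6]
        nlinarith [mul_le_mul_of_nonneg_left (by nlinarith : 1 ≤ (X ^ α)^2) this.le]
      linarith
  calc _ ≤ (4 * (X ^ (α-1) / (1 + (X ^ α)^2)))^2 := by gcongr
    _ = _ := by ring

lemma key_ineq {X Y a b α : ℝ} (hX : 0 < X) (hY : 0 < Y) (h1 : 1 ≤ X + Y)
    (hα : 0 < α) (ha : α ≤ a) (hb : α ≤ b) (hab : α ≤ 1 - a - b) :
    (X ^ (a-1) * Y ^ (b-1)) ^ 2 ≤ 16 * ((X ^ (α-1) / (1 + (X ^ α)^2)) ^ 2 + (Y ^ (α-1) / (1 + (Y ^ α)^2)) ^ 2) := by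
  rcases le_total X Y with h | h
  · have := key_ineq_aux hX h h1 (b := b) (a := a) (by linarith) (by linarith) hα ha hab
    nlinarith [sq_nonneg (Y ^ (α-1) / (1 + (Y ^ α)^2))]
  · have := key_ineq_aux hY h (by linarith) (b := a) (a := b) (by linarith) (by linarith) hα hb (by linarith)
    rw [mul_comm (X ^ (a-1))]
    nlinarith [sq_nonneg (X ^ (α-1) / (1 + (X ^ α)^2))]

lemma sphere_id (W w : ℂ) : ‖1 + (starRingEnd ℂ) w * W‖ ^ 2 =
    (1 + ‖W‖^2) * (1 + ‖w‖^2) - ‖W - w‖^2 := by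
  rw [← Complex.normSq_eq_norm_sq, ← Complex.normSq_eq_norm_sq, ← Complex.normSq_eq_norm_sq, ← Complex.normSq_eq_norm_sq]
  simp [Complex.normSq_apply]; ring

lemma sphere_le (W w : ℂ) (k : ℕ) : ‖1 + (starRingEnd ℂ) w * W‖ ^ (2 * k) ≤
    (1 + ‖W‖^2)^k * (1 + ‖w‖^2)^k * Real.exp (-(k * (‖W - w‖^2 / ((1 + ‖W‖^2) * (1 + ‖w‖^2))))) := by
  have h : ‖1 + (starRingEnd ℂ) w * W‖ ^ 2 ≤
    (1 + ‖W‖^2) * (1 + ‖w‖^2) * Real.exp (-(‖W - w‖^2 / ((1 + ‖W‖^2) * (1 + ‖w‖^2)))) := by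
    have hpos : 0 < (1 + ‖W‖^2) * (1 + ‖w‖^2) := by positivity
    have h1 := Real.add_one_le_exp (-(‖W - w‖^2 / ((1 + ‖W‖^2) * (1 + ‖w‖^2))))
    have h2 := mul_le_mul_of_nonneg_left h1 hpos.le
    refine le_trans (le_of_eq ?_) h2
    rw [sphere_id]; field_simp; ring
  rw [pow_mul]
  refine (pow_le_pow_left₀ (by positivity) h k).trans (le_of_eq ?_)
  rw [mul_pow, mul_pow, ← Real.exp_nat_mul]; congr 2; ring

lemma quad_id (w ws c : ℂ) : ‖w - c‖^2 = 2 * ((starRingEnd ℂ) (ws - c) * (w - c)).re - ‖ws - c‖^2 + ‖w - ws‖^2 := by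
  rw [← Complex.normSq_eq_norm_sq, ← Complex.normSq_eq_norm_sq, ← Complex.normSq_eq_norm_sq]
  simp [Complex.normSq_apply]; ring

lemma slope_sq {f : ℂ → ℂ} {d z : ℂ} (h : HasDerivAt f d z) :
    Tendsto (fun x => ‖f x - f z‖^2 / ‖x - z‖^2) (𝓝[≠] z) (𝓝 (‖d‖^2)) := by
  have := (hasDerivAt_iff_tendsto_slope.1 h).norm.pow 2
  refine this.congr fun x => ?_
  rw [slope_def_field, norm_div, div_pow]

lemma max_contra {ι : Type*} (S : Finset ι) (F0 W1 W2 : ℂ → ℂ) (w : ι → ℂ → ℂ) (z : ℂ)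
    (hF0 : ∀ᶠ x in 𝓝 z, DifferentiableAt ℂ F0 x) (hW1 : ∀ᶠ x in 𝓝 z, DifferentiableAt ℂ W1 x)
    (hW2 : ∀ᶠ x in 𝓝 z, DifferentiableAt ℂ W2 x)
    (hw : ∀ i ∈ S, ∀ᶠ x in 𝓝 z, DifferentiableAt ℂ (w i) x)
    (d1 d2 : ℂ) (d : ι → ℂ) (hd1 : HasDerivAt W1 d1 z) (hd2 : HasDerivAt W2 d2 z)
    (hd : ∀ i ∈ S, HasDerivAt (w i) (d i) z) (k : ℕ) (m : ℝ) (c : ι → ℂ)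
    (hγ : m * ∑ i ∈ S, ‖d i‖^2 < k * (‖d1‖^2 / (1 + ‖W1 z‖^2)^2 + ‖d2‖^2 / (1 + ‖W2 z‖^2)^2))
    (hz : F0 z ≠ 0)
    (hmax : ∀ᶠ x in 𝓝 z, ‖F0 x‖ * ((1 + ‖W1 x‖^2) * (1 + ‖W2 x‖^2))^k *
        Real.exp (-(m * ∑ i ∈ S, ‖w i x - c i‖^2)) ≤
      ‖F0 z‖ * ((1 + ‖W1 z‖^2) * (1 + ‖W2 z‖^2))^k * Real.exp (-(m * ∑ i ∈ S, ‖w i z - c i‖^2))) :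
    False := by
  set F : ℂ → ℂ := fun x => F0 x * (1 + (starRingEnd ℂ) (W1 z) * W1 x)^(2*k) *
    (1 + (starRingEnd ℂ) (W2 z) * W2 x)^(2*k) *
    Complex.exp (-(2 * m * ∑ i ∈ S, (starRingEnd ℂ) (w i z - c i) * (w i x - c i))) with hF
  set q : (ℂ → ℂ) → ℂ → ℝ := fun W x => ‖W x - W z‖^2 / ((1 + ‖W x‖^2) * (1 + ‖W z‖^2)) with hq
  set s : ℂ → ℝ := fun x => k * q W1 x + k * q W2 x - m * ∑ i ∈ S, ‖w i x - w i z‖^2 with hs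
  have hspos : ∀ᶠ x in 𝓝[≠] z, 0 < s x := by
    have t1 : ∀ (W : ℂ → ℂ) (d : ℂ), HasDerivAt W d z →
        Tendsto (fun x => q W x / ‖x - z‖^2) (𝓝[≠] z) (𝓝 (‖d‖^2 / (1 + ‖W z‖^2)^2)) := by
      intro W d hW
      have h1 := slope_sq hW
      have h2 : Tendsto (fun x => (1 + ‖W x‖^2) * (1 + ‖W z‖^2)) (𝓝[≠] z) (𝓝 ((1 + ‖W z‖^2) * (1 + ‖W z‖^2))) :=
        ((((hW.continuousAt.tendsto.mono_left nhdsWithin_le_nhds).norm.pow 2).const_add 1).mul_const _)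
      have h3 := h1.div h2 (by positivity)
      rw [← sq] at h3
      refine h3.congr fun x => ?_
      simp only [hq, Pi.div_apply]; rw [div_right_comm]
    have t2 : Tendsto (fun x => s x / ‖x - z‖^2) (𝓝[≠] z)
        (𝓝 (k * (‖d1‖^2 / (1 + ‖W1 z‖^2)^2) + k * (‖d2‖^2 / (1 + ‖W2 z‖^2)^2) - m * ∑ i ∈ S, ‖d i‖^2)) := by
      have h1 := ((t1 W1 d1 hd1).const_mul (k:ℝ)).add ((t1 W2 d2 hd2).const_mul (k:ℝ))
      have h2 : Tendsto (fun x => ∑ i ∈ S, ‖w i x - w i z‖^2 / ‖x - z‖^2) (𝓝[≠] z) (𝓝 (∑ i ∈ S, ‖d i‖^2)) :=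
        tendsto_finsetSum _ fun i hi => slope_sq (hd i hi)
      refine (h1.sub (h2.const_mul m)).congr fun x => ?_
      simp only [hs, ← Finset.sum_div]; ring
    have h3 := t2.eventually (lt_mem_nhds (by linarith : (0:ℝ) < _))
    filter_upwards [h3, self_mem_nhdsWithin] with x hx hne
    have : 0 < ‖x - z‖^2 := by
      have : 0 < ‖x - z‖ := norm_pos_iff.2 (sub_ne_zero.2 hne)
      positivity
    exact (div_pos_iff_of_pos_right this).1 hx
  have hnF : ∀ x, ‖F x‖ = ‖F0 x‖ * ‖1 + (starRingEnd ℂ) (W1 z) * W1 x‖^(2*k) *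
    ‖1 + (starRingEnd ℂ) (W2 z) * W2 x‖^(2*k) *
    Real.exp (-(m * ∑ i ∈ S, (‖w i x - c i‖^2 + ‖w i z - c i‖^2 - ‖w i x - w i z‖^2))) := by
    intro x
    simp only [hF, norm_mul, norm_pow, Complex.norm_exp]
    congr 2
    have e : ∀ i, ‖w i x - c i‖^2 + ‖w i z - c i‖^2 - ‖w i x - w i z‖^2 =
      2 * ((starRingEnd ℂ) (w i z - c i) * (w i x - c i)).re := fun i => by
        rw [quad_id (w i x) (w i z) (c i)]; ring
    simp_rw [e]
    rw [← Finset.mul_sum, ← Complex.re_sum, Complex.neg_re]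
    congr 1
    rw [show (2 * (m:ℂ)) = ((2 * m : ℝ) : ℂ) by push_cast; ring, Complex.re_ofReal_mul]; ring
  set D := ((1 + ‖W1 z‖^2) * (1 + ‖W2 z‖^2))^k * Real.exp (-(m * ∑ i ∈ S, ‖w i z - c i‖^2)) with hD
  have hDpos : 0 < D := by positivity
  set G : ℂ → ℝ := fun x => ‖F0 x‖ * ((1 + ‖W1 x‖^2) * (1 + ‖W2 x‖^2))^k *
        Real.exp (-(m * ∑ i ∈ S, ‖w i x - c i‖^2)) with hG
  have hle : ∀ x, ‖F x‖ ≤ G x * D * Real.exp (-s x) := by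
    intro x
    rw [hnF]
    have h1 := sphere_le (W1 x) (W1 z) k
    have h2 := sphere_le (W2 x) (W2 z) k
    calc _ ≤ ‖F0 x‖ * ((1 + ‖W1 x‖^2)^k * (1 + ‖W1 z‖^2)^k * Real.exp (-(k * q W1 x))) *
          ((1 + ‖W2 x‖^2)^k * (1 + ‖W2 z‖^2)^k * Real.exp (-(k * q W2 x))) * _ := by
            gcongr
      _ = _ := by
        simp only [hG, hD, hs, Finset.sum_add_distrib, Finset.sum_sub_distrib]
        have : Real.exp (-(m * (∑ i ∈ S, ‖w i x - c i‖^2 + ∑ i ∈ S, ‖w i z - c i‖^2 - ∑ i ∈ S, ‖w i x - w i z‖^2)))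
          = Real.exp (-(m * ∑ i ∈ S, ‖w i x - c i‖^2)) * Real.exp (-(m * ∑ i ∈ S, ‖w i z - c i‖^2)) *
            Real.exp (m * ∑ i ∈ S, ‖w i x - w i z‖^2) := by
          rw [← Real.exp_add, ← Real.exp_add]; congr 1; ring
        rw [this]
        have : Real.exp (-(k * q W1 x + k * q W2 x - m * ∑ i ∈ S, ‖w i x - w i z‖^2)) =
          Real.exp (-(k * q W1 x)) * Real.exp (-(k * q W2 x)) * Real.exp (m * ∑ i ∈ S, ‖w i x - w i z‖^2) := by
          rw [← Real.exp_add, ← Real.exp_add]; congr 1; ring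
        rw [this]; simp only [mul_pow]; ring
  have hFz : ‖F z‖ = G z * D := by
    rw [hnF]
    have e : ∀ W : ℂ, ‖1 + (starRingEnd ℂ) W * W‖^(2*k) = (1 + ‖W‖^2)^k * (1 + ‖W‖^2)^k := by
      intro W; rw [pow_mul, sphere_id]; simp [mul_pow]
    rw [e, e]
    simp only [hG, hD, sub_self, norm_zero, Finset.sum_add_distrib]
    have : Real.exp (-(m * ∑ i ∈ S, (‖w i z - c i‖^2 + ‖w i z - c i‖^2 - 0^2))) =
      Real.exp (-(m * ∑ i ∈ S, ‖w i z - c i‖^2)) * Real.exp (-(m * ∑ i ∈ S, ‖w i z - c i‖^2)) := by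
      rw [← Real.exp_add]; congr 1
      simp [Finset.sum_add_distrib]; ring
    rw [this]; simp only [mul_pow]; ring
  have hGz : 0 < G z := by
    have : 0 < ‖F0 z‖ := norm_pos_iff.2 hz
    simp only [hG]; positivity
  have hlt : ∀ᶠ x in 𝓝[≠] z, ‖F x‖ < ‖F z‖ := by
    filter_upwards [hspos, hmax.filter_mono nhdsWithin_le_nhds] with x hx hm
    have h1 : G x ≤ G z := hm
    rw [hFz]
    calc ‖F x‖ ≤ G x * D * Real.exp (-s x) := hle x
      _ ≤ G z * D * Real.exp (-s x) := by gcongr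
      _ < G z * D * 1 := by
        have : Real.exp (-s x) < 1 := by rw [Real.exp_lt_one_iff]; linarith
        gcongr
      _ = _ := mul_one _
  have hloc : IsLocalMax (norm ∘ F) z := by
    rw [IsLocalMax, IsMaxFilter]
    have := hlt
    rw [eventually_nhdsWithin_iff] at this
    filter_upwards [this] with x hx
    by_cases h : x = z
    · rw [h]
    · exact (hx h).le
  have hdF : ∀ᶠ x in 𝓝 z, DifferentiableAt ℂ F x := by
    have hw' : ∀ᶠ x in 𝓝 z, ∀ i ∈ S, DifferentiableAt ℂ (w i) x := (Finset.eventually_all S).2 hw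
    filter_upwards [hF0, hW1, hW2, hw'] with x h0 h1 h2 h3
    have h4 : DifferentiableAt ℂ (fun x => ∑ i ∈ S, (starRingEnd ℂ) (w i z - c i) * (w i x - c i)) x :=
      DifferentiableAt.fun_sum fun i hi => ((h3 i hi).sub_const _).const_mul _
    exact ((h0.mul (((h1.const_mul _).const_add _).pow _)).mul (((h2.const_mul _).const_add _).pow _)).mul
      ((h4.const_mul _).neg.cexp)
  have hev := Complex.eventually_eq_of_isLocalMax_norm hdF hloc
  obtain ⟨x, hx1, hx2⟩ := (hlt.and (hev.filter_mono nhdsWithin_le_nhds)).exists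
  rw [hx2] at hx1
  exact lt_irrefl _ hx1
end SB
end

section
namespace SB
open Set Topology Filter

structure SD (ι R : Type) [Fintype ι] [CommRing R] where
  σ : ι → R →+* ℂ
  N : ℕ
  hN : N ≠ 0
  a : ι → ℝ
  b : ι → ℝ
  α0 : Rˣ
  β0 : Rˣ
  hα1 : α0 ^ N = 1
  hβ1 : β0 ^ N = 1
  hα : ∀ i, σ i α0 = Complex.exp (2 * Real.pi * Complex.I * a i)
  hβ : ∀ i, σ i β0 = Complex.exp (2 * Real.pi * Complex.I * b i)
  S : Finset ι
  i0 : ι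
  ha0 : ∀ i, 1 / (N:ℝ) ≤ a i
  ha1 : ∀ i, a i < 1
  hb0 : ∀ i, 1 / (N:ℝ) ≤ b i
  hb1 : ∀ i, b i < 1
  hS : ∀ i ∈ S, 1 / (N:ℝ) ≤ 1 - a i - b i
  hdom : ∀ i, ∃ j ∈ S, ∀ ν, ‖σ i ν‖ = ‖σ j ν‖
  hfin : ∀ M : ℝ, {ν : R | ∀ i ∈ S, ‖σ i ν‖ ≤ M}.Finite

variable {ι R : Type} [Fintype ι] [CommRing R]

def SD.swap (D : SD ι R) : SD ι R where
  σ := D.σ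
  N := D.N
  hN := D.hN
  a := D.b
  b := D.a
  α0 := D.β0
  β0 := D.α0
  hα1 := D.hβ1
  hβ1 := D.hα1
  hα := D.hβ
  hβ := D.hα
  S := D.S
  i0 := D.i0
  ha0 := D.hb0
  ha1 := D.hb1
  hb0 := D.ha0
  hb1 := D.ha1
  hS := fun i hi => by have := D.hS i hi; linarith
  hdom := D.hdom
  hfin := D.hfin

namespace SD
variable (D : SD ι R)

lemma swap_swap : D.swap.swap = D := rfl

lemma Npos : (0:ℝ) < D.N := by exact_mod_cast Nat.pos_of_ne_zero D.hN
lemma ap (i : ι) : 0 < D.a i := lt_of_lt_of_le (by have := D.Npos; positivity) (D.ha0 i)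
lemma bp (i : ι) : 0 < D.b i := lt_of_lt_of_le (by have := D.Npos; positivity) (D.hb0 i)

noncomputable def yv (ω : R) (L x : ℂ) : ℂ :=
  D.σ D.i0 ω * (Complex.exp (D.a D.i0 * L) * Complex.exp (D.b D.i0 * Complex.log (1 - x)))

noncomputable def wv (ω ν : R) (L x : ℂ) (i : ι) : ℂ :=
  D.σ i ω * (Complex.exp (D.a i * L) * hI (D.a i) (D.b i) x + D.σ i ν * Bc (D.a i) (D.b i))

def AV (x Y : ℂ) (w : ι → ℂ) : Prop :=
  1 - x ∈ Complex.slitPlane ∧ ∃ (ω ν : R) (L : ℂ), ω ^ D.N = 1 ∧ Complex.exp L = x ∧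
    Y = D.yv ω L x ∧ w = D.wv ω ν L x

def BV (x Y : ℂ) (w : ι → ℂ) : Prop := D.swap.AV (1 - x) Y (-w)

def V (x Y : ℂ) (w : ι → ℂ) : Prop := D.AV x Y w ∨ D.BV x Y w

lemma V_swap {x Y : ℂ} {w : ι → ℂ} (h : D.V x Y w) : D.swap.V (1 - x) Y (-w) := by
  rcases h with h | h
  · right; rw [BV, swap_swap]; simpa using h
  · left; exact h

lemma sα (k : ℤ) (i : ι) : D.σ i ((D.α0 ^ k : Rˣ) : R) = Complex.exp (D.a i * (k * (2 * Real.pi * Complex.I))) := by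
  have h1 : D.σ i ((D.α0 ^ k : Rˣ) : R) = (((Units.map (D.σ i : R →* ℂ) D.α0) ^ k : ℂˣ) : ℂ) := by
    rw [← map_zpow]; rfl
  rw [h1, Units.val_zpow_eq_zpow_val]
  have h2 : ((Units.map (D.σ i : R →* ℂ) D.α0 : ℂˣ) : ℂ) = D.σ i D.α0 := rfl
  rw [h2, D.hα, ← Complex.exp_int_mul]; congr 1; ring

/-- change of the branch of the logarithm -/
lemma AV_branch {x Y : ℂ} {w : ι → ℂ} (h : D.AV x Y w) {L' : ℂ} (hL' : Complex.exp L' = x) :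
    ∃ ω ν : R, ω ^ D.N = 1 ∧ Y = D.yv ω L' x ∧ w = D.wv ω ν L' x := by
  obtain ⟨hs, ω, ν, L, hω, hL, rfl, rfl⟩ := h
  obtain ⟨k, hk⟩ := Complex.exp_eq_exp_iff_exists_int.1 (hL.trans hL'.symm)
  have hmul : ∀ i, D.σ i ((D.α0 ^ k : Rˣ) : R) * Complex.exp (D.a i * L') = Complex.exp (D.a i * L) := by
    intro i
    rw [sα, ← Complex.exp_add, hk]; congr 1; ring
  have hinv : ∀ i, D.σ i ((D.α0 ^ k : Rˣ) : R) * D.σ i ((D.α0 ^ (-k) : Rˣ) : R) = 1 := by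
    intro i
    rw [← map_mul, ← Units.val_mul, ← zpow_add]; simp
  refine ⟨ω * ((D.α0 ^ k : Rˣ) : R), ((D.α0 ^ (-k) : Rˣ) : R) * ν, ?_, ?_, ?_⟩
  · rw [mul_pow, hω, one_mul, ← Units.val_pow_eq_pow_val, ← zpow_natCast, ← zpow_mul, mul_comm, zpow_mul,
      zpow_natCast, D.hα1]; simp
  · rw [yv, yv, map_mul, ← hmul]; ring
  · funext i
    rw [wv, wv, map_mul, map_mul, ← hmul]
    have := hinv i
    linear_combination (- D.σ i ω * D.σ i ν * Bc (D.a i) (D.b i)) * this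

lemma AV_BV {x Y : ℂ} {w : ι → ℂ} (h : D.AV x Y w) (hx : x ∈ Complex.slitPlane) : D.BV x Y w := by
  have hs := h.1
  obtain ⟨ω, ν, hω, rfl, rfl⟩ := D.AV_branch h (Complex.exp_log (Complex.slitPlane_ne_zero hx))
  refine ⟨by simpa using hx, ω, -(1 + ν), Complex.log (1 - x), hω,
    Complex.exp_log (Complex.slitPlane_ne_zero hs), ?_, ?_⟩
  · simp only [yv, swap, sub_sub_cancel]; ring
  · funext i
    have := hI_func (D.ap i) (D.bp i) hx hs
    simp only [wv, swap, Pi.neg_apply, map_neg, map_add, map_one]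
    rw [Bc_comm (D.b i)]
    linear_combination (- D.σ i ω) * this

lemma V_AV {x Y : ℂ} {w : ι → ℂ} (h : D.V x Y w) (hx : 1 - x ∈ Complex.slitPlane) : D.AV x Y w := by
  rcases h with h | h
  · exact h
  · have := D.swap.AV_BV h hx
    rw [BV, swap_swap] at this
    simpa using this

lemma V_ne {x Y : ℂ} {w : ι → ℂ} (h : D.V x Y w) : x ≠ 0 ∧ 1 - x ≠ 0 := by
  rcases h with h | h
  · obtain ⟨hs, ω, ν, L, hω, hL, -⟩ := h
    exact ⟨hL ▸ Complex.exp_ne_zero L, Complex.slitPlane_ne_zero hs⟩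
  · obtain ⟨hs, ω, ν, L, hω, hL, -⟩ := h
    exact ⟨by simpa using Complex.slitPlane_ne_zero hs, hL ▸ Complex.exp_ne_zero L⟩

lemma norm_exp_mul (c : ℝ) (L : ℂ) : ‖Complex.exp (c * L)‖ = ‖Complex.exp L‖ ^ c := by
  rw [Complex.norm_exp, Complex.norm_exp, ← Real.exp_mul]; congr 1; simp [mul_comm]

lemma rpow_le_one_add {r c : ℝ} (hr : 0 ≤ r) (hc : 0 ≤ c) (hc1 : c ≤ 1) : r ^ c ≤ 1 + r := by
  rcases le_total r 1 with h | h
  · linarith [Real.rpow_le_one hr h hc]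
  · have := Real.rpow_le_rpow_of_exponent_le h hc1
    rw [Real.rpow_one] at this; linarith

lemma norm_ω {ω : R} (h : ω ^ D.N = 1) (i : ι) : ‖D.σ i ω‖ = 1 := by
  have : D.σ i ω ^ D.N = 1 := by rw [← map_pow, h, map_one]
  exact Complex.norm_eq_one_of_pow_eq_one this D.hN

/-- constants -/
structure Cst (C : ℝ) : Prop where
  one : 1 ≤ C
  h : ∀ i x, 1 - x ∈ Complex.slitPlane → ‖hI (D.a i) (D.b i) x‖ ≤ C * (1 + ‖x‖)
  h' : ∀ i x, 1 - x ∈ Complex.slitPlane → ‖hI (D.b i) (D.a i) x‖ ≤ C * (1 + ‖x‖)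
  B1 : ∀ i, 1 ≤ C * ‖Bc (D.a i) (D.b i)‖
  B2 : ∀ i, ‖Bc (D.a i) (D.b i)‖ ≤ C

lemma Cst.swap {D : SD ι R} {C : ℝ} (h : D.Cst C) : D.swap.Cst C where
  one := h.one
  h := h.h'
  h' := h.h
  B1 := fun i => by have := h.B1 i; rwa [Bc_comm] at this
  B2 := fun i => by have := h.B2 i; rwa [Bc_comm] at this

lemma exC : ∃ C, D.Cst C := by
  choose c1 h1 h1' using fun i => hI_bound (D.ap i) (D.ha1 i) (D.bp i) (D.hb1 i)
  choose c2 h2 h2' using fun i => hI_bound (D.bp i) (D.hb1 i) (D.ap i) (D.ha1 i)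
  set f : ι → ℝ := fun i => c1 i + c2 i + ‖Bc (D.a i) (D.b i)‖ + 1 / ‖Bc (D.a i) (D.b i)‖ with hf
  have hB : ∀ i, 0 < ‖Bc (D.a i) (D.b i)‖ := fun i => norm_pos_iff.2 (Bc_ne (D.ap i) (D.bp i))
  have hf0 : ∀ i, 0 ≤ f i := fun i => by
    have := h1 i; have := h2 i; have := hB i
    simp only [hf]; positivity
  have hle : ∀ i, f i ≤ 1 + ∑ j, f j := fun i => by
    have := Finset.single_le_sum (fun j _ => hf0 j) (Finset.mem_univ i)
    linarith
  have hd : ∀ i, c1 i ≤ 1 + ∑ j, f j ∧ c2 i ≤ 1 + ∑ j, f j ∧ ‖Bc (D.a i) (D.b i)‖ ≤ 1 + ∑ j, f j ∧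
      1 / ‖Bc (D.a i) (D.b i)‖ ≤ 1 + ∑ j, f j := fun i => by
    have e1 := h1 i; have e2 := h2 i; have e3 := hB i
    have e4 := hle i
    have e5 : 0 < 1 / ‖Bc (D.a i) (D.b i)‖ := by positivity
    simp only [hf] at e4 ⊢
    refine ⟨?_, ?_, ?_, ?_⟩ <;> linarith
  refine ⟨1 + ∑ i, f i, ?_, ?_, ?_, ?_, fun i => (hd i).2.2.1⟩
  · have := Finset.sum_nonneg (fun j (_ : j ∈ Finset.univ) => hf0 j)
    linarith
  · intro i x hx
    exact (h1' i x hx).trans (mul_le_mul_of_nonneg_right (hd i).1 (by positivity))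
  · intro i x hx
    exact (h2' i x hx).trans (mul_le_mul_of_nonneg_right (hd i).2.1 (by positivity))
  · intro i
    have := (hd i).2.2.2
    rwa [div_le_iff₀ (hB i)] at this

noncomputable def Q (c w : ι → ℂ) : ℝ := ∑ i ∈ D.S, ‖w i - c i‖^2

lemma Q_le {c w : ι → ℂ} {r : ℝ} (hr : 0 ≤ r) (h : D.Q c w ≤ r^2) {i : ι} (hi : i ∈ D.S) : ‖w i - c i‖ ≤ r := by
  have := Finset.single_le_sum (f := fun i => ‖w i - c i‖^2) (fun j _ => by positivity) hi
  exact le_of_sq_le_sq (this.trans h) hr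

lemma Q_neg (c w : ι → ℂ) : D.swap.Q (-c) (-w) = D.Q c w := by
  unfold Q
  refine Finset.sum_congr rfl fun i _ => ?_
  rw [Pi.neg_apply, Pi.neg_apply, ← neg_sub', norm_neg]

noncomputable def cc (ν0 : R) (i : ι) : ℂ := D.σ i ν0 * Bc (D.a i) (D.b i)

lemma cc_neg (ν0 : R) : D.swap.cc (-ν0) = - D.cc ν0 := by
  funext i
  simp only [cc, swap, Pi.neg_apply, map_neg]; rw [Bc_comm]; ring

lemma eh_bound {C : ℝ} (hC : D.Cst C) {L x : ℂ} (hs : 1 - x ∈ Complex.slitPlane) (hL : Complex.exp L = x) (i : ι) :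
    ‖Complex.exp (D.a i * L) * hI (D.a i) (D.b i) x‖ ≤ C * (1 + ‖x‖)^2 := by
  rw [norm_mul, norm_exp_mul, hL]
  have h1 := rpow_le_one_add (norm_nonneg x) (D.ap i).le (D.ha1 i).le
  have h2 := hC.h i x hs
  have := mul_le_mul h1 h2 (norm_nonneg _) (by positivity)
  linarith

lemma ν_bound {C : ℝ} (hC : D.Cst C) {ω ν ν0 : R} {L x : ℂ} (hs : 1 - x ∈ Complex.slitPlane)
    (hL : Complex.exp L = x) (hω : ω ^ D.N = 1) {H0 r : ℝ} (hr : 0 ≤ r) (hH : ∀ i, ‖D.σ i ν0‖ ≤ H0)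
    (hQ : D.Q (D.cc ν0) (D.wv ω ν L x) ≤ r^2) (i : ι) :
    ‖D.σ i ν‖ ≤ H0 + C * r + C^2 * (1 + ‖x‖)^2 := by
  obtain ⟨j, hj, hij⟩ := D.hdom i
  rw [hij]
  have h1 := D.Q_le hr hQ hj
  have h2 := D.eh_bound hC hs hL j
  set e := Complex.exp (D.a j * L) * hI (D.a j) (D.b j) x with he
  have hω1 := D.norm_ω hω j
  have h3 : ‖D.σ j ν * Bc (D.a j) (D.b j)‖ ≤ r + ‖D.cc ν0 j‖ + C * (1 + ‖x‖)^2 := by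
    have e1 : D.σ j ω * (D.σ j ν * Bc (D.a j) (D.b j)) =
        (D.wv ω ν L x j - D.cc ν0 j) + D.cc ν0 j - D.σ j ω * e := by
      simp only [wv, he]; ring
    have e2 : ‖D.σ j ν * Bc (D.a j) (D.b j)‖ = ‖D.σ j ω * (D.σ j ν * Bc (D.a j) (D.b j))‖ := by
      rw [norm_mul (D.σ j ω), hω1, one_mul]
    have e3 : ‖D.σ j ω * e‖ = ‖e‖ := by rw [norm_mul, hω1, one_mul]
    rw [e2, e1]
    refine (norm_sub_le _ _).trans ?_
    have := norm_add_le (D.wv ω ν L x j - D.cc ν0 j) (D.cc ν0 j)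
    rw [e3]; linarith
  rw [cc, norm_mul, norm_mul] at h3
  have hB1 := hC.B1 j
  have hC1 := hC.one
  set β := ‖Bc (D.a j) (D.b j)‖ with hβ
  have hHj := hH j
  have hβ0 : 0 < β := norm_pos_iff.2 (Bc_ne (D.ap j) (D.bp j))
  have e5 : (‖D.σ j ν‖ - H0) * β ≤ r + C * (1 + ‖x‖)^2 := by nlinarith
  set A := r + C * (1 + ‖x‖)^2 with hA
  have hA0 : 0 ≤ A := by positivity
  have : ‖D.σ j ν‖ - H0 ≤ C * A := by
    have h6 : (‖D.σ j ν‖ - H0) * β ≤ (C * A) * β := by nlinarith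
    exact le_of_mul_le_mul_right h6 hβ0
  rw [hA] at this
  nlinarith

lemma V_bound {C : ℝ} (hC : D.Cst C) {x Y : ℂ} {w : ι → ℂ} (h : D.V x Y w) {ν0 : R} {H0 r : ℝ} (hr : 0 ≤ r)
    (hH : ∀ i, ‖D.σ i ν0‖ ≤ H0) (hH0 : 0 ≤ H0)
    (hQ : D.Q (D.cc ν0) w ≤ r^2) :
    ‖Y‖ ≤ 2 * (1 + ‖x‖)^2 ∧ ∀ i, ‖w i‖ ≤ 8 * C^3 * (1 + ‖x‖)^2 * (1 + H0 + r) := by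
  have hC1 := hC.one
  have main : ∀ (D : SD ι R) (hC : D.Cst C) (x Y : ℂ) (w : ι → ℂ) (h : D.AV x Y w) (ν0 : R)
      (hH : ∀ i, ‖D.σ i ν0‖ ≤ H0) (hQ : D.Q (D.cc ν0) w ≤ r^2),
      ‖Y‖ ≤ (1 + ‖x‖) * (1 + ‖1 - x‖) ∧ ∀ i, ‖w i‖ ≤ 2 * C^3 * (1 + ‖x‖)^2 * (1 + H0 + r) := by
    intro D hC x Y w h ν0 hH hQ
    obtain ⟨hs, ω, ν, L, hω, hL, rfl, rfl⟩ := h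
    constructor
    · rw [yv, norm_mul, D.norm_ω hω, one_mul, norm_mul, norm_exp_mul, norm_exp_mul, hL,
        Complex.exp_log (Complex.slitPlane_ne_zero hs)]
      have h1 := rpow_le_one_add (norm_nonneg x) (D.ap D.i0).le (D.ha1 D.i0).le
      have h2 := rpow_le_one_add (norm_nonneg (1-x)) (D.bp D.i0).le (D.hb1 D.i0).le
      exact mul_le_mul h1 h2 (by positivity) (by positivity)
    · intro i
      have h1 := D.ν_bound hC hs hL hω hr hH hQ i
      have h2 := D.eh_bound hC hs hL i
      have h3 := hC.B2 i
      rw [wv, norm_mul, D.norm_ω hω, one_mul]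
      refine (norm_add_le _ _).trans ?_
      rw [norm_mul (D.σ i ν)]
      have h4 : ‖D.σ i ν‖ * ‖Bc (D.a i) (D.b i)‖ ≤ (H0 + C * r + C^2 * (1 + ‖x‖)^2) * C :=
        mul_le_mul h1 h3 (norm_nonneg _) (by positivity)
      have hx := norm_nonneg x
      set q := (1 + ‖x‖)^2 with hq
      have hq1 : 1 ≤ q := by nlinarith
      have c2 : C ≤ C^2 := by nlinarith
      have c3 : C^2 ≤ C^3 := by nlinarith [sq_nonneg C]
      have i1 : H0 * C ≤ C^3 * q * H0 := by
        have : C ≤ C^3 * q := by nlinarith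
        nlinarith
      have i2 : C * r * C ≤ C^3 * q * r := by
        have : C^2 ≤ C^3 * q := by nlinarith
        nlinarith
      have i3 : C * q ≤ C^3 * q := by nlinarith
      have i4 : 0 ≤ C^3 * q * H0 := by positivity
      have i5 : 0 ≤ C^3 * q * r := by positivity
      nlinarith
  have hn : ‖1 - x‖ ≤ 1 + ‖x‖ := by simpa using norm_sub_le (1:ℂ) x
  have hx := norm_nonneg x
  rcases h with h | h
  · obtain ⟨h1, h2⟩ := main D hC x Y w h ν0 hH hQ
    refine ⟨h1.trans (by nlinarith), fun i => (h2 i).trans ?_⟩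
    have : 0 ≤ C^3 * (1 + ‖x‖)^2 * (1 + H0 + r) := by positivity
    nlinarith
  · obtain ⟨h1, h2⟩ := main D.swap hC.swap (1 - x) Y (-w) h (-ν0) (by simpa [swap] using hH)
      (by rw [cc_neg, Q_neg]; exact hQ)
    rw [sub_sub_cancel] at h1
    refine ⟨h1.trans (by nlinarith), fun i => ?_⟩
    have := h2 i
    rw [Pi.neg_apply, norm_neg] at this
    refine this.trans ?_
    have h4 : (1 + ‖1 - x‖)^2 ≤ 4 * (1 + ‖x‖)^2 := by nlinarith [norm_nonneg (1 - x)]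
    have h5 : 0 ≤ 2 * C^3 * (1 + H0 + r) := by positivity
    nlinarith [mul_le_mul_of_nonneg_left h4 h5]
end SD
end SB
end

section
namespace SB
open Set Topology Filter
namespace SD
variable {ι R : Type} [Fintype ι] [CommRing R] (D : SD ι R)

lemma ball_slit {x0 x : ℂ} (h0 : x0 ≠ 0) (h : ‖x - x0‖ < ‖x0‖) : x / x0 ∈ Complex.slitPlane := by
  rw [Complex.mem_slitPlane_iff]; left
  have h1 : ‖x / x0 - 1‖ < 1 := by
    rw [div_sub_one h0, norm_div, div_lt_one (norm_pos_iff.2 h0)]; exact h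
  have h2 := Complex.abs_re_le_norm (x / x0 - 1)
  have h3 := (abs_le.1 h2).1
  simp at h3
  linarith

noncomputable def Lb (x0 x : ℂ) : ℂ := Complex.log (x / x0) + Complex.log x0

lemma exp_Lb {x0 x : ℂ} (h0 : x0 ≠ 0) (h : ‖x - x0‖ < ‖x0‖) : Complex.exp (Lb x0 x) = x := by
  rw [Lb, Complex.exp_add, Complex.exp_log (Complex.slitPlane_ne_zero (ball_slit h0 h)), Complex.exp_log h0]
  field_simp

lemma Lb_self {x0 : ℂ} (h0 : x0 ≠ 0) : Lb x0 x0 = Complex.log x0 := by simp [Lb, h0]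

lemma Lb_deriv {x0 x : ℂ} (h0 : x0 ≠ 0) (h : ‖x - x0‖ < ‖x0‖) : HasDerivAt (Lb x0) x⁻¹ x := by
  have h1 : HasDerivAt (fun x : ℂ => x / x0) (1 / x0) x := (hasDerivAt_id x).div_const x0
  have h2 := (h1.clog (ball_slit h0 h)).add_const (Complex.log x0)
  refine h2.congr_deriv ?_
  have : x ≠ 0 := by
    rintro rfl; simp at h
  field_simp

lemma yv_diff (ω : R) {Lf : ℂ → ℂ} {x : ℂ} (hs : 1 - x ∈ Complex.slitPlane) (hL : HasDerivAt Lf x⁻¹ x) :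
    DifferentiableAt ℂ (fun z => D.yv ω (Lf z) z) x := by
  have h1 : DifferentiableAt ℂ (fun z : ℂ => Complex.log (1 - z)) x :=
    DifferentiableAt.clog (f := fun z : ℂ => 1 - z) (by fun_prop) hs
  exact ((hL.differentiableAt.const_mul _).cexp.mul (h1.const_mul _).cexp).const_mul _

lemma wv_deriv (ω ν : R) (i : ι) {Lf : ℂ → ℂ} {x : ℂ} (hs : 1 - x ∈ Complex.slitPlane) (hx : x ≠ 0)
    (hL : HasDerivAt Lf x⁻¹ x) :
    HasDerivAt (fun z => D.wv ω ν (Lf z) z i)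
      (D.σ i ω * (Complex.exp (D.a i * Lf x) * x⁻¹ * (1 - x) ^ ((D.b i - 1 : ℝ):ℂ))) x :=
  ((hI_lderiv (D.ap i) (D.b i) hs hx hL).add_const _).const_mul _

lemma good_ball {x0 : ℂ} (h0 : x0 ≠ 0) (hs : 1 - x0 ∈ Complex.slitPlane) :
    ∃ ρ > 0, ∀ x ∈ Metric.closedBall x0 ρ, 1 - x ∈ Complex.slitPlane ∧ ‖x - x0‖ < ‖x0‖ := by
  have hop : IsOpen {y : ℂ | 1 - y ∈ Complex.slitPlane} :=
    Complex.isOpen_slitPlane.preimage (by fun_prop)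
  have h1 : {y : ℂ | 1 - y ∈ Complex.slitPlane} ∩ Metric.ball x0 ‖x0‖ ∈ 𝓝 x0 :=
    inter_mem (hop.mem_nhds hs) (Metric.ball_mem_nhds _ (norm_pos_iff.2 h0))
  obtain ⟨ρ, hρ, hb⟩ := Metric.nhds_basis_closedBall.mem_iff.1 h1
  exact ⟨ρ, hρ, fun x hx => ⟨(hb hx).1, by simpa [dist_eq_norm] using (hb hx).2⟩⟩

/-- local holomorphic family through a value -/
def LocFam (x0 Y0 : ℂ) (w0 : ι → ℂ) : Prop :=
  ∃ (Yf : ℂ → ℂ) (wf : ι → ℂ → ℂ) (d : ι → ℂ), Yf x0 = Y0 ∧ (∀ i, wf i x0 = w0 i) ∧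
    (∀ᶠ x in 𝓝 x0, DifferentiableAt ℂ Yf x ∧ (∀ i, DifferentiableAt ℂ (wf i) x) ∧ D.V x (Yf x) (fun i => wf i x)) ∧
    (∀ i, HasDerivAt (wf i) (d i) x0) ∧ ∀ i, ‖d i‖ = ‖x0‖ ^ (D.a i - 1) * ‖1 - x0‖ ^ (D.b i - 1)

lemma locFam_A {x0 Y0 : ℂ} {w0 : ι → ℂ} (h : D.AV x0 Y0 w0) : D.LocFam x0 Y0 w0 := by
  have hs := h.1
  have h0 := (D.V_ne (Or.inl h)).1
  have hb0 : ‖x0 - x0‖ < ‖x0‖ := by simpa using h0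
  obtain ⟨ω, ν, hω, rfl, rfl⟩ := D.AV_branch h (exp_Lb h0 hb0)
  obtain ⟨ρ, hρ, hgood⟩ := good_ball h0 hs
  refine ⟨fun x => D.yv ω (Lb x0 x) x, fun i x => D.wv ω ν (Lb x0 x) x i, _, rfl, fun i => rfl, ?_,
    fun i => D.wv_deriv ω ν i hs h0 (Lb_deriv h0 hb0), fun i => ?_⟩
  · filter_upwards [Metric.closedBall_mem_nhds x0 hρ] with x hx
    obtain ⟨h1, h2⟩ := hgood x hx
    have hxne : x ≠ 0 := by rintro rfl; simp at h2
    exact ⟨D.yv_diff ω h1 (Lb_deriv h0 h2),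
      fun i => (D.wv_deriv ω ν i h1 hxne (Lb_deriv h0 h2)).differentiableAt,
      Or.inl ⟨h1, ω, ν, Lb x0 x, hω, exp_Lb h0 h2, rfl, rfl⟩⟩
  · rw [norm_mul, D.norm_ω hω, one_mul, norm_mul, norm_mul, norm_exp_mul, exp_Lb h0 hb0, norm_inv,
      Complex.norm_cpow_real, Real.rpow_sub_one (x := ‖x0‖) (by simpa using h0), div_eq_mul_inv]

lemma locFam {x0 Y0 : ℂ} {w0 : ι → ℂ} (h : D.V x0 Y0 w0) : D.LocFam x0 Y0 w0 := by
  rcases h with h | h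
  · exact D.locFam_A h
  · obtain ⟨Yf, wf, d, h1, h2, h3, h4, h5⟩ := D.swap.locFam_A h
    have ht : Tendsto (fun x : ℂ => 1 - x) (𝓝 x0) (𝓝 (1 - x0)) := by
      have : Continuous (fun x : ℂ => 1 - x) := by fun_prop
      exact this.tendsto x0
    have hdx : ∀ x : ℂ, HasDerivAt (fun x : ℂ => 1 - x) (-1) x := fun x => by
      simpa using (hasDerivAt_id x).const_sub 1
    refine ⟨fun x => Yf (1 - x), fun i x => - wf i (1 - x), d, h1, fun i => by simp [h2], ?_, ?_, ?_⟩
    · filter_upwards [ht.eventually h3] with x hx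
      refine ⟨hx.1.comp x (hdx x).differentiableAt,
        fun i => ((hx.2.1 i).comp x (hdx x).differentiableAt).neg, ?_⟩
      have := D.swap.V_swap hx.2.2
      rw [swap_swap, sub_sub_cancel] at this
      exact this
    · intro i
      refine (((h4 i).comp x0 (hdx x0)).neg).congr_deriv ?_
      ring
    · intro i
      rw [h5 i]
      simp only [swap, sub_sub_cancel]; ring

/-- the set Z -/
def Z (ν0 : R) (r : ℝ) : Set (ℂ × ℂ × (ι → ℂ)) :=
  {z | D.V z.1 z.2.1 z.2.2 ∧ D.Q (D.cc ν0) z.2.2 ≤ r^2}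

lemma Z_swap {ν0 : R} {r : ℝ} {z : ℂ × ℂ × (ι → ℂ)} (h : z ∈ D.Z ν0 r) :
    (1 - z.1, z.2.1, -z.2.2) ∈ D.swap.Z (-ν0) r := by
  refine ⟨D.V_swap h.1, ?_⟩
  simp only
  rw [cc_neg, Q_neg]; exact h.2

lemma Q_cont (c : ι → ℂ) : Continuous (D.Q c) := by
  unfold Q
  fun_prop

lemma local_compact_A {ν0 : R} {r : ℝ} (hr : 0 ≤ r) {x0 : ℂ} (h0 : x0 ≠ 0) (hs : 1 - x0 ∈ Complex.slitPlane) :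
    ∃ ρ > 0, ∃ K ⊆ D.Z ν0 r, IsCompact K ∧ ∀ z ∈ D.Z ν0 r, z.1 ∈ Metric.closedBall x0 ρ → z ∈ K := by
  obtain ⟨ρ, hρ, hgood⟩ := good_ball h0 hs
  obtain ⟨C, hC⟩ := D.exC
  obtain ⟨H0, hH⟩ : ∃ H0, ∀ i, ‖D.σ i ν0‖ ≤ H0 := by
    refine ⟨∑ i, ‖D.σ i ν0‖, fun i => Finset.single_le_sum (f := fun i => ‖D.σ i ν0‖) (fun j _ => norm_nonneg _) (Finset.mem_univ i)⟩
  set M := H0 + C * r + C^2 * (1 + (‖x0‖ + ρ))^2 with hM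
  have hC1 := hC.one
  set Wset : Set R := {ω | ω ^ D.N = 1} with hWset
  have hWf : Wset.Finite := (D.hfin 1).subset fun ω hω i _ => (D.norm_ω hω i).le
  set Nset : Set R := {ν | ∀ i ∈ D.S, ‖D.σ i ν‖ ≤ M} with hNset
  have hNf : Nset.Finite := D.hfin M
  set g : R → R → ℂ → ℂ × ℂ × (ι → ℂ) := fun ω ν x => (x, D.yv ω (Lb x0 x) x, D.wv ω ν (Lb x0 x) x) with hg
  have hgc : ∀ ω ν, ContinuousOn (g ω ν) (Metric.closedBall x0 ρ) := by
    intro ω ν x hx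
    obtain ⟨h1, h2⟩ := hgood x hx
    have hxne : x ≠ 0 := by rintro rfl; simp at h2
    refine ContinuousWithinAt.prodMk continuousWithinAt_id (ContinuousWithinAt.prodMk ?_ ?_)
    · exact (D.yv_diff ω h1 (Lb_deriv h0 h2)).continuousAt.continuousWithinAt
    · refine continuousWithinAt_pi.2 fun i => ?_
      exact (D.wv_deriv ω ν i h1 hxne (Lb_deriv h0 h2)).continuousAt.continuousWithinAt
  refine ⟨ρ, hρ, ⋃ p ∈ Wset ×ˢ Nset, g p.1 p.2 '' Metric.closedBall x0 ρ ∩ {z | D.Q (D.cc ν0) z.2.2 ≤ r^2}, ?_, ?_, ?_⟩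
  · intro z hz
    simp only [mem_iUnion] at hz
    obtain ⟨p, hp, ⟨x, hx, rfl⟩, hQ⟩ := hz
    obtain ⟨h1, h2⟩ := hgood x hx
    exact ⟨Or.inl ⟨h1, p.1, p.2, Lb x0 x, hp.1, exp_Lb h0 h2, rfl, rfl⟩, hQ⟩
  · refine (hWf.prod hNf).isCompact_biUnion fun p _ => ?_
    refine ((isCompact_closedBall x0 ρ).image_of_continuousOn (hgc p.1 p.2)).inter_right ?_
    exact isClosed_le ((D.Q_cont _).comp (continuous_snd.comp continuous_snd)) continuous_const
  · rintro ⟨x, Y, w⟩ ⟨hV, hQ⟩ hx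
    simp only at hV hQ hx
    obtain ⟨h1, h2⟩ := hgood x hx
    obtain ⟨ω, ν, hω, rfl, rfl⟩ := D.AV_branch (D.V_AV hV h1) (exp_Lb h0 h2)
    simp only [mem_iUnion]
    refine ⟨(ω, ν), ⟨hω, ?_⟩, ⟨x, hx, rfl⟩, hQ⟩
    intro i _
    refine (D.ν_bound hC h1 (exp_Lb h0 h2) hω hr hH hQ i).trans ?_
    have : ‖x‖ ≤ ‖x0‖ + ρ := by
      have := norm_le_norm_add_norm_sub' x x0
      rw [mem_closedBall_iff_norm] at hx
      linarith
    rw [hM]; gcongr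

lemma local_compact {ν0 : R} {r : ℝ} (hr : 0 ≤ r) {x0 : ℂ} (h0 : x0 ≠ 0) (h1 : 1 - x0 ≠ 0) :
    ∃ ρ > 0, ∃ K ⊆ D.Z ν0 r, IsCompact K ∧ ∀ z ∈ D.Z ν0 r, z.1 ∈ Metric.closedBall x0 ρ → z ∈ K := by
  by_cases hs : 1 - x0 ∈ Complex.slitPlane
  · exact D.local_compact_A hr h0 hs
  · have hs2 : 1 - (1 - x0) ∈ Complex.slitPlane := by
      rw [Complex.mem_slitPlane_iff] at hs ⊢
      push Not at hs
      left; have := hs.1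
      simp at this ⊢; linarith
    obtain ⟨ρ, hρ, K, hK1, hK2, hK3⟩ := D.swap.local_compact_A (ν0 := -ν0) hr h1 hs2
    set τ : ℂ × ℂ × (ι → ℂ) → ℂ × ℂ × (ι → ℂ) := fun z => (1 - z.1, z.2.1, -z.2.2) with hτ
    have hττ : ∀ z, τ (τ z) = z := by intro z; simp [hτ]
    refine ⟨ρ, hρ, τ '' K, ?_, hK2.image (by fun_prop), ?_⟩
    · rintro _ ⟨z, hz, rfl⟩
      have := D.swap.Z_swap (hK1 hz)
      rw [neg_neg, swap_swap] at this
      exact this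
    · intro z hz hx
      refine ⟨τ z, hK3 _ (D.Z_swap hz) ?_, hττ z⟩
      rw [mem_closedBall_iff_norm] at hx ⊢
      simp only [hτ]
      rw [sub_sub_sub_cancel_left, norm_sub_rev]; exact hx

lemma Z_compact {ν0 : R} {r : ℝ} (hr : 0 ≤ r) {A : Set ℂ} (hA : IsCompact A) (h0 : ∀ x ∈ A, x ≠ 0 ∧ 1 - x ≠ 0) :
    ∃ K ⊆ D.Z ν0 r, IsCompact K ∧ ∀ z ∈ D.Z ν0 r, z.1 ∈ A → z ∈ K := by
  refine hA.induction_on (p := fun A => ∃ K ⊆ D.Z ν0 r, IsCompact K ∧ ∀ z ∈ D.Z ν0 r, z.1 ∈ A → z ∈ K) ?_ ?_ ?_ ?_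
  · exact ⟨∅, empty_subset _, isCompact_empty, fun z _ h => h.elim⟩
  · rintro s t hst ⟨K, h1, h2, h3⟩
    exact ⟨K, h1, h2, fun z hz hzs => h3 z hz (hst hzs)⟩
  · rintro s t ⟨K, h1, h2, h3⟩ ⟨K', h1', h2', h3'⟩
    refine ⟨K ∪ K', union_subset h1 h1', h2.union h2', fun z hz hzs => ?_⟩
    rcases hzs with h | h
    · exact Or.inl (h3 z hz h)
    · exact Or.inr (h3' z hz h)
  · intro x hx
    obtain ⟨ρ, hρ, K, h1, h2, h3⟩ := D.local_compact (ν0 := ν0) hr (h0 x hx).1 (h0 x hx).2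
    exact ⟨Metric.closedBall x ρ, mem_nhdsWithin_of_mem_nhds (Metric.closedBall_mem_nhds x hρ), K, h1, h2, h3⟩
end SD
end SB
end

section
namespace SB
open Set Topology Filter
namespace SD
variable {ι R : Type} [Fintype ι] [CommRing R] (D : SD ι R)

noncomputable def Pv (P : ℕ → Polynomial ℂ) (J : ℕ) (x Y U : ℂ) : ℂ :=
  ∑ j ∈ Finset.range (J + 1), (P j).eval x * Y ^ (J - j) * U ^ j

lemma Pv_hom (P : ℕ → Polynomial ℂ) (J : ℕ) (x Y U s : ℂ) : Pv P J x (s * Y) (s * U) = s ^ J * Pv P J x Y U := by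
  rw [Pv, Pv, Finset.mul_sum]
  refine Finset.sum_congr rfl fun j hj => ?_
  have : J = (J - j) + j := by have := Finset.mem_range.1 hj; omega
  conv_rhs => rw [this, pow_add]
  rw [mul_pow, mul_pow, Nat.add_sub_cancel]
  ring

lemma Pv_bound (P : ℕ → Polynomial ℂ) (J L : ℕ) (hL : ∀ j, (P j).natDegree ≤ L) (H : ℝ)
    (hH : ∀ j i, ‖(P j).coeff i‖ ≤ H) (x Y U : ℂ) (M : ℝ) (hY : ‖Y‖ ≤ M) (hU : ‖U‖ ≤ M) :
    ‖Pv P J x Y U‖ ≤ (J+1) * (L+1) * H * M^J * (1 + ‖x‖)^L := by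
  have hM : 0 ≤ M := (norm_nonneg _).trans hY
  have hH0 : 0 ≤ H := (norm_nonneg _).trans (hH 0 0)
  rw [Pv]
  refine (norm_sum_le _ _).trans ?_
  have hterm : ∀ j ∈ Finset.range (J+1), ‖(P j).eval x * Y ^ (J - j) * U ^ j‖ ≤ (L+1) * H * (1 + ‖x‖)^L * M^J := by
    intro j hj
    have hJ : J = (J - j) + j := by have := Finset.mem_range.1 hj; omega
    have h1 : ‖(P j).eval x‖ ≤ (L+1) * H * (1 + ‖x‖)^L := by
      rw [Polynomial.eval_eq_sum_range' (Nat.lt_succ_of_le (hL j))]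
      refine (norm_sum_le _ _).trans ?_
      have : ∀ i ∈ Finset.range (L+1), ‖(P j).coeff i * x^i‖ ≤ H * (1 + ‖x‖)^L := by
        intro i hi
        rw [norm_mul, norm_pow]
        refine mul_le_mul (hH j i) ?_ (by positivity) hH0
        have hx := norm_nonneg x
        exact (pow_le_pow_left₀ hx (by linarith) i).trans
          (pow_le_pow_right₀ (by linarith) (by have := Finset.mem_range.1 hi; omega))
      refine (Finset.sum_le_sum this).trans ?_
      simp; ring_nf; rfl
    rw [norm_mul, norm_mul, norm_pow, norm_pow]
    conv_rhs => rw [hJ, pow_add]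
    rw [mul_assoc]
    gcongr
  refine (Finset.sum_le_sum hterm).trans ?_
  simp; ring_nf; rfl

/-- value at a point near 0 -/
lemma Ev_pt {p q : ℕ} (hp : 0 < p) (hqN : q < D.N) (hap : D.a D.i0 = (p:ℝ)/D.N) (hbq : D.b D.i0 = (q:ℝ)/D.N)
    {L : ℂ} (hx : ‖Complex.exp L‖ < 1) (J : ℕ) (P : ℕ → Polynomial ℂ) (ν : R) (ω : R) :
    ∃ v, Ev (Complex.exp (L / D.N)) (evS D.N p q D.hN J P (D.σ D.i0 ν * Bc (D.a D.i0) (D.b D.i0))) v ∧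
      Pv P J (Complex.exp L) (D.yv ω L (Complex.exp L)) (D.wv ω ν L (Complex.exp L) D.i0) = (D.σ D.i0 ω)^J * v := by
  have hN0 : (D.N:ℂ) ≠ 0 := by exact_mod_cast D.hN
  set x := Complex.exp L with hxd
  set t := Complex.exp (L / D.N) with ht
  have htN : t ^ D.N = x := by
    rw [ht, ← Complex.exp_nat_mul, hxd]; congr 1; field_simp
  have htp : t ^ p = Complex.exp (D.a D.i0 * L) := by
    rw [ht, ← Complex.exp_nat_mul, hap]; congr 1; push_cast; field_simp
  have h1x : 1 - x ≠ 0 := by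
    intro h
    have : x = 1 := by linear_combination -h
    rw [this] at hx; simp at hx
  have hE : Ev t (ES ℂ D.N p q D.hN) (t^p * (1 - x) ^ (((q:ℝ)/D.N - 1 : ℝ) : ℂ)) :=
    (Ev.Xpow t p).mul (Ev.expand D.hN (by rw [htN]; exact Ev_E0 hqN hx))
  have hone : Ev t (1 - PowerSeries.X ^ D.N) (1 - x) := by
    have h1 := (Ev.const t 1).add ((Ev.const t (-1)).mul (Ev.Xpow t D.N))
    rw [htN] at h1
    have e1 : (PowerSeries.C (1:ℂ) + PowerSeries.C (-1) * PowerSeries.X ^ D.N : PowerSeries ℂ) = 1 - PowerSeries.X ^ D.N := by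
      simp; ring
    rw [e1] at h1
    have e2 : (1:ℂ) + -1 * x = 1 - x := by ring
    rwa [e2] at h1
  have hY : Ev t (YS ℂ D.N p q D.hN) ((1 - x) * (t^p * (1 - x) ^ (((q:ℝ)/D.N - 1 : ℝ) : ℂ))) := hone.mul hE
  have hU : Ev t (US ℂ D.N p q D.hN) (t^p * hI ((p:ℝ)/D.N) ((q:ℝ)/D.N) x) :=
    (Ev.Xpow t p).mul (Ev.expand D.hN (by rw [htN]; exact Ev_U0 hp hqN hx))
  refine ⟨_, hY.evS hU J P _, ?_⟩
  have ey : D.yv ω L x = D.σ D.i0 ω * ((1 - x) * (t^p * (1 - x) ^ (((q:ℝ)/D.N - 1 : ℝ) : ℂ))) := by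
    rw [yv, htp, ← hbq]
    have : Complex.exp (D.b D.i0 * Complex.log (1 - x)) = (1 - x) * (1 - x) ^ ((D.b D.i0 - 1 : ℝ) : ℂ) := by
      rw [Complex.ofReal_sub, Complex.ofReal_one, Complex.cpow_sub _ _ h1x, Complex.cpow_one,
        Complex.cpow_def_of_ne_zero h1x, mul_comm (Complex.log _)]
      field_simp
    rw [this]; ring
  have ew : D.wv ω ν L x D.i0 = D.σ D.i0 ω * (t^p * hI ((p:ℝ)/D.N) ((q:ℝ)/D.N) x + D.σ D.i0 ν * Bc (D.a D.i0) (D.b D.i0)) := by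
    rw [wv, htp, ← hap, ← hbq]
  rw [ey, ew, Pv_hom, htN]
  rfl

noncomputable def G (P : ℕ → Polynomial ℂ) (J k : ℕ) (m : ℝ) (c : ι → ℂ) (z : ℂ × ℂ × (ι → ℂ)) : ℝ :=
  ‖Pv P J z.1 z.2.1 (z.2.2 D.i0) * (z.1⁻¹)^(8*k-1) * (1 - z.1)‖ *
    ((1 + (‖z.1‖ ^ (1/(D.N:ℝ)))^2) * (1 + (‖1 - z.1‖ ^ (1/(D.N:ℝ)))^2))^k * Real.exp (-(m * D.Q c z.2.2))

noncomputable def ψ (x : ℂ) : ℝ := ‖x‖ * ‖1 - x‖ / (1 + ‖x‖)^3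

lemma ψ_cont : Continuous ψ := by
  unfold ψ
  refine Continuous.div (by fun_prop) (by fun_prop) fun x => by positivity

lemma ψ_le (x : ℂ) : ψ x * (1 + ‖x‖) ≤ 1 := by
  have hn : ‖1 - x‖ ≤ 1 + ‖x‖ := by simpa using norm_sub_le (1:ℂ) x
  have h0 := norm_nonneg x
  rw [ψ, div_mul_eq_mul_div, div_le_one (by positivity)]
  have : ‖x‖ * ‖1 - x‖ ≤ (1 + ‖x‖) * (1 + ‖x‖) := mul_le_mul (by linarith) hn (norm_nonneg _) (by positivity)
  nlinarith

lemma ψ_nonneg (x : ℂ) : 0 ≤ ψ x := by unfold ψ; positivity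

lemma ψ_le_one (x : ℂ) : ψ x ≤ 1 := by
  have := ψ_le x; have := ψ_nonneg x; nlinarith [norm_nonneg x]

lemma G_max (P : ℕ → Polynomial ℂ) (J k : ℕ) (hk : 0 < k) (m : ℝ) (hm : 0 ≤ m) (ν0 : R) (r : ℝ) (hr : 0 ≤ r) (A0 : ℝ)
    (hA0 : 0 ≤ A0) (hmk : m * (16 * D.N^2 * (D.S.card)) < k)
    (hB : ∀ z ∈ D.Z ν0 r, D.G P J k m (D.cc ν0) z ≤ A0 * Real.exp (-(m * D.Q (D.cc ν0) z.2.2)) * ψ z.1) :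
    ∀ z ∈ D.Z ν0 r, D.G P J k m (D.cc ν0) z ≤ A0 * Real.exp (-(m * r^2)) := by
  set c := D.cc ν0 with hc
  by_contra! hcon
  obtain ⟨p0, hp0, hlt⟩ := hcon
  have hG0 : 0 < D.G P J k m c p0 := lt_of_le_of_lt (by positivity) hlt
  have hQ0 : ∀ w, 0 ≤ D.Q c w := fun w => Finset.sum_nonneg fun i _ => by positivity
  have hB2 : ∀ z ∈ D.Z ν0 r, D.G P J k m c z ≤ A0 * ψ z.1 := by
    intro z hz
    refine (hB z hz).trans ?_
    have h1 : Real.exp (-(m * D.Q c z.2.2)) ≤ 1 := by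
      rw [Real.exp_le_one_iff]; have := mul_nonneg hm (hQ0 z.2.2); linarith
    have := ψ_nonneg z.1
    calc _ ≤ A0 * 1 * ψ z.1 := by gcongr
      _ = _ := by ring
  have hA0' : 0 < A0 := by
    rcases hA0.eq_or_lt with h | h
    · have := hB2 p0 hp0; rw [← h] at this; linarith
    · exact h
  set ε := D.G P J k m c p0 / A0 with hε
  have hε0 : 0 < ε := by positivity
  set A : Set ℂ := {x | ε ≤ ψ x} with hA
  have hAc : IsCompact A := by
    refine Metric.isCompact_of_isClosed_isBounded (isClosed_le continuous_const ψ_cont) ?_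
    refine (Metric.isBounded_closedBall (x := (0:ℂ)) (r := 1/ε)).subset fun x hx => ?_
    rw [mem_closedBall_zero_iff, le_div_iff₀ hε0]
    have h1 := ψ_le x
    have h2 : ε ≤ ψ x := hx
    nlinarith [norm_nonneg x]
  have hAne : ∀ x ∈ A, x ≠ 0 ∧ 1 - x ≠ 0 := by
    intro x hx
    have h2 : ε ≤ ψ x := hx
    constructor
    · rintro rfl; simp [ψ] at h2; linarith
    · intro h; simp [ψ, h] at h2; linarith
  obtain ⟨K, hKZ, hKc, hK⟩ := D.Z_compact (ν0 := ν0) hr hAc hAne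
  have hinA : ∀ z ∈ D.Z ν0 r, D.G P J k m c p0 ≤ D.G P J k m c z → z ∈ K := by
    intro z hz h
    refine hK z hz ?_
    show ε ≤ ψ z.1
    rw [hε, div_le_iff₀ hA0']
    linarith [hB2 z hz]
  have hp0K := hinA p0 hp0 le_rfl
  have hGc : ContinuousOn (D.G P J k m c) K := by
    intro z hz
    have hne := (D.V_ne (hKZ hz).1).1
    unfold G Pv
    have h1 : ContinuousAt (fun z : ℂ × ℂ × (ι → ℂ) => z.1⁻¹) z := continuous_fst.continuousAt.inv₀ hne
    have hN := D.Npos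
    have h2 : Continuous (fun z : ℂ × ℂ × (ι → ℂ) => ‖z.1‖ ^ (1/(D.N:ℝ))) :=
      (by fun_prop : Continuous fun z : ℂ × ℂ × (ι → ℂ) => ‖z.1‖).rpow_const fun _ => Or.inr (by positivity)
    have h3 : Continuous (fun z : ℂ × ℂ × (ι → ℂ) => ‖1 - z.1‖ ^ (1/(D.N:ℝ))) :=
      (by fun_prop : Continuous fun z : ℂ × ℂ × (ι → ℂ) => ‖1 - z.1‖).rpow_const fun _ => Or.inr (by positivity)
    have h4 : Continuous (fun z : ℂ × ℂ × (ι → ℂ) => D.Q c z.2.2) := (D.Q_cont c).comp (by fun_prop)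
    have h5 : Continuous (fun z : ℂ × ℂ × (ι → ℂ) => ∑ j ∈ Finset.range (J + 1), (P j).eval z.1 * z.2.1 ^ (J - j) * z.2.2 D.i0 ^ j) := by
      refine continuous_finsetSum _ fun j _ => ?_
      exact (((P j).continuous.comp continuous_fst).mul (by fun_prop)).mul (by fun_prop)
    refine ContinuousAt.continuousWithinAt ?_
    refine ContinuousAt.mul (ContinuousAt.mul (ContinuousAt.norm (ContinuousAt.mul (ContinuousAt.mul h5.continuousAt (h1.pow _)) ?_)) ?_) ?_
    · exact (by fun_prop : Continuous fun z : ℂ × ℂ × (ι → ℂ) => 1 - z.1).continuousAt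
    · exact Continuous.continuousAt (by fun_prop)
    · exact Continuous.continuousAt (by fun_prop)
  obtain ⟨zs, hzs, hmax⟩ := hKc.exists_isMaxOn ⟨p0, hp0K⟩ hGc
  have hge : D.G P J k m c p0 ≤ D.G P J k m c zs := hmax hp0K
  have hmax' : ∀ z ∈ D.Z ν0 r, D.G P J k m c z ≤ D.G P J k m c zs := by
    intro z hz
    rcases le_total (D.G P J k m c p0) (D.G P J k m c z) with h | h
    · exact hmax (hinA z hz h)
    · exact h.trans hge
  obtain ⟨hV, hQ⟩ := hKZ hzs
  have hQlt : D.Q c zs.2.2 < r^2 := by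
    refine lt_of_le_of_ne hQ fun h => ?_
    have h1 := hB zs (hKZ hzs)
    rw [h] at h1
    have h2 : A0 * Real.exp (-(m * r^2)) * ψ zs.1 ≤ A0 * Real.exp (-(m * r^2)) * 1 := by
      gcongr; exact ψ_le_one _
    linarith
  obtain ⟨xs, Ys, ws⟩ := zs
  simp only at hV hQ hQlt
  obtain ⟨hx0, hx1⟩ := D.V_ne hV
  obtain ⟨Yf, wf, d, e1, e2, e3, e4, e5⟩ := D.locFam hV
  set α : ℝ := 1/(D.N:ℝ) with hα
  have hα0 : 0 < α := by have := D.Npos; positivity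
  set W1 : ℂ → ℂ := fun x => Complex.exp (α * Lb xs x) with hW1
  set W2 : ℂ → ℂ := fun x => Complex.exp (α * Lb (1 - xs) (1 - x)) with hW2
  have hb1 : ∀ᶠ x in 𝓝 xs, ‖x - xs‖ < ‖xs‖ := by
    have := Metric.ball_mem_nhds xs (norm_pos_iff.2 hx0)
    filter_upwards [this] with x hx
    simpa [dist_eq_norm] using hx
  have hb2 : ∀ᶠ x in 𝓝 xs, ‖(1 - x) - (1 - xs)‖ < ‖1 - xs‖ := by
    have := Metric.ball_mem_nhds xs (norm_pos_iff.2 hx1)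
    filter_upwards [this] with x hx
    rw [sub_sub_sub_cancel_left, norm_sub_rev]
    simpa [dist_eq_norm] using hx
  have hdx : ∀ x : ℂ, HasDerivAt (fun x : ℂ => 1 - x) (-1) x := fun x => by
    simpa using (hasDerivAt_id x).const_sub 1
  have dW1 : ∀ x, ‖x - xs‖ < ‖xs‖ → HasDerivAt W1 (Complex.exp (α * Lb xs x) * (α * x⁻¹)) x :=
    fun x hx => ((Lb_deriv hx0 hx).const_mul (α:ℂ)).cexp
  have dW2 : ∀ x, ‖(1 - x) - (1 - xs)‖ < ‖1 - xs‖ →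
      HasDerivAt W2 (Complex.exp (α * Lb (1 - xs) (1 - x)) * (α * ((1 - x)⁻¹ * (-1)))) x :=
    fun x hx => (((Lb_deriv hx1 hx).comp x (hdx x)).const_mul (α:ℂ)).cexp
  have nW1 : ∀ x, ‖x - xs‖ < ‖xs‖ → ‖W1 x‖ = ‖x‖ ^ α := fun x hx => by
    simp only [hW1]; rw [norm_exp_mul, exp_Lb hx0 hx]
  have nW2 : ∀ x, ‖(1 - x) - (1 - xs)‖ < ‖1 - xs‖ → ‖W2 x‖ = ‖1 - x‖ ^ α := fun x hx => by
    simp only [hW2]; rw [norm_exp_mul, exp_Lb hx1 hx]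
  have hs1 : ‖xs - xs‖ < ‖xs‖ := by simpa using hx0
  have hs2 : ‖(1 - xs) - (1 - xs)‖ < ‖1 - xs‖ := by simpa using hx1
  set F0 : ℂ → ℂ := fun x => Pv P J x (Yf x) (wf D.i0 x) * (x⁻¹)^(8*k-1) * (1 - x) with hF0
  have hGval : ∀ x, ‖x - xs‖ < ‖xs‖ → ‖(1 - x) - (1 - xs)‖ < ‖1 - xs‖ →
      ‖F0 x‖ * ((1 + ‖W1 x‖ ^ 2) * (1 + ‖W2 x‖ ^ 2)) ^ k *
        Real.exp (-(m * ∑ i ∈ D.S, ‖wf i x - c i‖ ^ 2)) = D.G P J k m c (x, Yf x, fun i => wf i x) := by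
    intro x h1 h2
    rw [nW1 x h1, nW2 x h2]; rfl
  have hself : (xs, Yf xs, fun i => wf i xs) = (xs, Ys, ws) := by
    rw [e1]; congr 2; funext i; exact e2 i
  refine max_contra D.S F0 W1 W2 wf xs ?_ ?_ ?_ ?_ _ _ d (dW1 xs hs1) (dW2 xs hs2) (fun i _ => e4 i) k m c ?_ ?_ ?_
  · filter_upwards [e3, hb1] with x hx hx'
    have hxne : x ≠ 0 := by rintro rfl; simp at hx'
    simp only [hF0, Pv]
    have h1 : DifferentiableAt ℂ (fun x : ℂ => x⁻¹) x := differentiableAt_inv hxne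
    refine DifferentiableAt.mul (DifferentiableAt.mul ?_ (h1.pow _)) (hdx x).differentiableAt
    refine DifferentiableAt.fun_sum fun j _ => ?_
    exact ((P j).differentiable.differentiableAt.mul (hx.1.pow _)).mul ((hx.2.1 D.i0).pow _)
  · filter_upwards [hb1] with x hx using (dW1 x hx).differentiableAt
  · filter_upwards [hb2] with x hx using (dW2 x hx).differentiableAt
  · intro i _
    filter_upwards [e3] with x hx using hx.2.1 i
  · have nd1 : ‖Complex.exp (α * Lb xs xs) * (α * xs⁻¹)‖ = α * ‖xs‖ ^ (α - 1) := by
      have := nW1 xs hs1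
      simp only [hW1] at this
      rw [norm_mul, this, norm_mul, norm_inv, Complex.norm_real, Real.norm_of_nonneg hα0.le,
        Real.rpow_sub_one (x := ‖xs‖) (by simpa using hx0)]
      field_simp
    have nd2 : ‖Complex.exp (α * Lb (1 - xs) (1 - xs)) * (α * ((1 - xs)⁻¹ * (-1)))‖ = α * ‖1 - xs‖ ^ (α - 1) := by
      have := nW2 xs hs2
      simp only [hW2] at this
      rw [norm_mul, this, norm_mul, norm_mul, norm_neg, norm_one, norm_inv, Complex.norm_real, Real.norm_of_nonneg hα0.le,
        Real.rpow_sub_one (x := ‖1 - xs‖) (by simpa using hx1)]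
      field_simp
    rw [nd1, nd2, nW1 xs hs1, nW2 xs hs2]
    have hX : 0 < ‖xs‖ := norm_pos_iff.2 hx0
    have hY : 0 < ‖1 - xs‖ := norm_pos_iff.2 hx1
    have h1XY : 1 ≤ ‖xs‖ + ‖1 - xs‖ := by
      have := norm_add_le xs (1 - xs); simpa using this
    set E := (‖xs‖ ^ (α - 1) / (1 + (‖xs‖ ^ α) ^ 2)) ^ 2 + (‖1 - xs‖ ^ (α - 1) / (1 + (‖1 - xs‖ ^ α) ^ 2)) ^ 2 with hE
    have hE0 : 0 < E := by
      have : 0 < ‖xs‖ ^ (α - 1) := Real.rpow_pos_of_pos hX _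
      positivity
    have hsum : ∑ i ∈ D.S, ‖d i‖^2 ≤ D.S.card * (16 * E) := by
      rw [← nsmul_eq_mul]
      refine Finset.sum_le_card_nsmul _ _ _ fun i hi => ?_
      rw [e5 i]
      exact key_ineq hX hY h1XY hα0 (D.ha0 i) (D.hb0 i) (D.hS i hi)
    have hrhs : (α * ‖xs‖ ^ (α - 1)) ^ 2 / (1 + (‖xs‖ ^ α) ^ 2) ^ 2 + (α * ‖1 - xs‖ ^ (α - 1)) ^ 2 / (1 + (‖1 - xs‖ ^ α) ^ 2) ^ 2 = α^2 * E := by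
      rw [hE]; simp only [div_pow, mul_pow]; ring
    rw [hrhs]
    have h3 : m * ∑ i ∈ D.S, ‖d i‖^2 ≤ m * (D.S.card * (16 * E)) := by gcongr
    refine lt_of_le_of_lt h3 ?_
    have h4 : m * (D.S.card * (16 * E)) = (m * (16 * D.N^2 * (D.S.card))) * (α^2 * E) := by
      rw [hα]; have := D.Npos; field_simp
    rw [h4]
    have : 0 < α^2 * E := by positivity
    nlinarith
  · intro h
    have h1 := hGval xs hs1 hs2
    rw [h, hself] at h1
    simp at h1
    linarith
  · have hQc : ∀ᶠ x in 𝓝 xs, D.Q c (fun i => wf i x) < r^2 := by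
      have h1 : ContinuousAt (fun x => D.Q c (fun i => wf i x)) xs := by
        refine (D.Q_cont c).continuousAt.comp (continuousAt_pi.2 fun i => (e4 i).continuousAt)
      refine h1.eventually (gt_mem_nhds ?_)
      have : (fun i => wf i xs) = ws := funext e2
      show D.Q c (fun i => wf i xs) < r^2
      rw [this]; exact hQlt
    filter_upwards [e3, hb1, hb2, hQc] with x hx h1 h2 h3
    rw [hGval x h1 h2, hGval xs hs1 hs2, hself]
    exact hmax' _ ⟨hx.2.2, h3.le⟩
end SD
end SB
end

section
namespace SB
open Set Topology Filter

lemma coeff_cauchy (f : PowerSeries ℂ) (B : ℝ) (h : ∀ t : ℂ, ‖t‖ = 1/2 → ∃ v, Ev t f v ∧ ‖v‖ ≤ B) (κ : ℕ) :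
    ‖PowerSeries.coeff κ f‖ ≤ 2^κ * B := by
  set tt : ℝ → ℂ := fun θ => (1/2) * Complex.exp (θ * Complex.I) with htt
  have hn : ∀ θ, ‖tt θ‖ = 1/2 := fun θ => by simp [htt]
  choose v hv hvB using fun θ : ℝ => h (tt θ) (hn θ)
  set F : ℕ → ℝ → ℂ := fun n θ => PowerSeries.coeff n f * (1/2)^n * Complex.exp ((((n:ℂ) - κ) * Complex.I) * θ) with hF
  have hFe : ∀ n θ, F n θ = PowerSeries.coeff n f * (tt θ)^n * Complex.exp (-(κ * θ * Complex.I)) := by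
    intro n θ
    simp only [hF, htt, mul_pow, ← Complex.exp_nat_mul]
    rw [mul_assoc, mul_assoc, mul_assoc, mul_assoc, ← Complex.exp_add]
    congr 3; ring_nf
  have hsum := intervalIntegral.hasSum_integral_of_dominated_convergence (a := 0) (b := 2 * Real.pi)
    (μ := MeasureTheory.volume) (F := F) (f := fun θ => v θ * Complex.exp (-(κ * θ * Complex.I)))
    (fun n _ => ‖PowerSeries.coeff n f * (1/2:ℂ)^n‖) ?_ ?_ ?_ ?_ ?_
  rotate_left
  · intro n
    exact Continuous.aestronglyMeasurable (by simp only [hF]; fun_prop)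
  · intro n
    refine Filter.Eventually.of_forall fun θ _ => ?_
    simp only [hF]
    rw [norm_mul]
    have : ‖Complex.exp ((((n:ℂ) - κ) * Complex.I) * θ)‖ = 1 := by
      rw [Complex.norm_exp]; simp
    rw [this, mul_one]
  · refine Filter.Eventually.of_forall fun θ _ => ?_
    refine (hv 0).1.congr fun n => ?_
    rw [norm_mul, norm_mul, norm_pow, hn, norm_pow]; simp
  · exact intervalIntegrable_const
  · refine Filter.Eventually.of_forall fun θ _ => ?_
    have := (hv θ).2.mul_right (Complex.exp (-(κ * θ * Complex.I)))
    refine this.congr_fun ?_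
    intro n; exact hFe n θ
  have hsingle : HasSum (fun n => ∫ θ in (0:ℝ)..(2 * Real.pi), F n θ) (PowerSeries.coeff κ f * (1/2)^κ * (2 * Real.pi)) := by
    have hk : (PowerSeries.coeff κ f * (1/2)^κ * (2 * Real.pi) : ℂ) = ∫ θ in (0:ℝ)..(2 * Real.pi), F κ θ := by
      simp [hF]; ring
    rw [hk]
    refine hasSum_single κ fun n hnk => ?_
    simp only [hF]
    rw [intervalIntegral.integral_const_mul]
    have hne : ((n:ℂ) - κ) * Complex.I ≠ 0 := by
      refine mul_ne_zero (sub_ne_zero.2 (by exact_mod_cast hnk)) Complex.I_ne_zero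
    rw [integral_exp_mul_complex hne]
    have : Complex.exp (((n:ℂ) - κ) * Complex.I * ((2 * Real.pi : ℝ):ℂ)) = 1 := by
      rw [Complex.exp_eq_one_iff]
      exact ⟨(n:ℤ) - κ, by push_cast; ring⟩
    rw [this]; simp
  have huniq := hsum.unique hsingle
  have hle : ‖∫ θ in (0:ℝ)..(2 * Real.pi), v θ * Complex.exp (-(κ * θ * Complex.I))‖ ≤ B * |2 * Real.pi - 0| := by
    refine intervalIntegral.norm_integral_le_of_norm_le_const fun θ _ => ?_
    rw [norm_mul]
    have : ‖Complex.exp (-(κ * θ * Complex.I))‖ = 1 := by rw [Complex.norm_exp]; simp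
    rw [this, mul_one]; exact hvB θ
  rw [huniq, norm_mul, norm_mul, sub_zero, abs_of_pos (by positivity)] at hle
  have hpi : ‖(2 * Real.pi : ℂ)‖ = 2 * Real.pi := by
    simp [abs_of_pos Real.pi_pos]
  rw [hpi] at hle
  have h2 := le_of_mul_le_mul_right hle (by positivity)
  rw [norm_pow] at h2
  have h3 : ‖(1/2:ℂ)‖ = 1/2 := by simp
  rw [h3, one_div, inv_pow, ← div_eq_mul_inv, div_le_iff₀ (by positivity)] at h2
  linarith

namespace SD
variable {ι R : Type} [Fintype ι] [CommRing R] (D : SD ι R)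

lemma fac_bound (x : ℂ) {N : ℕ} (hN : N ≠ 0) :
    (1 + (‖x‖ ^ (1/(N:ℝ)))^2) * (1 + (‖1 - x‖ ^ (1/(N:ℝ)))^2) ≤ 25 * (1 + ‖x‖)^4 := by
  have hN1 : (1:ℝ) ≤ N := by exact_mod_cast Nat.one_le_iff_ne_zero.2 hN
  have hn : ‖1 - x‖ ≤ 1 + ‖x‖ := by simpa using norm_sub_le (1:ℂ) x
  have h0 := norm_nonneg x
  have hN2 : 1/(N:ℝ) ≤ 1 := by rw [div_le_one (by linarith)]; exact hN1
  have h1 := rpow_le_one_add (norm_nonneg x) (c := 1/(N:ℝ)) (by positivity) hN2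
  have h2 := rpow_le_one_add (norm_nonneg (1 - x)) (c := 1/(N:ℝ)) (by positivity) hN2
  have p1 : 0 ≤ ‖x‖ ^ (1/(N:ℝ)) := by positivity
  have p2 : 0 ≤ ‖1 - x‖ ^ (1/(N:ℝ)) := by positivity
  have e1 : 1 + (‖x‖ ^ (1/(N:ℝ)))^2 ≤ 5 * (1 + ‖x‖)^2 := by nlinarith
  have e2 : 1 + (‖1 - x‖ ^ (1/(N:ℝ)))^2 ≤ 5 * (1 + ‖x‖)^2 := by nlinarith
  calc _ ≤ (5 * (1 + ‖x‖)^2) * (5 * (1 + ‖x‖)^2) := by gcongr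
    _ = _ := by ring

end SD
end SB
end

section
namespace SB
open Set Topology Filter
namespace SD
variable {ι R : Type} [Fintype ι] [CommRing R] (D : SD ι R)

lemma alg_near {X Yn A Pn f : ℝ} {N k : ℕ} (hk : 0 < k) (hX : 0 < X) (hX1 : X ≤ 1) (hY : 0 ≤ Yn) (hA : 0 ≤ A)
    (hP0 : 0 ≤ Pn) (hP : Pn ≤ (2^N)^(8*k) * X^(8*k) * A) (hf0 : 0 ≤ f) (hf : f ≤ 25 * (1 + X)^4) :
    Pn * (X⁻¹)^(8*k-1) * Yn * f^k ≤ (2^(N+4))^(8*k) * A * (X * Yn / (1 + X)^3) := by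
  have h1 : X^(8*k) * (X⁻¹)^(8*k-1) = X := by
    obtain ⟨n, hn⟩ : ∃ n, 8*k = n+1 := ⟨8*k-1, by omega⟩
    rw [hn, Nat.add_sub_cancel, pow_succ, inv_pow]; field_simp
  have h2 : f^k ≤ (2^9)^k := by
    refine pow_le_pow_left₀ hf0 (hf.trans ?_) k
    have : (1 + X)^4 ≤ 2^4 := pow_le_pow_left₀ (by linarith) (by linarith) 4
    linarith
  have h3 : (2^9)^k * (1 + X)^3 ≤ (2^4:ℝ)^(8*k) := by
    have : (1 + X)^3 ≤ 2^3 := pow_le_pow_left₀ (by linarith) (by linarith) 3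
    calc (2^9:ℝ)^k * (1 + X)^3 ≤ (2^9)^k * 2^3 := by gcongr
      _ = 2^(9*k+3) := by rw [← pow_mul, ← pow_add]
      _ ≤ 2^(4*(8*k)) := pow_le_pow_right₀ (by norm_num) (by omega)
      _ = _ := by rw [pow_mul]
  rw [mul_div_assoc', le_div_iff₀ (by positivity)]
  calc Pn * (X⁻¹)^(8*k-1) * Yn * f^k * (1 + X)^3
      ≤ ((2^N)^(8*k) * X^(8*k) * A) * (X⁻¹)^(8*k-1) * Yn * (2^9)^k * (1 + X)^3 := by gcongr
    _ = (2^N)^(8*k) * A * Yn * (X^(8*k) * (X⁻¹)^(8*k-1)) * ((2^9)^k * (1 + X)^3) := by ring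
    _ ≤ (2^N)^(8*k) * A * Yn * X * (2^4:ℝ)^(8*k) := by rw [h1]; gcongr
    _ = _ := by rw [pow_add, mul_pow]; ring

lemma alg_far {X Yn A Pn f : ℝ} {N k J L : ℕ} (hk : 0 < k) (hX : 0 < X) (hXN : 1 ≤ 2^N * X) (hY : 0 ≤ Yn) (hA : 0 ≤ A)
    (hP0 : 0 ≤ Pn) (hP : Pn ≤ A * (1 + X)^(L + 2*J)) (hf0 : 0 ≤ f) (hf : f ≤ 25 * (1 + X)^4)
    (hdeg : L + 2*J + 3 ≤ 4*k) :
    Pn * (X⁻¹)^(8*k-1) * Yn * f^k ≤ (2^(N+4))^(8*k) * A * (X * Yn / (1 + X)^3) := by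
  have h1 : X^(8*k) * (X⁻¹)^(8*k-1) = X := by
    obtain ⟨n, hn⟩ : ∃ n, 8*k = n+1 := ⟨8*k-1, by omega⟩
    rw [hn, Nat.add_sub_cancel, pow_succ, inv_pow]; field_simp
  have h2 : f^k ≤ (2^5)^k * (1 + X)^(4*k) := by
    rw [pow_mul (1 + X), ← mul_pow]
    refine pow_le_pow_left₀ hf0 (hf.trans ?_) k
    have : 0 ≤ (1 + X)^4 := by positivity
    linarith
  have h5 : (1 + X)^(L+2*J) * ((2^5)^k * (1 + X)^(4*k)) * (1 + X)^3 ≤ (2^(N+4))^(8*k) * X^(8*k) := by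
    have e1 : (1 + X)^(L+2*J) * (1 + X)^(4*k) * (1 + X)^3 ≤ (1 + X)^(8*k) := by
      rw [← pow_add, ← pow_add]
      exact pow_le_pow_right₀ (by linarith) (by omega)
    have e2 : 1 + X ≤ 2^(N+1) * X := by
      have : (1:ℝ) ≤ 2^N := one_le_pow₀ (by norm_num)
      rw [pow_succ]; nlinarith
    have e3 : (1 + X)^(8*k) ≤ (2^(N+1))^(8*k) * X^(8*k) := by
      rw [← mul_pow]; exact pow_le_pow_left₀ (by linarith) e2 _
    have e4 : (2^5:ℝ)^k ≤ (2^3)^(8*k) := by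
      rw [← pow_mul, ← pow_mul]; exact pow_le_pow_right₀ (by norm_num) (by omega)
    calc _ = (2^5)^k * ((1 + X)^(L+2*J) * (1 + X)^(4*k) * (1 + X)^3) := by ring
      _ ≤ (2^3)^(8*k) * ((2^(N+1))^(8*k) * X^(8*k)) := by
        refine mul_le_mul e4 (e1.trans e3) (by positivity) (by positivity)
      _ = _ := by rw [← mul_assoc, ← mul_pow, ← pow_add]; congr 3; ring
  have h6 : (X⁻¹)^(8*k-1) = X * (X^(8*k))⁻¹ := by
    rw [eq_mul_inv_iff_mul_eq₀ (by positivity), mul_comm]; exact h1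
  rw [mul_div_assoc', le_div_iff₀ (by positivity), h6]
  calc Pn * (X * (X^(8*k))⁻¹) * Yn * f^k * (1 + X)^3
      ≤ (A * (1 + X)^(L + 2*J)) * (X * (X^(8*k))⁻¹) * Yn * ((2^5)^k * (1 + X)^(4*k)) * (1 + X)^3 := by gcongr
    _ = A * X * Yn * (X^(8*k))⁻¹ * ((1 + X)^(L+2*J) * ((2^5)^k * (1 + X)^(4*k)) * (1 + X)^3) := by ring
    _ ≤ A * X * Yn * (X^(8*k))⁻¹ * ((2^(N+4))^(8*k) * X^(8*k)) := by gcongr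
    _ = _ := by field_simp

lemma aux_M2 {N c H0 r : ℝ} (hN : 1 ≤ N) (hC : 1 ≤ c) (hH : 0 ≤ H0) (hr : 0 ≤ r) :
    2 ≤ 8 * N * c * (1 + H0 + r) ∧ 8 * c * (1 + H0 + r) ≤ 8 * N * c * (1 + H0 + r) := by
  have h1 : 1 ≤ N * c := one_le_mul_of_one_le_of_one_le hN hC
  have h2 : 1 ≤ (N * c) * (1 + H0 + r) := one_le_mul_of_one_le_of_one_le h1 (by linarith)
  have h3 : 0 ≤ c * (1 + H0 + r) := by positivity
  have h4 : 1 * (c * (1 + H0 + r)) ≤ N * (c * (1 + H0 + r)) := mul_le_mul_of_nonneg_right hN h3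
  constructor <;> linarith

lemma aux_M {N C H0 r s B : ℝ} (hN : 1 ≤ N) (hC : 1 ≤ C) (hH : 0 ≤ H0) (hr : 0 ≤ r)
    (hs : s ≤ H0 + C * r + 4 * C^2) (hB : B ≤ C) (hB0 : 0 ≤ B) :
    4 * N + s * B ≤ 8 * N * C^3 * (1 + H0 + r) := by
  have e1 : s * B ≤ (H0 + C * r + 4 * C^2) * C := mul_le_mul hs hB hB0 (by positivity)
  have c3 : 1 ≤ C^3 := one_le_pow₀ hC
  have c1 : C ≤ C^3 := by simpa using pow_le_pow_right₀ hC (show 1 ≤ 3 by norm_num)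
  have c2 : C^2 ≤ C^3 := pow_le_pow_right₀ hC (by norm_num)
  have f1 : C * H0 ≤ C^3 * H0 := by gcongr
  have f2 : C^2 * r ≤ C^3 * r := by gcongr
  have e2 : (H0 + C * r + 4 * C^2) * C ≤ 4 * C^3 + C^3 * H0 + C^3 * r := by linarith
  have e0 : 0 ≤ 4 * C^3 + C^3 * H0 + C^3 * r := by positivity
  have e3 := mul_le_mul_of_nonneg_right hN e0
  have e4 : N * 1 ≤ N * C^3 := by gcongr
  have e5 : 0 ≤ N * (C^3 * H0) := by positivity
  have e6 : 0 ≤ N * (C^3 * r) := by positivity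
  linarith

/-- analytic data -/
structure Hyp (D : SD ι R) (C : ℝ) (p q J L k : ℕ) (P : ℕ → Polynomial ℂ) (H : ℝ) (ν0 : R) (H0 r : ℝ) : Prop where
  hC : D.Cst C
  hp : 0 < p
  hqN : q < D.N
  hap : D.a D.i0 = (p:ℝ)/D.N
  hbq : D.b D.i0 = (q:ℝ)/D.N
  hL : ∀ j, (P j).natDegree ≤ L
  hH : ∀ j i, ‖(P j).coeff i‖ ≤ H
  hν : ∀ i, ‖D.σ i ν0‖ ≤ H0
  hr : 0 ≤ r
  hdeg : L + 2*J + 3 ≤ 4*k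
  hvan : ∀ ν : R, (∀ i, ‖D.σ i ν‖ ≤ H0 + C * r + 4 * C^2) →
    PowerSeries.X ^ (D.N * (8*k)) ∣ evS D.N p q D.hN J P (D.σ D.i0 ν * Bc (D.a D.i0) (D.b D.i0))

lemma G_bound {C : ℝ} {p q J L k : ℕ} {P : ℕ → Polynomial ℂ} {H : ℝ} {ν0 : R} {H0 r : ℝ}
    (h : Hyp D C p q J L k P H ν0 H0 r) (m : ℝ) :
    ∀ z ∈ D.Z ν0 r, D.G P J k m (D.cc ν0) z ≤
      ((2^(D.N+4))^(8*k) * ((J+1) * (L+1) * H * (8 * D.N * C^3 * (1 + H0 + r))^J)) *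
        Real.exp (-(m * D.Q (D.cc ν0) z.2.2)) * ψ z.1 := by
  rintro ⟨x, Y, w⟩ ⟨hV, hQ⟩
  simp only at hV hQ
  obtain ⟨hx0, hx1⟩ := D.V_ne hV
  have hX : 0 < ‖x‖ := norm_pos_iff.2 hx0
  have hk : 0 < k := by have := h.hdeg; omega
  have hC1 := h.hC.one
  have hr := h.hr
  have hH0 : 0 ≤ H0 := (norm_nonneg _).trans (h.hν D.i0)
  have hHn : 0 ≤ H := (norm_nonneg _).trans (h.hH 0 0)
  have hN1 : (1:ℝ) ≤ D.N := by exact_mod_cast Nat.one_le_iff_ne_zero.2 D.hN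
  set M := 8 * D.N * C^3 * (1 + H0 + r) with hM
  set A := (J+1) * (L+1) * H * M^J with hA
  have hM0 : 0 ≤ M := by positivity
  have hA0 : 0 ≤ A := by positivity
  set f := (1 + (‖x‖ ^ (1/(D.N:ℝ)))^2) * (1 + (‖1 - x‖ ^ (1/(D.N:ℝ)))^2) with hf
  have hfb := fac_bound x D.hN
  have hf0 : 0 ≤ f := by positivity
  suffices hs : ‖Pv P J x Y (w D.i0)‖ * (‖x‖⁻¹)^(8*k-1) * ‖1 - x‖ * f^k ≤ (2^(D.N+4))^(8*k) * A * (‖x‖ * ‖1 - x‖ / (1 + ‖x‖)^3) by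
    simp only [G, ψ]
    rw [norm_mul, norm_mul, norm_pow, norm_inv]
    have := mul_le_mul_of_nonneg_right hs (Real.exp_pos (-(m * D.Q (D.cc ν0) w))).le
    refine this.trans (le_of_eq ?_)
    ring
  have c3 : 1 ≤ C^3 := one_le_pow₀ hC1
  rcases le_total (2^D.N * ‖x‖) 1 with hc | hc
  · have h2N : (2:ℝ) ≤ 2^D.N := by
      calc (2:ℝ) = 2^1 := by norm_num
        _ ≤ _ := pow_le_pow_right₀ (by norm_num) (Nat.one_le_iff_ne_zero.2 D.hN)
    have hxh : ‖x‖ ≤ 1/2 := by nlinarith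
    have hs : 1 - x ∈ Complex.slitPlane := by
      rw [Complex.mem_slitPlane_iff]; left
      have := Complex.re_le_norm x
      simp; linarith
    obtain ⟨ω, ν, hω, rfl, rfl⟩ := D.AV_branch (D.V_AV hV hs) (Complex.exp_log hx0)
    obtain ⟨v, hv, hPv⟩ := D.Ev_pt h.hp h.hqN h.hap h.hbq (L := Complex.log x) (by rw [Complex.exp_log hx0]; linarith) J P ν ω
    rw [Complex.exp_log hx0] at hPv
    have hνb : ∀ i, ‖D.σ i ν‖ ≤ H0 + C * r + 4 * C^2 := by
      intro i
      refine (D.ν_bound h.hC hs (Complex.exp_log hx0) hω hr h.hν hQ i).trans ?_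
      have : (1 + ‖x‖)^2 ≤ 4 := by nlinarith
      nlinarith [sq_nonneg C]
    set t := Complex.exp (Complex.log x / D.N) with ht
    have htN : ‖t‖^D.N = ‖x‖ := by
      rw [← norm_pow, ht, ← Complex.exp_nat_mul, mul_div_cancel₀ _ (by exact_mod_cast D.hN), Complex.exp_log hx0]
    have ht2 : ‖t‖ ≤ 1/2 := by
      refine le_of_not_gt fun hlt => ?_
      have : (1/2:ℝ)^D.N < ‖t‖^D.N := pow_lt_pow_left₀ hlt (by norm_num) D.hN
      rw [htN, one_div, inv_pow, inv_lt_iff_one_lt_mul₀ (by positivity)] at this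
      linarith
    have hMb : 4 * (D.N:ℝ) + ‖D.σ D.i0 ν * Bc (D.a D.i0) (D.b D.i0)‖ ≤ M := by
      rw [norm_mul]
      exact aux_M hN1 hC1 hH0 hr (hνb _) (h.hC.B2 _) (norm_nonneg _)
    have hBd := Bd_evS D.N p q D.hN h.hp h.hqN J L P h.hL H h.hH _ M hMb
    have hvb := Ev.bound ht2 hBd hv _ (h.hvan ν hνb)
    refine alg_near hk hX (by linarith) (norm_nonneg _) hA0 (norm_nonneg _) ?_ hf0 hfb
    rw [hPv, norm_mul, norm_pow, D.norm_ω hω, one_pow, one_mul]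
    refine hvb.trans (le_of_eq ?_)
    rw [pow_mul, mul_pow, mul_pow, htN]
  · refine alg_far (L := L) (J := J) hk hX hc (norm_nonneg _) hA0 (norm_nonneg _) ?_ hf0 hfb h.hdeg
    obtain ⟨v1, v2⟩ := D.V_bound h.hC hV hr h.hν hH0 hQ
    have hq0 : 0 ≤ (1 + ‖x‖)^2 := by positivity
    obtain ⟨hM2, hMw⟩ := aux_M2 hN1 c3 hH0 hr
    have := Pv_bound P J L h.hL H h.hH x Y (w D.i0) (M * (1 + ‖x‖)^2) (v1.trans (by gcongr))
      ((v2 _).trans (by rw [mul_right_comm]; exact mul_le_mul_of_nonneg_right hMw hq0))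
    refine this.trans (le_of_eq ?_)
    rw [hA, mul_pow, pow_add, ← pow_mul]; ring

/-- the analytic estimate -/
theorem AP {C : ℝ} {p q J L k : ℕ} {P : ℕ → Polynomial ℂ} {H : ℝ} {ν0 : R} {H0 r : ℝ}
    (h : Hyp D C p q J L k P H ν0 H0 r) (hrr : 16 * C^2 * D.S.card ≤ r^2) (κ : ℕ) :
    ‖PowerSeries.coeff κ (evS D.N p q D.hN J P (D.σ D.i0 ν0 * Bc (D.a D.i0) (D.b D.i0)))‖ ≤
      2^κ * (2 * ((2^(D.N+4))^(8*k) * ((J+1) * (L+1) * H * (8 * D.N * C^3 * (1 + H0 + r))^J)) *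
        Real.exp (-((k / (16 * D.N^2 * D.S.card + 1)) * (r^2 - 16 * C^2 * D.S.card)))) := by
  set m : ℝ := k / (16 * D.N^2 * D.S.card + 1) with hm
  have hk : 0 < k := by have := h.hdeg; omega
  have hk' : (0:ℝ) < k := by exact_mod_cast hk
  have hm0 : 0 ≤ m := by positivity
  have hC1 := h.hC.one
  have hr := h.hr
  have hH0 : 0 ≤ H0 := (norm_nonneg _).trans (h.hν D.i0)
  have hHn : 0 ≤ H := (norm_nonneg _).trans (h.hH 0 0)
  have hmk : m * (16 * D.N^2 * (D.S.card)) < k := by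
    rw [hm, div_mul_eq_mul_div, div_lt_iff₀ (by positivity)]
    nlinarith
  set A0 : ℝ := (2^(D.N+4))^(8*k) * ((J+1) * (L+1) * H * (8 * D.N * C^3 * (1 + H0 + r))^J) with hA0
  have hA00 : 0 ≤ A0 := by positivity
  have hG := D.G_max P J k hk m hm0 ν0 r hr A0 hA00 hmk (D.G_bound h m)
  refine coeff_cauchy _ _ (fun t ht => ?_) κ
  have ht0 : t ≠ 0 := by rintro rfl; simp at ht
  set Lg := D.N * Complex.log t with hLg
  have hN0 : (D.N:ℂ) ≠ 0 := by exact_mod_cast D.hN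
  have hex : Complex.exp Lg = t ^ D.N := by rw [hLg, Complex.exp_nat_mul, Complex.exp_log ht0]
  have het : Complex.exp (Lg / D.N) = t := by rw [hLg, mul_div_cancel_left₀ _ hN0, Complex.exp_log ht0]
  have hxn : ‖t ^ D.N‖ ≤ 1/2 := by
    rw [norm_pow, ht]
    calc (1/2:ℝ)^D.N ≤ (1/2)^1 := pow_le_pow_of_le_one (by norm_num) (by norm_num) (Nat.one_le_iff_ne_zero.2 D.hN)
      _ = _ := by norm_num
  obtain ⟨v, hv, hPv⟩ := D.Ev_pt h.hp h.hqN h.hap h.hbq (L := Lg) (by rw [hex]; linarith) J P ν0 1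
  rw [het] at hv
  rw [map_one, one_pow, one_mul, hex] at hPv
  refine ⟨v, hv, ?_⟩
  set x := t ^ D.N with hx
  have hxpos : 0 < ‖x‖ := by rw [hx]; exact norm_pos_iff.2 (pow_ne_zero _ ht0)
  have hs : 1 - x ∈ Complex.slitPlane := by
    rw [Complex.mem_slitPlane_iff]; left
    have := Complex.re_le_norm x
    simp; linarith
  have hQ : D.Q (D.cc ν0) (D.wv 1 ν0 Lg x) ≤ 16 * C^2 * D.S.card := by
    rw [mul_comm, ← nsmul_eq_mul]
    refine Finset.sum_le_card_nsmul _ _ _ fun i hi => ?_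
    have e1 := D.eh_bound h.hC hs hex i
    have e2 : D.wv 1 ν0 Lg x i - D.cc ν0 i = Complex.exp (D.a i * Lg) * hI (D.a i) (D.b i) x := by
      simp only [wv, cc, map_one]; ring
    rw [e2]
    have e3 : (1 + ‖x‖)^2 ≤ 4 := by nlinarith
    have e4 : C * (1 + ‖x‖)^2 ≤ C * 4 := by gcongr
    calc _ ≤ (C * 4)^2 := pow_le_pow_left₀ (norm_nonneg _) (e1.trans e4) 2
      _ = _ := by ring
  have hmem : (x, D.yv 1 Lg x, D.wv 1 ν0 Lg x) ∈ D.Z ν0 r :=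
    ⟨Or.inl ⟨hs, 1, ν0, Lg, one_pow _, hex, rfl, rfl⟩, hQ.trans hrr⟩
  have hGz := hG _ hmem
  simp only [G] at hGz
  rw [hPv, norm_mul, norm_mul, norm_pow, norm_inv] at hGz
  set f := (1 + (‖x‖ ^ (1/(D.N:ℝ)))^2) * (1 + (‖1 - x‖ ^ (1/(D.N:ℝ)))^2) with hf
  have hf1 : 1 ≤ f := by
    have e1 : 1 ≤ 1 + (‖x‖ ^ (1/(D.N:ℝ)))^2 := by have := sq_nonneg (‖x‖ ^ (1/(D.N:ℝ))); linarith
    have e2 : 1 ≤ 1 + (‖1 - x‖ ^ (1/(D.N:ℝ)))^2 := by have := sq_nonneg (‖1 - x‖ ^ (1/(D.N:ℝ))); linarith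
    rw [hf]; nlinarith
  have hfk : 1 ≤ f^k := one_le_pow₀ hf1
  have hxi : 1 ≤ (‖x‖⁻¹)^(8*k-1) := one_le_pow₀ (by rw [one_le_inv₀ hxpos]; linarith)
  have h1x : 1/2 ≤ ‖1 - x‖ := by
    have := norm_sub_norm_le (1:ℂ) x
    rw [norm_one] at this; linarith
  set q0 := D.Q (D.cc ν0) (D.wv 1 ν0 Lg x) with hq0
  have hexp : Real.exp (-(m * (16 * C^2 * D.S.card))) ≤ Real.exp (-(m * q0)) := by
    rw [Real.exp_le_exp]
    have := mul_le_mul_of_nonneg_left hQ hm0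
    linarith
  have hlow : ‖v‖ * 1 * (1/2) * 1 * Real.exp (-(m * (16 * C^2 * D.S.card))) ≤ A0 * Real.exp (-(m * r^2)) := by
    refine le_trans ?_ hGz
    gcongr
  have hsplit : Real.exp (-(m * (r^2 - 16 * C^2 * D.S.card))) * Real.exp (-(m * (16 * C^2 * D.S.card))) = Real.exp (-(m * r^2)) := by
    rw [← Real.exp_add]; congr 1; ring
  rw [← hsplit, ← mul_assoc A0] at hlow
  have h7 := le_of_mul_le_mul_right hlow (Real.exp_pos _)
  linarith
end SD
end SB
end

section
namespace SB
open NumberField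

lemma house_le_iff {K : Type} [Field K] [NumberField K] {x : K} {B : ℝ} (h : ∀ τ : K →+* ℂ, ‖τ x‖ ≤ B) : house x ≤ B := by
  have h0 : 0 ≤ B := (norm_nonneg _).trans (h (Classical.arbitrary _))
  rw [house, pi_norm_le_iff_of_nonneg h0]
  intro τ; exact h τ

lemma siegel0 (K : Type) [Field K] [NumberField K] [DecidableEq (K →+* ℂ)] : ∃ c : ℝ, ∀ (α β : Type) (a : Matrix α β (𝓞 K)) (_ : a ≠ 0)
    (p q : ℕ) (_ : 0 < p) (_ : p < q) (_ : Fintype β) (_ : Fintype.card β = q) (A : ℝ)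
    (_ : ∀ k l, house ((algebraMap (𝓞 K) K) (a k l)) ≤ A) (_ : Fintype α) (_ : Fintype.card α = p),
    ∃ ξ : β → 𝓞 K, ξ ≠ 0 ∧ a.mulVec ξ = 0 ∧ ∀ l, house (ξ l).1 ≤ c * (c * q * A) ^ ((p:ℝ) / (q - p)) :=
  ⟨_, fun _ _ a ha _ _ h0 hpq _ hb _ habs _ hα => house.exists_ne_zero_int_vec_house_le K a ha h0 hpq hb habs hα⟩

lemma siegel (K : Type) [Field K] [NumberField K] : ∃ c : ℝ, 1 ≤ c ∧ ∀ (α β : Type) [Fintype α] [Fintype β]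
    (a : Matrix α β (𝓞 K)) (A : ℝ), 0 < Fintype.card α → Fintype.card β = 2 * Fintype.card α → 1 ≤ A →
    (∀ k l (τ : K →+* ℂ), ‖τ (a k l : K)‖ ≤ A) →
    ∃ ξ : β → 𝓞 K, ξ ≠ 0 ∧ a.mulVec ξ = 0 ∧ ∀ l (τ : K →+* ℂ), ‖τ (ξ l : K)‖ ≤ c * Fintype.card β * A := by
  classical
  obtain ⟨c, hc⟩ := siegel0 K
  refine ⟨(|c| + 1)^2, by nlinarith [abs_nonneg c], ?_⟩
  intro α β _ _ a A hα hβ hA ha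
  have hβ1 : (1:ℝ) ≤ Fintype.card β := by
    have : 1 ≤ Fintype.card β := by omega
    exact_mod_cast this
  by_cases ha0 : a = 0
  · refine ⟨fun _ => 1, ?_, by rw [ha0]; simp, fun l τ => ?_⟩
    · intro h
      have : Nonempty β := Fintype.card_pos_iff.1 (by omega)
      obtain ⟨b⟩ := this
      have := congrFun h b
      simp at this
    · simp only [map_one, norm_one]
      have h1 : 1 ≤ (|c| + 1)^2 := by nlinarith [abs_nonneg c]
      exact one_le_mul_of_one_le_of_one_le (one_le_mul_of_one_le_of_one_le h1 hβ1) hA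
  · obtain ⟨ξ, h1, h2, h3⟩ := hc α β a ha0 _ _ hα (by omega) _ rfl A (fun k l => house_le_iff (ha k l)) _ rfl
    refine ⟨ξ, h1, h2, fun l τ => (norm_embedding_le_house _ τ).trans ((h3 l).trans ?_)⟩
    have e : ((Fintype.card α : ℝ) / ((Fintype.card β : ℝ) - Fintype.card α)) = 1 := by
      have h0 : (0:ℝ) < Fintype.card α := by exact_mod_cast hα
      rw [hβ]; push_cast
      rw [div_eq_one_iff_eq (by linarith)]; ring
    rw [e, Real.rpow_one]
    have h4 : c^2 ≤ (|c| + 1)^2 := by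
      rw [← sq_abs]; exact pow_le_pow_left₀ (abs_nonneg _) (by linarith) 2
    calc c * (c * Fintype.card β * A) = c^2 * Fintype.card β * A := by ring
      _ ≤ _ := by gcongr

lemma count0 (K : Type) [Field K] [NumberField K] [DecidableEq (K →+* ℂ)] : ∃ c : ℝ, ∀ (α : 𝓞 K) i,
    ‖(((integralBasis K).reindex (equivReindex K).symm).repr (algebraMap (𝓞 K) K α) i : ℂ)‖ ≤ c * house (algebraMap (𝓞 K) K α) :=
  ⟨_, house.basis_repr_norm_le_const_mul_house K⟩

lemma count (K : Type) [Field K] [NumberField K] : ∃ c : ℝ, 1 ≤ c ∧ ∃ d : ℕ, ∀ R : ℝ, 1 ≤ R → ∀ s : Finset (𝓞 K),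
    (∀ ν ∈ s, ∀ τ : K →+* ℂ, ‖τ (ν : K)‖ ≤ R) → (s.card : ℝ) ≤ c * R ^ d := by
  classical
  obtain ⟨c, hc⟩ := count0 K
  set e := equivReindex K with he
  set d := Fintype.card (K →+* ℂ) with hd
  set c' := |c| with hc'
  have hc0 : 0 ≤ c' := abs_nonneg c
  refine ⟨(2 * c' + 1)^d, one_le_pow₀ (by linarith), d, fun R hR s hs => ?_⟩
  set m : ℤ := ⌊c' * R⌋ with hm
  have hm0 : 0 ≤ m := Int.floor_nonneg.2 (by positivity)
  set g : 𝓞 K → (K →+* ℂ) → ℤ := fun ν i => ((RingOfIntegers.basis K).reindex e.symm).repr ν i with hg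
  have hginj : Function.Injective g := by
    intro x y hxy
    apply ((RingOfIntegers.basis K).reindex e.symm).repr.injective
    ext i; exact congrFun hxy i
  have hsub : s.image g ⊆ Fintype.piFinset (fun _ : K →+* ℂ => Finset.Icc (-m) m) := by
    intro f hf
    obtain ⟨ν, hν, rfl⟩ := Finset.mem_image.1 hf
    rw [Fintype.mem_piFinset]
    intro i
    have h1 := hc ν i
    have h2 : house (algebraMap (𝓞 K) K ν) ≤ R := house_le_iff (hs ν hν)
    have h3 : ‖((g ν i : ℤ) : ℂ)‖ ≤ c * house (algebraMap (𝓞 K) K ν) := by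
      refine le_trans (le_of_eq ?_) h1
      simp only [hg, Module.Basis.repr_reindex, Finsupp.mapDomain_equiv_apply, integralBasis_repr_apply, eq_intCast, Rat.cast_intCast]
    rw [Complex.norm_intCast] at h3
    have h4 : (|g ν i| : ℝ) ≤ c' * R := by
      refine h3.trans ?_
      refine mul_le_mul (le_abs_self c) h2 (house_nonneg _) hc0
    have h5 : |g ν i| ≤ m := by
      rw [hm, Int.le_floor]; push_cast; exact h4
    rw [Finset.mem_Icc]; exact abs_le.1 h5
  have hcard := Finset.card_le_card hsub
  rw [Finset.card_image_of_injective _ hginj, Fintype.card_piFinset] at hcard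
  simp only [Int.card_Icc, Finset.prod_const, Finset.card_univ] at hcard
  have h6 : (s.card : ℝ) ≤ ((m + 1 - -m).toNat : ℝ)^d := by exact_mod_cast hcard
  have h7 : ((m + 1 - -m).toNat : ℝ) ≤ (2 * c' + 1) * R := by
    have : ((m + 1 - -m).toNat : ℝ) = ((m + 1 - -m : ℤ) : ℝ) := by
      have := Int.toNat_of_nonneg (show 0 ≤ m + 1 - -m by omega)
      exact_mod_cast this
    rw [this]; push_cast
    have := Int.floor_le (c' * R)
    rw [← hm] at this
    linarith
  calc (s.card : ℝ) ≤ _ := h6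
    _ ≤ ((2 * c' + 1) * R)^d := pow_le_pow_left₀ (by positivity) h7 d
    _ = _ := mul_pow _ _ _

lemma liouville {K : Type} [Field K] [NumberField K] {θ : 𝓞 K} (h : θ ≠ 0) (τ : K →+* ℂ) {B : ℝ}
    (hB : ∀ τ' : K →+* ℂ, ‖τ' (θ : K)‖ ≤ B) : 1 ≤ ‖τ (θ : K)‖ * B ^ (Module.finrank ℚ K - 1) := by
  have h1 := norm_norm_le_norm_mul_house_pow (θ : K) τ
  have h2 : 1 ≤ ‖Algebra.norm ℚ (θ : K)‖ := by
    rw [← Algebra.coe_norm_int]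
    have h3 : Algebra.norm ℤ θ ≠ 0 := Algebra.norm_ne_zero_iff.2 h
    have h4 : ‖((Algebra.norm ℤ θ : ℤ) : ℚ)‖ = ((|Algebra.norm ℤ θ| : ℤ) : ℝ) := by
      rw [← Rat.norm_cast_real]; simp
    rw [h4]
    exact_mod_cast Int.one_le_abs h3
  refine h2.trans (h1.trans ?_)
  gcongr
  · exact house_nonneg _
  · exact house_le_iff hB
end SB
end

section
namespace SB
open NumberField PowerSeries

lemma den_int {K : Type} [Field K] [NumberField K] (N p q : ℕ) (hN : N ≠ 0) (hp : 0 < p) (hqN : q < N) (J L : ℕ)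
    (P : ℕ → Polynomial K) (hL : ∀ j, (P j).natDegree ≤ L) (hP : ∀ j i, IsIntegral ℤ ((P j).coeff i)) (H : ℝ)
    (hH : ∀ (τ : K →+* ℂ) j i, ‖τ ((P j).coeff i)‖ ≤ H)
    (δ : ℕ) (β : K) (hβ : IsIntegral ℤ (δ * β)) (M : ℝ) (hM : ∀ τ : K →+* ℂ, 4 * N + ‖τ β‖ ≤ M) (n : ℕ) :
    ∃ θ : 𝓞 K, (θ : K) = (N : K) ^ n * (n.factorial : K) * ((δ : K) ^ J * coeff n (evS N p q hN J P β)) ∧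
      ∀ τ : K →+* ℂ, τ θ = (N : ℂ) ^ n * (n.factorial : ℂ) * ((δ : ℂ) ^ J * coeff n (evS N p q hN J (fun j => (P j).map τ) (τ β))) ∧
        ‖τ θ‖ ≤ (N:ℝ) ^ n * n.factorial * δ ^ J * 2 ^ n * ((J + 1) * (L + 1) * H * M ^ J) := by
  refine ⟨⟨_, evS_int K N p q hN hp J P hP δ β hβ n⟩, rfl, fun τ => ?_⟩
  have e : τ ((N : K) ^ n * (n.factorial : K) * ((δ : K) ^ J * coeff n (evS N p q hN J P β))) = (N : ℂ) ^ n * (n.factorial : ℂ) * ((δ : ℂ) ^ J * coeff n (evS N p q hN J (fun j => (P j).map τ) (τ β))) := by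
    rw [← map_evS]; simp
  refine ⟨e, ?_⟩
  change ‖τ ((N : K) ^ n * (n.factorial : K) * ((δ : K) ^ J * coeff n (evS N p q hN J P β)))‖ ≤ _
  rw [e]
  have h := (Bd_evS N p q hN hp hqN J L (fun j => (P j).map τ) (fun j => (Polynomial.natDegree_map_le).trans (hL j)) H
    (fun j i => by rw [Polynomial.coeff_map]; exact hH τ j i) (τ β) M (hM τ)).coeff_le n
  simp only [norm_mul, norm_pow, Complex.norm_natCast]
  calc _ ≤ (N:ℝ) ^ n * n.factorial * (δ ^ J * (2 ^ n * ((J + 1) * (L + 1) * H * M ^ J))) := by gcongr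
    _ = _ := by ring

lemma siegel_P (K : Type) [Field K] [NumberField K] : ∃ c : ℝ, 1 ≤ c ∧ ∀ (N p q : ℕ) (hN : N ≠ 0) (_ : 0 < p) (_ : q < N) (J L T : ℕ)
    (δ : ℕ) (_ : 0 < δ) (β : K) (_ : IsIntegral ℤ (δ * β)) (V : Finset (𝓞 K)) (_ : V.Nonempty) (M : ℝ) (_ : 1 ≤ M)
    (_ : ∀ ν ∈ V, ∀ τ : K →+* ℂ, 4 * N + ‖τ (ν * β)‖ ≤ M) (_ : 0 < T) (_ : (J + 1) * (L + 1) = 2 * (V.card * T)),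
    ∃ P : ℕ → Polynomial K, (∀ j, (P j).natDegree ≤ L) ∧ (∀ j i, IsIntegral ℤ ((P j).coeff i)) ∧ (∃ j ≤ J, P j ≠ 0) ∧
      (∀ (τ : K →+* ℂ) j i, ‖τ ((P j).coeff i)‖ ≤ c * ((J + 1) * (L + 1)) * ((N:ℝ) ^ T * T.factorial * δ ^ J * 2 ^ T * ((J + 1) * (L + 1) * 1 * M ^ J))) ∧
      ∀ ν ∈ V, X ^ T ∣ evS N p q hN J P (ν * β) := by
  obtain ⟨c, hc1, hc⟩ := siegel K
  refine ⟨c, hc1, ?_⟩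
  intro N p q hN hp hqN J L T δ hδ β hβ V hV M hM hMV hT hJL
  set A : ℝ := (N:ℝ) ^ T * T.factorial * δ ^ J * 2 ^ T * ((J + 1) * (L + 1) * 1 * M ^ J) with hA
  have hN1 : (1:ℝ) ≤ N := by exact_mod_cast Nat.one_le_iff_ne_zero.2 hN
  have hδ1 : (1:ℝ) ≤ δ := by exact_mod_cast hδ
  let Q : ℕ → ℕ → ℕ → Polynomial K := fun j0 i0 j => if j = j0 then Polynomial.X ^ i0 else 0
  have hQc : ∀ j0 i0 j i, (Q j0 i0 j).coeff i = if j = j0 ∧ i = i0 then 1 else 0 := by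
    intro j0 i0 j i
    simp only [Q]
    by_cases h : j = j0 <;> simp [h, Polynomial.coeff_X_pow]
  have hent : ∀ (r : V × Fin T) (l : Fin (J+1) × Fin (L+1)), ∃ θ : 𝓞 K, (θ : K) = (N : K) ^ (r.2:ℕ) * ((r.2:ℕ).factorial : K) * ((δ : K) ^ J * coeff r.2 (evS N p q hN J (Q l.1 l.2) (((r.1 : 𝓞 K) : K) * β))) ∧ ∀ τ : K →+* ℂ, ‖τ θ‖ ≤ A := by
    intro r l
    have hi : IsIntegral ℤ ((δ:K) * ((r.1 : 𝓞 K) * β)) := by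
      have : (δ:K) * ((r.1 : 𝓞 K) * β) = (r.1 : 𝓞 K) * (δ * β) := by ring
      rw [this]
      exact (RingOfIntegers.isIntegral_coe _).mul hβ
    obtain ⟨θ, h1, h2⟩ := den_int N p q hN hp hqN J L (Q l.1 l.2) (by
        intro j; simp only [Q]; split_ifs
        · rw [Polynomial.natDegree_X_pow]; have := l.2.2; omega
        · simp) (by intro j i; rw [hQc]; split_ifs; exacts [isIntegral_one, isIntegral_zero]) 1
      (by intro τ j i; rw [hQc]; split_ifs <;> simp) δ _ hi M (hMV _ r.1.2) r.2
    refine ⟨θ, h1, fun τ => (h2 τ).2.trans ?_⟩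
    have hr := r.2.2
    rw [hA]
    gcongr <;> first | exact hN1 | exact hr.le | norm_num
  choose a ha1 ha2 using hent
  have hA1 : 1 ≤ A := by
    rw [hA]
    have h1 : 1 ≤ (N:ℝ)^T := one_le_pow₀ hN1
    have h2 : (1:ℝ) ≤ T.factorial := by exact_mod_cast Nat.factorial_pos T
    have h3 : 1 ≤ (δ:ℝ)^J := one_le_pow₀ hδ1
    have h4 : 1 ≤ (2:ℝ)^T := one_le_pow₀ (by norm_num)
    have h5 : 1 ≤ M^J := one_le_pow₀ hM
    have h6 : (1:ℝ) ≤ (J + 1) * (L + 1) * 1 := by nlinarith [Nat.cast_nonneg (α := ℝ) J, Nat.cast_nonneg (α := ℝ) L, mul_nonneg (Nat.cast_nonneg (α := ℝ) J) (Nat.cast_nonneg (α := ℝ) L)]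
    exact one_le_mul_of_one_le_of_one_le (one_le_mul_of_one_le_of_one_le (one_le_mul_of_one_le_of_one_le (one_le_mul_of_one_le_of_one_le h1 h2) h3) h4) (one_le_mul_of_one_le_of_one_le h6 h5)
  obtain ⟨ξ, hξ0, hξ, hξb⟩ := hc (V × Fin T) (Fin (J+1) × Fin (L+1)) (Matrix.of a) A (by
      simp only [Fintype.card_prod, Fintype.card_coe, Fintype.card_fin]; exact Nat.mul_pos hV.card_pos hT)
    (by simp only [Fintype.card_prod, Fintype.card_coe, Fintype.card_fin]; exact hJL) hA1 (fun r l τ => ha2 r l τ)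
  let P : ℕ → Polynomial K := fun j => if h : j < J + 1 then ∑ i : Fin (L+1), Polynomial.C ((ξ (⟨j, h⟩, i) : 𝓞 K) : K) * Polynomial.X ^ (i:ℕ) else 0
  have hPc : ∀ j (h : j < J+1) i (h' : i < L+1), (P j).coeff i = (ξ (⟨j,h⟩, ⟨i,h'⟩) : 𝓞 K) := by
    intro j h i h'
    simp only [P, h, dif_pos, Polynomial.finsetSum_coeff, Polynomial.coeff_C_mul_X_pow]
    rw [Finset.sum_eq_single (⟨i, h'⟩ : Fin (L+1))]
    · simp
    · intro b _ hb; rw [if_neg]; rintro rfl; exact hb rfl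
    · simp
  have hPd : ∀ j, (P j).natDegree ≤ L := by
    intro j
    simp only [P]; split_ifs with h
    · refine Polynomial.natDegree_sum_le_of_forall_le _ _ (fun i _ => ?_)
      refine (Polynomial.natDegree_C_mul_X_pow_le _ _).trans ?_
      have := i.2; omega
    · simp
  have hPc0 : ∀ j i, (P j).coeff i = 0 ∨ ∃ l, (P j).coeff i = (ξ l : 𝓞 K) := by
    intro j i
    by_cases h : j < J+1
    · by_cases h' : i < L+1
      · exact Or.inr ⟨_, hPc j h i h'⟩
      · left; exact Polynomial.coeff_eq_zero_of_natDegree_lt (by have := hPd j; omega)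
    · left; simp only [P, dif_neg h, Polynomial.coeff_zero]
  refine ⟨P, hPd, ?_, ?_, ?_, ?_⟩
  · intro j i
    rcases hPc0 j i with h | ⟨l, h⟩ <;> rw [h]
    · exact isIntegral_zero
    · exact RingOfIntegers.isIntegral_coe _
  · by_contra hcon
    push Not at hcon
    apply hξ0
    ext ⟨⟨j, hj⟩, ⟨i, hi⟩⟩
    have := hPc j hj i hi
    rw [hcon j (by omega)] at this
    simpa using this.symm
  · intro τ j i
    rcases hPc0 j i with h | ⟨l, h⟩ <;> rw [h]
    · rw [map_zero, norm_zero]; positivity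
    · have := hξb l τ
      simpa only [Fintype.card_prod, Fintype.card_fin, Nat.cast_mul, Nat.cast_add, Nat.cast_one] using this
  · intro ν hν
    rw [X_pow_dvd_iff]
    intro m hm
    have h := congrFun hξ (⟨ν, hν⟩, ⟨m, hm⟩)
    have h' := congrArg (fun z : 𝓞 K => (z : K)) h
    simp only [Matrix.mulVec, dotProduct, Matrix.of_apply, Pi.zero_apply, map_zero, map_sum, map_mul, ha1] at h'
    have hev : evS N p q hN J P (ν * β) = ∑ l : Fin (J+1) × Fin (L+1), C ((ξ l : 𝓞 K) : K) * evS N p q hN J (Q l.1 l.2) (ν * β) := by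
      have hQ : ∀ (j0 : Fin (J+1)) i0, evS N p q hN J (Q j0 i0) (ν * β) = pS N (Polynomial.X ^ i0) * YS K N p q hN ^ (J - j0) * (US K N p q hN + C (ν * β)) ^ (j0:ℕ) := by
        intro j0 i0
        rw [evS, Finset.sum_eq_single (j0:ℕ)]
        · simp [Q]
        · intro b _ hb; simp [Q, hb, pS]
        · intro h; exact absurd (Finset.mem_range.2 j0.2) h
      rw [Fintype.sum_prod_type, evS, Finset.sum_range]
      refine Finset.sum_congr rfl (fun j _ => ?_)
      simp only [hQ]
      have : pS N (P j) = ∑ i : Fin (L+1), C ((ξ (j, i) : 𝓞 K) : K) * pS N (Polynomial.X ^ (i:ℕ)) := by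
        simp only [P, j.2, dif_pos, pS, map_sum, map_mul, Polynomial.aeval_C]
        rfl
      rw [this, Finset.sum_mul, Finset.sum_mul]
      refine Finset.sum_congr rfl (fun i _ => ?_)
      ring
    have hne : (N:K)^m * (m.factorial:K) * (δ:K)^J ≠ 0 := by
      have hN' : (N:K) ≠ 0 := by exact_mod_cast hN
      have hδ' : (δ:K) ≠ 0 := by exact_mod_cast hδ.ne'
      have hm' : (m.factorial:K) ≠ 0 := by exact_mod_cast Nat.factorial_ne_zero m
      exact mul_ne_zero (mul_ne_zero (pow_ne_zero _ hN') hm') (pow_ne_zero _ hδ')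
    apply (mul_eq_zero.1 _).resolve_left hne
    rw [hev, map_sum, Finset.mul_sum]
    convert h' using 1
    refine Finset.sum_congr rfl (fun l _ => ?_)
    rw [coeff_C_mul]
    ring
end SB
end

section
namespace SB
open Real

noncomputable def cD (N δ : ℕ) : ℝ := 16 * N^2 + 16 * N * (16 * N + 2) + δ + 16 * N

lemma pow_le_exp_mul {x y : ℝ} (hx : 0 ≤ x) (h : x ≤ exp y) (n : ℕ) : x ^ n ≤ exp (n * y) := by
  rw [Real.exp_nat_mul]; exact pow_le_pow_left₀ hx h n

lemma nat_le_exp (n : ℕ) : (n:ℝ) ≤ exp n := by linarith [Real.add_one_le_exp (n:ℝ)]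

lemma denb (N δ k J s κ : ℕ) (hκ : κ ≤ 16 * N * k) (hJ : J ≤ k) (hs : 1 ≤ s) (hk : k ≤ 4^s) :
    (N:ℝ) ^ κ * κ.factorial * δ ^ J * 2 ^ κ ≤ exp (cD N δ * (k * s)) := by
  have hs' : (1:ℝ) ≤ s := by exact_mod_cast hs
  have hκ' : (κ:ℝ) ≤ 16 * N * k := by exact_mod_cast hκ
  have hJ' : (J:ℝ) ≤ k := by exact_mod_cast hJ
  have hk0 : (0:ℝ) ≤ k := Nat.cast_nonneg _
  have hN0 : (0:ℝ) ≤ N := Nat.cast_nonneg _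
  have hδ0 : (0:ℝ) ≤ δ := Nat.cast_nonneg _
  have hks : (k:ℝ) ≤ k * s := by nlinarith
  have h1 : (N:ℝ) ^ κ ≤ exp (16 * N^2 * (k * s)) := by
    refine (pow_le_exp_mul hN0 (nat_le_exp N) κ).trans (exp_le_exp.2 ?_)
    calc (κ:ℝ) * N ≤ (16 * N * k) * N := by gcongr
      _ = 16 * N^2 * k := by ring
      _ ≤ _ := by gcongr
  have h4 : (4:ℝ) ≤ exp 2 := by
    have := Real.add_one_le_exp (1:ℝ)
    have e : exp 2 = exp 1 * exp 1 := by rw [← exp_add]; norm_num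
    rw [e]; nlinarith
  have h2 : (κ.factorial:ℝ) ≤ exp (16 * N * (16 * N + 2) * (k * s)) := by
    have hf : (κ.factorial:ℝ) ≤ (κ:ℝ)^κ := by exact_mod_cast Nat.factorial_le_pow κ
    have hkk : (κ:ℝ) ≤ exp ((16 * N + 2) * s) := by
      have h16 : (16 * N : ℝ) ≤ exp (16 * N * s) := by
        have := nat_le_exp (16*N)
        push_cast at this
        refine this.trans (exp_le_exp.2 ?_)
        nlinarith
      have hk4 : (k:ℝ) ≤ exp (s * 2) := by
        have : (k:ℝ) ≤ 4^s := by exact_mod_cast hk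
        exact this.trans (pow_le_exp_mul (by norm_num) h4 s)
      calc (κ:ℝ) ≤ 16 * N * k := hκ'
        _ ≤ exp (16 * N * s) * exp (s * 2) := by gcongr
        _ = _ := by rw [← exp_add]; congr 1; ring
    refine hf.trans ((pow_le_exp_mul (Nat.cast_nonneg _) hkk κ).trans (exp_le_exp.2 ?_))
    calc (κ:ℝ) * ((16 * N + 2) * s) ≤ (16 * N * k) * ((16 * N + 2) * s) := by gcongr
      _ = _ := by ring
  have h3 : (δ:ℝ)^J ≤ exp (δ * (k * s)) := by
    refine (pow_le_exp_mul hδ0 (nat_le_exp δ) J).trans (exp_le_exp.2 ?_)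
    calc (J:ℝ) * δ ≤ k * δ := by gcongr
      _ = δ * k := by ring
      _ ≤ _ := by gcongr
  have h5 : (2:ℝ)^κ ≤ exp (16 * N * (k * s)) := by
    have h2e : (2:ℝ) ≤ exp 1 := by linarith [Real.add_one_le_exp (1:ℝ)]
    refine (pow_le_exp_mul (by norm_num) h2e κ).trans (exp_le_exp.2 ?_)
    calc (κ:ℝ) * 1 ≤ 16 * N * k := by linarith
      _ ≤ _ := by gcongr
  calc _ ≤ exp (16 * N^2 * (k * s)) * exp (16 * N * (16 * N + 2) * (k * s)) * exp (δ * (k * s)) * exp (16 * N * (k * s)) := by gcongr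
    _ = _ := by rw [← exp_add, ← exp_add, ← exp_add]; congr 1; unfold cD; ring

noncomputable def cW (N δ : ℕ) (c : ℝ) : ℝ := 2 * cD N δ + c + 8 * (N + 4) + 9

lemma Wb (N δ k J L s κ T : ℕ) (c M : ℝ) (hκ : κ ≤ 16 * N * k) (hT : T ≤ 16 * N * k) (hJ : J ≤ k) (hs : 1 ≤ s) (hk1 : 1 ≤ k) (hk : k ≤ 4^s)
    (hc : 0 ≤ c) (hM0 : 0 ≤ M) (hM : M ≤ exp s) (hJ2 : J + 1 ≤ 2^s) (hL2 : L + 1 ≤ 2^s) :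
    ((N:ℝ) ^ κ * κ.factorial * δ ^ J * 2 ^ κ) * (2 * ((2^(N+4))^(8*k) * ((J + 1) * (L + 1) *
      (c * ((J + 1) * (L + 1)) * ((N:ℝ) ^ T * T.factorial * δ ^ J * 2 ^ T * ((J + 1) * (L + 1) * 1 * M ^ J))) * exp s ^ J))) ≤ exp (cW N δ c * (k * s)) := by
  have hs' : (1:ℝ) ≤ s := by exact_mod_cast hs
  have hk0 : (1:ℝ) ≤ k := by exact_mod_cast hk1
  have hJ' : (J:ℝ) ≤ k := by exact_mod_cast hJ
  have hks : (k:ℝ) ≤ k * s := by nlinarith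
  have hss : (s:ℝ) ≤ k * s := by nlinarith
  have h2e : (2:ℝ) ≤ exp 1 := by linarith [Real.add_one_le_exp (1:ℝ)]
  have h2s : (2:ℝ)^s ≤ exp (k * s) :=
    (pow_le_exp_mul (by norm_num) h2e s).trans (exp_le_exp.2 (by linarith))
  have e1 := denb N δ k J s κ hκ hJ hs hk
  have e2 := denb N δ k J s T hT hJ hs hk
  have e3 : (J:ℝ) + 1 ≤ exp (k * s) := by
    refine le_trans ?_ h2s; exact_mod_cast hJ2
  have e4 : (L:ℝ) + 1 ≤ exp (k * s) := by
    refine le_trans ?_ h2s; exact_mod_cast hL2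
  have e5 : exp s ^ J ≤ exp (k * s) := by
    rw [← Real.exp_nat_mul]; exact exp_le_exp.2 (by gcongr)
  have e6 : M ^ J ≤ exp (k * s) := (pow_le_pow_left₀ hM0 hM J).trans e5
  have e7 : c ≤ exp (c * (k * s)) := by
    have h1 := Real.add_one_le_exp c
    have : exp c ≤ exp (c * (k * s)) := exp_le_exp.2 (by nlinarith)
    linarith
  have e8 : ((2:ℝ)^(N+4))^(8*k) ≤ exp (8 * (N + 4) * (k * s)) := by
    rw [← pow_mul]
    refine (pow_le_exp_mul (by norm_num) h2e _).trans (exp_le_exp.2 ?_)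
    push_cast
    calc ((N:ℝ) + 4) * (8 * k) * 1 = 8 * (N + 4) * k := by ring
      _ ≤ _ := by gcongr
  have e9 : (2:ℝ) ≤ exp (k * s) := h2e.trans (exp_le_exp.2 (by linarith))
  calc _ ≤ exp (cD N δ * (k * s)) * (exp (k * s) * (exp (8 * (N + 4) * (k * s)) * (exp (k * s) * exp (k * s) *
      (exp (c * (k * s)) * (exp (k * s) * exp (k * s)) * (exp (cD N δ * (k * s)) * (exp (k * s) * exp (k * s) * 1 * exp (k * s)))) * exp (k * s)))) := by
        gcongr
    _ = _ := by
      simp only [mul_one, ← exp_add]; congr 1; unfold cW; ring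

/-- final contradiction of the extrapolation step -/
lemma fin_contra {W x y : ℝ} {d : ℕ} (hd : 0 < d) {B t : ℝ} (hW0 : 0 ≤ W) (hW : W ≤ exp x) (hx : 0 ≤ x) (ht : t ≤ W * exp (-y)) (ht0 : 0 ≤ t)
    (hB0 : 0 ≤ B) (hB : B ≤ W) (h1 : 1 ≤ t * B ^ (d - 1)) (hxy : d * x < y) : False := by
  obtain ⟨e, rfl⟩ : ∃ e, d = e + 1 := ⟨d - 1, by omega⟩
  rw [Nat.add_sub_cancel] at h1
  have : t * B ^ e ≤ exp x * exp (-y) * exp x ^ e := by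
    have hBx := hB.trans hW
    have : t ≤ exp x * exp (-y) := ht.trans (by gcongr)
    gcongr
  have e1 : exp x * exp (-y) * exp x ^ e = exp ((e+1:ℕ) * x - y) := by
    rw [← Real.exp_nat_mul, ← exp_add, ← exp_add]; congr 1; push_cast; ring
  rw [e1] at this
  have : exp ((e+1:ℕ) * x - y) < 1 := by rw [exp_lt_one_iff]; linarith
  linarith

end SB
end

section
namespace SB
open NumberField PowerSeries

lemma ev_poly (A : ℝ) (m : ℕ) : ∀ᶠ s : ℕ in Filter.atTop, A * (s:ℝ)^m ≤ 2^s := by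
  have h := tendsto_pow_const_div_const_pow_of_one_lt m (r := (2:ℝ)) (by norm_num)
  have hA : 0 < 1 / (|A| + 1) := by positivity
  filter_upwards [h.eventually_lt_const hA] with s hs
  rw [div_lt_div_iff₀ (by positivity) (by positivity)] at hs
  have h1 : A ≤ |A| + 1 := by linarith [le_abs_self A]
  have : A * (s:ℝ)^m ≤ (|A|+1) * (s:ℝ)^m := by gcongr
  linarith

lemma params (A0 C hb B4 B8 Y Z : ℝ) (d : ℕ) (hA0 : 0 ≤ A0) (hC : 0 ≤ C) (hh : 0 ≤ hb) (h4 : 0 ≤ B4) (h8 : 0 ≤ B8) (hZ : 0 ≤ Z) :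
    ∃ s : ℕ, 1 ≤ s ∧ A0 * ((s:ℝ) * (C * s + 4 * C^2))^d ≤ 2^s ∧ B4 + s * (C * s + 4 * C^2) * hb ≤ Real.exp s ∧
      B8 * (1 + s * (C * s + 4 * C^2) + s) ≤ Real.exp s ∧ Y * s + Z < (s:ℝ)^2 := by
  have h1 := ev_poly (A0 * (C + 4 * C^2)^d) (2*d)
  have h2 := ev_poly (B4 + (C + 4 * C^2) * hb) 2
  have h3 := ev_poly (B8 * (1 + (C + 4 * C^2) + 1)) 2
  have h5 := Filter.tendsto_atTop.1 (tendsto_natCast_atTop_atTop (R := ℝ)) (Y + Z + 1)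
  obtain ⟨s, h1, h2, h3, h5, h6⟩ := (h1.and (h2.and (h3.and (h5.and (Filter.eventually_ge_atTop 1))))).exists
  have hs : (1:ℝ) ≤ s := by exact_mod_cast h6
  have hss : (s:ℝ) ≤ s^2 := by nlinarith
  have hss1 : (1:ℝ) ≤ (s:ℝ)^2 := by nlinarith
  have hρ : (s:ℝ) * (C * s + 4 * C^2) ≤ (C + 4 * C^2) * s^2 := by
    have : 4 * C^2 * (s:ℝ) ≤ 4 * C^2 * s^2 := by gcongr
    nlinarith
  have h2e : (2:ℝ)^s ≤ Real.exp s := by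
    have : (2:ℝ) ≤ Real.exp 1 := by linarith [Real.add_one_le_exp (1:ℝ)]
    simpa using pow_le_exp_mul (by norm_num) this s
  refine ⟨s, h6, ?_, ?_, ?_, ?_⟩
  · calc _ ≤ A0 * ((C + 4 * C^2) * s^2)^d := by gcongr
      _ = A0 * (C + 4 * C^2)^d * (s:ℝ)^(2*d) := by rw [mul_pow, ← pow_mul]; ring
      _ ≤ _ := h1
  · refine le_trans ?_ (h2.trans h2e)
    calc _ ≤ B4 * (s:ℝ)^2 + (C + 4 * C^2) * s^2 * hb := by gcongr; nlinarith
      _ = _ := by ring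
  · refine le_trans ?_ (h3.trans h2e)
    calc _ ≤ B8 * ((s:ℝ)^2 + (C + 4 * C^2) * s^2 + s^2) := by gcongr
      _ = _ := by ring
  · nlinarith

lemma step {K : Type} [Field K] [NumberField K] (D : SD (K →+* ℂ) (𝓞 K)) (hσ : ∀ i ν, D.σ i ν = i (ν : K))
    (β : K) (hβB : D.i0 β = Bc (D.a D.i0) (D.b D.i0)) (C : ℝ) (hC : D.Cst C) (p q : ℕ) (hp : 0 < p) (hqN : q < D.N)
    (hap : D.a D.i0 = (p:ℝ)/D.N) (hbq : D.b D.i0 = (q:ℝ)/D.N) (δ : ℕ) (hδp : 0 < δ) (hδ : IsIntegral ℤ (δ * β))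
    (J L k s T : ℕ) (P : ℕ → Polynomial K) (hL : ∀ j, (P j).natDegree ≤ L) (hP : ∀ j i, IsIntegral ℤ ((P j).coeff i))
    (c M : ℝ) (hc : 0 ≤ c) (hM0 : 0 ≤ M) (hM : M ≤ Real.exp s)
    (hH : ∀ (τ : K →+* ℂ) j i, ‖τ ((P j).coeff i)‖ ≤ c * ((J + 1) * (L + 1)) * ((D.N:ℝ) ^ T * T.factorial * δ ^ J * 2 ^ T * ((J + 1) * (L + 1) * 1 * M ^ J)))
    (hT : T ≤ 16 * D.N * k) (hJ : J ≤ k) (hs : 1 ≤ s) (hk1 : 1 ≤ k) (hk : k ≤ 4^s)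
    (hJ2 : J + 1 ≤ 2^s) (hL2 : L + 1 ≤ 2^s) (hdeg : L + 2 * J + 3 ≤ 4 * k) (H0 : ℝ) (ν : 𝓞 K)
    (hν : ∀ τ : K →+* ℂ, ‖τ (ν:K)‖ ≤ H0) (hH0M : 8 * D.N * C^3 * (1 + H0 + s) ≤ Real.exp s)
    (hMν : ∀ τ : K →+* ℂ, 4 * D.N + ‖τ (ν * β)‖ ≤ M)
    (hY : Module.finrank ℚ K * cW D.N δ c * (16 * D.N^2 * D.S.card + 1) * s + 16 * C^2 * D.S.card < (s:ℝ)^2)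
    (hvan : ∀ ν' : 𝓞 K, (∀ τ : K →+* ℂ, ‖τ (ν':K)‖ ≤ H0 + C * s + 4 * C^2) →
      X ^ (D.N * (8 * k)) ∣ evS D.N p q D.hN J (fun j => (P j).map D.i0) (D.i0 (ν' * β))) :
    X ^ (D.N * (8 * (2 * k))) ∣ evS D.N p q D.hN J (fun j => (P j).map D.i0) (D.i0 (ν * β)) := by
  set H := c * ((J + 1) * (L + 1)) * ((D.N:ℝ) ^ T * T.factorial * δ ^ J * 2 ^ T * ((J + 1) * (L + 1) * 1 * M ^ J)) with hHd
  have hH00 : 0 ≤ H0 := (norm_nonneg _).trans (hν D.i0)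
  have hHn : 0 ≤ H := (norm_nonneg _).trans (hH D.i0 0 0)
  have hC1 := hC.one
  have e0 : ∀ ν : 𝓞 K, D.i0 (ν * β) = D.σ D.i0 ν * Bc (D.a D.i0) (D.b D.i0) := by
    intro ν; rw [map_mul, hσ, hβB]
  have hcW : 0 ≤ cW D.N δ c := by unfold cW cD; positivity
  have hyp : SD.Hyp D C p q J L k (fun j => (P j).map D.i0) H ν H0 s :=
    { hC := hC, hp := hp, hqN := hqN, hap := hap, hbq := hbq
      hL := fun j => Polynomial.natDegree_map_le.trans (hL j)
      hH := fun j i => by rw [Polynomial.coeff_map]; exact hH D.i0 j i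
      hν := fun i => by rw [hσ]; exact hν i
      hr := Nat.cast_nonneg _
      hdeg := hdeg
      hvan := fun ν' h => by
        rw [← e0]; exact hvan ν' (fun τ => by rw [← hσ]; exact h τ) }
  rw [X_pow_dvd_iff]
  intro κ hκ
  obtain ⟨θ, -, hθ2⟩ := den_int D.N p q D.hN hp hqN J L P hL hP H hH δ (ν * β) (by
    have : (δ:K) * (ν * β) = ν * (δ * β) := by ring
    rw [this]; exact (RingOfIntegers.isIntegral_coe _).mul hδ) M hMν κ
  by_contra hne
  have hs0 : (0:ℝ) ≤ s := Nat.cast_nonneg _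
  have hr2 : 16 * C^2 * D.S.card ≤ (s:ℝ)^2 := by
    have : 0 ≤ Module.finrank ℚ K * cW D.N δ c * (16 * D.N^2 * D.S.card + 1) * s := by positivity
    linarith
  have hAP := D.AP hyp hr2 κ
  rw [← e0] at hAP
  have hθ0 : θ ≠ 0 := by
    rintro rfl
    have := (hθ2 D.i0).1
    rw [show ((0 : 𝓞 K) : K) = 0 from rfl, map_zero] at this
    have hN' : (D.N:ℂ) ≠ 0 := by exact_mod_cast D.hN
    have hδ' : (δ:ℂ) ≠ 0 := by exact_mod_cast hδp.ne'
    have hm' : (κ.factorial:ℂ) ≠ 0 := by exact_mod_cast Nat.factorial_ne_zero κ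
    exact mul_ne_zero (mul_ne_zero (pow_ne_zero _ hN') hm') (mul_ne_zero (pow_ne_zero _ hδ') hne) this.symm
  have hli := liouville hθ0 D.i0 (fun τ => (hθ2 τ).2)
  set y := ((k:ℝ)/(16*D.N^2*D.S.card+1))*((s:ℝ)^2-16*C^2*D.S.card) with hy
  have hκ' : κ ≤ 16 * D.N * k := by nlinarith
  have hW := Wb D.N δ k J L s κ T c M hκ' hT hJ hs hk1 hk hc hM0 hM hJ2 hL2
  rw [← hHd] at hW
  refine fin_contra (y := y) (Module.finrank_pos (R := ℚ) (M := K)) (by positivity) hW (by positivity) ?_ (norm_nonneg _) (by positivity) ?_ hli ?_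
  · rw [(hθ2 D.i0).1]
    simp only [norm_mul, norm_pow, Complex.norm_natCast]
    have hM2 : (8 * D.N * C^3 * (1 + H0 + s))^J ≤ Real.exp s ^ J := pow_le_pow_left₀ (by positivity) hH0M J
    calc _ ≤ (D.N:ℝ)^κ * κ.factorial * (δ^J * (2^κ * (2 * ((2^(D.N+4))^(8*k) * ((J+1)*(L+1)*H*(8*D.N*C^3*(1+H0+s))^J)) * Real.exp (-y)))) := by
          gcongr
      _ ≤ (D.N:ℝ)^κ * κ.factorial * (δ^J * (2^κ * (2 * ((2^(D.N+4))^(8*k) * ((J+1)*(L+1)*H*Real.exp s ^J)) * Real.exp (-y)))) := by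
          gcongr
      _ = _ := by ring
  · have hMJ : M^J ≤ Real.exp s ^ J := pow_le_pow_left₀ hM0 hM J
    have h2 : (1:ℝ) ≤ 2 * (2^(D.N+4))^(8*k) := by
      have : (1:ℝ) ≤ (2^(D.N+4))^(8*k) := one_le_pow₀ (one_le_pow₀ (by norm_num))
      linarith
    refine mul_le_mul_of_nonneg_left ?_ (by positivity)
    calc _ ≤ (J+1)*(L+1)*H*Real.exp s ^ J := by gcongr
      _ = 1 * ((J+1)*(L+1)*H*Real.exp s ^ J) := by ring
      _ ≤ (2 * (2^(D.N+4))^(8*k)) * ((J+1)*(L+1)*H*Real.exp s ^ J) := by gcongr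
      _ = _ := by ring
  · rw [hy]
    have hq : (0:ℝ) < 16*D.N^2*D.S.card+1 := by positivity
    have hk0 : (0:ℝ) < k := by exact_mod_cast hk1
    rw [div_mul_eq_mul_div, lt_div_iff₀ hq]
    have : (Module.finrank ℚ K:ℝ) * (cW D.N δ c * (k * s)) * (16*D.N^2*D.S.card+1) = k * (Module.finrank ℚ K * cW D.N δ c * (16 * D.N^2 * D.S.card + 1) * s) := by ring
    rw [this]
    exact mul_lt_mul_of_pos_left (by linarith) hk0

end SB
end

section
namespace SB
open NumberField PowerSeries

lemma exden {K : Type} [Field K] [NumberField K] (β : K) : ∃ δ : ℕ, 0 < δ ∧ IsIntegral ℤ ((δ:K) * β) := by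
  obtain ⟨y, hy0, hy⟩ := exists_integral_multiples ℤ ℚ ({β} : Finset K)
  have h := hy β (by simp)
  refine ⟨y.natAbs, Int.natAbs_pos.2 hy0, ?_⟩
  rw [zsmul_eq_mul] at h
  rcases Int.natAbs_eq y with e | e
  · rw [e] at h; simpa using h
  · rw [e] at h; simpa using h.neg

set_option maxHeartbeats 1000000 in
lemma no_alg {K : Type} [Field K] [NumberField K] (D : SD (K →+* ℂ) (𝓞 K)) (hσ : ∀ i ν, D.σ i ν = i (ν : K))
    (β : K) (hβB : D.i0 β = Bc (D.a D.i0) (D.b D.i0)) (p q : ℕ) (hp : 0 < p) (hpN : p < D.N) (hqN : q < D.N)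
    (hap : D.a D.i0 = (p:ℝ)/D.N) (hbq : D.b D.i0 = (q:ℝ)/D.N)
    (ha : ∀ n : ℤ, (p:ℂ)/D.N ≠ n) (hb : ∀ n : ℤ, (q:ℂ)/D.N ≠ n) (hab : ∀ n : ℤ, (p:ℂ)/D.N + (q:ℂ)/D.N ≠ n) : False := by
  obtain ⟨C, hC⟩ := D.exC
  have hC1 := hC.one
  obtain ⟨cs, hcs1, hsg⟩ := siegel_P K
  obtain ⟨cc, hcc1, d, hcount⟩ := count K
  obtain ⟨δ, hδp, hδ⟩ := exden β
  obtain ⟨hb', hhb0, hhb⟩ : ∃ h : ℝ, 0 ≤ h ∧ ∀ τ : K →+* ℂ, ‖τ β‖ ≤ h := by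
    refine ⟨∑ τ : K →+* ℂ, ‖τ β‖, by positivity, fun τ => ?_⟩
    exact Finset.single_le_sum (f := fun τ : K →+* ℂ => ‖τ β‖) (fun _ _ => norm_nonneg _) (Finset.mem_univ τ)
  have hN1 : 1 ≤ D.N := Nat.one_le_iff_ne_zero.2 D.hN
  obtain ⟨s, hs1, E1, E2, E3, E4⟩ := params (16 * D.N * cc) C hb' (4 * D.N) (8 * D.N * C^3)
    (Module.finrank ℚ K * cW D.N δ cs * (16 * D.N^2 * D.S.card + 1)) (16 * C^2 * D.S.card) d (by positivity) (by positivity) hhb0 (by positivity) (by positivity) (by positivity)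
  have hs' : (1:ℝ) ≤ s := by exact_mod_cast hs1
  set ρ : ℝ := C * s + 4 * C^2 with hρ
  have hρ1 : 1 ≤ ρ := by rw [hρ]; nlinarith
  have hfin : {ν : 𝓞 K | ∀ τ : K →+* ℂ, ‖τ (ν:K)‖ ≤ s * ρ}.Finite := by
    refine (D.hfin (s * ρ)).subset (fun ν hν i _ => ?_)
    rw [hσ]; exact hν i
  set V := hfin.toFinset with hV
  have hVm : ∀ ν, ν ∈ V ↔ ∀ τ : K →+* ℂ, ‖τ (ν:K)‖ ≤ s * ρ := by
    intro ν; rw [hV, Set.Finite.mem_toFinset]; rfl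
  have hsρ : 1 ≤ s * ρ := by nlinarith
  have hVne : V.Nonempty := ⟨0, by
    rw [hVm]; intro τ; rw [show ((0 : 𝓞 K) : K) = 0 from rfl, map_zero, norm_zero]; linarith⟩
  have hVc := hcount (s * ρ) hsρ V (fun ν hν => (hVm ν).1 hν)
  have hn1 : 1 ≤ V.card := hVne.card_pos
  have hJ0 : 16 * D.N * V.card ≤ 2^s := by
    have : (16 * D.N * V.card : ℝ) ≤ 2^s := by
      refine le_trans ?_ E1
      calc (16 * D.N * V.card : ℝ) ≤ 16 * D.N * (cc * (s * ρ)^d) := by gcongr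
        _ = _ := by ring
    exact_mod_cast this
  obtain ⟨J, hJ⟩ : ∃ J, J + 1 = 16 * D.N * V.card := ⟨16 * D.N * V.card - 1, by
    have : 0 < 16 * D.N * V.card := by positivity
    omega⟩
  obtain ⟨L, hL⟩ : ∃ L, L + 1 = 2^s := ⟨2^s - 1, by have := Nat.one_le_two_pow (n := s); omega⟩
  set M : ℝ := 4 * D.N + s * ρ * hb' with hM
  have hN1' : (1:ℝ) ≤ D.N := by exact_mod_cast hN1
  have hM1 : 1 ≤ M := by
    have : 0 ≤ s * ρ * hb' := by positivity
    rw [hM]; linarith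
  have hMb : ∀ ν : 𝓞 K, (∀ τ : K →+* ℂ, ‖τ (ν:K)‖ ≤ s * ρ) → ∀ τ : K →+* ℂ, 4 * D.N + ‖τ (ν * β)‖ ≤ M := by
    intro ν hν τ
    rw [hM, map_mul, norm_mul]
    have := mul_le_mul (hν τ) (hhb τ) (norm_nonneg _) (by positivity)
    linarith
  set T := D.N * (8 * 2^s) with hT
  obtain ⟨P, hPd, hPi, ⟨j1, hj1, hPj1⟩, hPH, hPV⟩ := hsg D.N p q D.hN hp hqN J L T δ hδp β hδ V hVne M hM1
    (fun ν hν => hMb ν ((hVm ν).1 hν)) (by positivity) (by rw [hJ, hL, hT]; ring)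
  have hind : ∀ i ≤ s, ∀ ν : 𝓞 K, (∀ τ : K →+* ℂ, ‖τ (ν:K)‖ ≤ ((s:ℝ) - i) * ρ) →
      X ^ (D.N * (8 * 2^(s+i))) ∣ evS D.N p q D.hN J (fun j => (P j).map D.i0) (D.i0 (ν * β)) := by
    intro i
    induction i with
    | zero =>
      intro _ ν hν
      have h := hPV ν ((hVm ν).2 (by simpa using hν))
      have h' := map_dvd (PowerSeries.map D.i0) h
      rwa [map_evS, map_pow, PowerSeries.map_X] at h'
    | succ i ih =>
      intro hi ν hν
      have hi' : ((i:ℝ) + 1) ≤ s := by exact_mod_cast hi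
      push_cast at hν
      have h2i : 2^s ≤ 2^(s+i) := Nat.pow_le_pow_right (by norm_num) (by omega)
      have h24 : 2^(s+i) ≤ 4^s := by
        rw [show (4:ℕ) = 2^2 by norm_num, ← pow_mul]
        exact Nat.pow_le_pow_right (by norm_num) (by omega)
      have hν' : ((s:ℝ) - (i + 1)) * ρ ≤ s * ρ := by
        have : (0:ℝ) ≤ i := Nat.cast_nonneg _
        gcongr; linarith
      have := step D hσ β hβB C hC p q hp hqN hap hbq δ hδp hδ J L (2^(s+i)) s T P hPd hPi cs M (by linarith) (by linarith) E2 hPH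
        (by rw [hT]; nlinarith) (by omega) hs1 Nat.one_le_two_pow h24 (by omega) (by omega) (by omega) (((s:ℝ) - (i + 1)) * ρ) ν hν
        (le_trans (by gcongr) E3)
        (hMb ν (fun τ => (hν τ).trans hν')) E4
        (fun ν' h => ih (by omega) ν' (fun τ => (h τ).trans (le_of_eq (by rw [hρ]; ring))))
      rw [show 2^(s+(i+1)) = 2 * 2^(s+i) by ring]
      exact this
  have hfinal := hind s le_rfl 0 (fun τ => by rw [show ((0 : 𝓞 K) : K) = 0 from rfl, map_zero, norm_zero, sub_self, zero_mul])
  rw [show ((0 : 𝓞 K) : K) = 0 from rfl, zero_mul, map_zero] at hfinal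
  have hz := zero_est D.N p q D.hN hp ha hb hab J L _ (fun j => (P j).map D.i0) (fun j => Polynomial.natDegree_map_le.trans (hPd j))
    ⟨j1, hj1, by rwa [Ne, Polynomial.map_eq_zero]⟩ hfinal
  have h1 : (J+1) * (L + J) ≤ 2^s * (2 * 2^s) := Nat.mul_le_mul (by omega) (by omega)
  have h2 : p * J ≤ D.N * 2^s := Nat.mul_le_mul hpN.le (by omega)
  have h3 : D.N * ((J+1) * (L+J)) ≤ D.N * (2^s * (2 * 2^s)) := Nat.mul_le_mul_left _ h1
  rw [pow_add] at hz
  have h4 : 1 ≤ 2^s := Nat.one_le_two_pow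
  have h5 : D.N * (8 * (2^s * 2^s)) ≤ D.N * (2^s * (2 * 2^s)) + D.N * 2^s := by omega
  have h6 : D.N * 2^s ≤ D.N * (2^s * 2^s) := by nlinarith
  have h7 : 0 < D.N * (2^s * 2^s) := by positivity
  nlinarith
end SB
end

section
namespace SB
open NumberField ComplexConjugate

lemma root_exp {N : ℕ} (hN : N ≠ 0) (z : ℂ) (h : z ^ N = 1) (h1 : z ≠ 1) :
    ∃ A : ℕ, 0 < A ∧ A < N ∧ z = Complex.exp (2 * Real.pi * Complex.I / N) ^ A := by
  have : NeZero N := ⟨hN⟩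
  obtain ⟨i, hi, rfl⟩ := (Complex.isPrimitiveRoot_exp N hN).eq_pow_of_pow_eq_one h
  refine ⟨i, Nat.pos_of_ne_zero ?_, hi, rfl⟩
  rintro rfl; simp at h1

lemma core {K : Type} [Field K] [NumberField K] (i0 : K →+* ℂ) (N p q : ℕ) (hp : 0 < p) (hpN : p < N) (hq : 0 < q) (hqN : q < N)
    (hpq : p + q ≠ N) (ζ β : K) (hζ : i0 ζ = Complex.exp (2 * Real.pi * Complex.I / N)) (hβ : i0 β = Bc ((p:ℝ)/N) ((q:ℝ)/N)) : False := by
  classical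
  have hN : N ≠ 0 := by omega
  have hN0 : (0:ℝ) < N := by exact_mod_cast Nat.pos_of_ne_zero hN
  set ξ := Complex.exp (2 * Real.pi * Complex.I / N) with hξ
  have hprim : IsPrimitiveRoot ξ N := Complex.isPrimitiveRoot_exp N hN
  have hζp : IsPrimitiveRoot ζ N := IsPrimitiveRoot.of_map_of_injective (f := i0) (by rw [hζ]; exact hprim) i0.injective
  have hτp : ∀ τ : K →+* ℂ, IsPrimitiveRoot (τ ζ) N := fun τ => hζp.map_of_injective τ.injective
  have hξA : ∀ A : ℕ, ξ ^ A = Complex.exp (2 * Real.pi * Complex.I * ((A:ℝ)/N : ℝ)) := by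
    intro A
    rw [hξ, ← Complex.exp_nat_mul]; congr 1; push_cast; ring
  have hex : ∀ (m : ℕ), ¬ N ∣ m → ∀ τ : K →+* ℂ, ∃ A : ℕ, 0 < A ∧ A < N ∧ τ ζ ^ m = ξ ^ A := by
    intro m hm τ
    refine root_exp hN _ ?_ ?_
    · rw [← pow_mul, mul_comm, pow_mul, (hτp τ).pow_eq_one, one_pow]
    · intro h; exact hm ((hτp τ).dvd_of_pow_eq_one _ h)
  choose A hA0 hAN hA using hex p (Nat.not_dvd_of_pos_of_lt hp hpN)
  choose B hB0 hBN hB using hex q (Nat.not_dvd_of_pos_of_lt hq hqN)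
  have hnd : ¬ N ∣ p + q := by
    rintro ⟨c, hc⟩
    have : c < 2 := by
      by_contra h
      have : N * 2 ≤ N * c := Nat.mul_le_mul_left _ (by omega)
      omega
    interval_cases c <;> omega
  have hABN : ∀ τ, A τ + B τ ≠ N := by
    intro τ h
    apply hnd
    apply (hτp τ).dvd_of_pow_eq_one
    rw [pow_add, hA, hB, ← pow_add, h, hprim.pow_eq_one]
  have hcj : ∀ τ : K →+* ℂ, ∀ (m a b : ℕ), 0 < a → a < N → 0 < b → b < N → τ ζ ^ m = ξ ^ a → ((starRingEnd ℂ).comp τ) ζ ^ m = ξ ^ b → a + b = N := by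
    intro τ m a b ha haN hb hbN h1 h2
    have hn : ‖ξ ^ a‖ = 1 := by rw [norm_pow, hprim.norm'_eq_one hN, one_pow]
    have h3 : ξ ^ (a + b) = 1 := by
      rw [pow_add, ← h2, RingHom.comp_apply, ← map_pow, h1, Complex.mul_conj, Complex.normSq_eq_norm_sq, hn]; simp
    obtain ⟨c, hc⟩ := hprim.dvd_of_pow_eq_one _ h3
    have : c < 2 := by
      by_contra h
      have : N * 2 ≤ N * c := Nat.mul_le_mul_left _ (by omega)
      omega
    interval_cases c <;> omega
  have hζi : IsIntegral ℤ ζ := hζp.isIntegral (Nat.pos_of_ne_zero hN)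
  let ζ' : 𝓞 K := ⟨ζ, hζi⟩
  have hζ' : ζ' ^ N = 1 := by
    apply RingOfIntegers.ext
    change algebraMap (𝓞 K) K (ζ' ^ N) = algebraMap (𝓞 K) K 1
    rw [map_pow, map_one]
    exact hζp.pow_eq_one
  let u : (𝓞 K)ˣ := Units.ofPowEqOne ζ' N hζ' hN
  have hu : u ^ N = 1 := Units.pow_ofPowEqOne hζ' hN
  have hdom : ∀ τ : K →+* ℂ, ∃ j ∈ Finset.univ.filter (fun τ => A τ + B τ < N), ∀ x : K, ‖τ x‖ = ‖j x‖ := by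
    intro τ
    by_cases h : A τ + B τ < N
    · exact ⟨τ, by simpa using h, fun _ => rfl⟩
    · refine ⟨(starRingEnd ℂ).comp τ, ?_, fun ν => ?_⟩
      · have h1 := hcj τ p _ _ (hA0 _) (hAN _) (hA0 _) (hAN _) (hA τ) (hA _)
        have h2 := hcj τ q _ _ (hB0 _) (hBN _) (hB0 _) (hBN _) (hB τ) (hB _)
        have h3 := hABN τ
        simp only [Finset.mem_filter, Finset.mem_univ, true_and]
        omega
      · simp
  let D : SD (K →+* ℂ) (𝓞 K) :=
    { σ := fun τ => τ.comp (algebraMap (𝓞 K) K)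
      N := N
      hN := hN
      a := fun τ => (A τ : ℝ) / N
      b := fun τ => (B τ : ℝ) / N
      α0 := u ^ p
      β0 := u ^ q
      hα1 := by rw [← pow_mul, mul_comm, pow_mul, hu, one_pow]
      hβ1 := by rw [← pow_mul, mul_comm, pow_mul, hu, one_pow]
      hα := fun τ => by
        rw [← hξA, ← hA]; simp [u]; rfl
      hβ := fun τ => by
        rw [← hξA, ← hB]; simp [u]; rfl
      S := Finset.univ.filter (fun τ => A τ + B τ < N)
      i0 := i0
      ha0 := fun τ => by
        have : (1:ℝ) ≤ A τ := by exact_mod_cast hA0 τ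
        gcongr
      ha1 := fun τ => by
        rw [div_lt_one hN0]; exact_mod_cast hAN τ
      hb0 := fun τ => by
        have : (1:ℝ) ≤ B τ := by exact_mod_cast hB0 τ
        gcongr
      hb1 := fun τ => by
        rw [div_lt_one hN0]; exact_mod_cast hBN τ
      hS := fun τ hτ => by
        have h : A τ + B τ + 1 ≤ N := by simpa using hτ
        have h' : (A τ : ℝ) + B τ + 1 ≤ N := by exact_mod_cast h
        rw [show (1:ℝ) - A τ / N - B τ / N = (N - A τ - B τ) / N by field_simp]
        gcongr; linarith
      hdom := fun τ => by
        obtain ⟨j, hj, h⟩ := hdom τ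
        exact ⟨j, hj, fun ν => h ν⟩
      hfin := fun M => by
        refine ((Embeddings.finite_of_norm_le K ℂ M).preimage RingOfIntegers.coe_injective.injOn).subset (fun ν hν => ?_)
        refine ⟨RingOfIntegers.isIntegral_coe ν, fun φ => ?_⟩
        obtain ⟨j, hj, h⟩ := hdom φ
        rw [h]; exact hν j hj }
  have hAi : A i0 = p := by
    have := hA i0; rw [hζ] at this
    exact (hprim.pow_inj hpN (hAN _) this).symm
  have hBi : B i0 = q := by
    have := hB i0; rw [hζ] at this
    exact (hprim.pow_inj hqN (hBN _) this).symm
  have hni : ∀ m : ℕ, ¬ N ∣ m → ∀ n : ℤ, (m:ℂ)/N ≠ n := by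
    intro m hm n h
    rw [div_eq_iff (by exact_mod_cast hN)] at h
    have h' : (m:ℤ) = n * N := by exact_mod_cast h
    exact hm (Int.natCast_dvd_natCast.1 ⟨n, by rw [h', mul_comm]⟩)
  refine no_alg D (fun i ν => rfl) β ?_ p q hp hpN hqN ?_ ?_ (hni p (Nat.not_dvd_of_pos_of_lt hp hpN)) (hni q (Nat.not_dvd_of_pos_of_lt hq hqN)) ?_
  · change i0 β = Bc ((A i0 : ℝ)/N) ((B i0 : ℝ)/N)
    rw [hAi, hBi, hβ]
  · change (A i0 : ℝ)/N = _
    rw [hAi]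
  · change (B i0 : ℝ)/N = _
    rw [hBi]
  · intro n h
    refine hni (p+q) hnd n ?_
    rw [← h]; push_cast; exact add_div _ _ _
end SB
end

section
namespace SB

noncomputable def GB (a b : ℚ) : ℂ := Complex.Gamma (a : ℂ) * Complex.Gamma (b : ℂ) / Complex.Gamma ((a : ℂ) + (b : ℂ))

lemma GB_comm (a b : ℚ) : GB a b = GB b a := by
  unfold GB; rw [mul_comm, add_comm]

lemma GB_succ (a b : ℚ) (ha : a ≠ 0) (hab : a + b ≠ 0) : GB (a+1) b = ((a / (a+b) : ℚ) : ℂ) * GB a b := by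
  unfold GB
  have ha' : (a:ℂ) ≠ 0 := by exact_mod_cast ha
  have hab' : (a:ℂ) + b ≠ 0 := by exact_mod_cast hab
  push_cast
  rw [show (a:ℂ) + 1 + b = a + b + 1 by ring, Complex.Gamma_add_one _ ha', Complex.Gamma_add_one _ hab']
  rw [div_mul_div_comm]; ring

lemma GB_shift (a b : ℚ) (ha : ¬ ∃ m : ℤ, a = (m : ℚ)) (hab : ¬ ∃ m : ℤ, a + b = (m : ℚ)) (h : IsAlgebraic ℚ (GB a b)) (n : ℤ) :
    IsAlgebraic ℚ (GB (a + n) b) := by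
  have h1 : ∀ n : ℤ, a + n ≠ 0 := fun n h => ha ⟨-n, by push_cast; linarith⟩
  have h2 : ∀ n : ℤ, a + n + b ≠ 0 := fun n h => hab ⟨-n, by push_cast; linarith⟩
  have hr : ∀ r : ℚ, IsAlgebraic ℚ ((r:ℚ):ℂ) := fun r => isAlgebraic_algebraMap (R := ℚ) (A := ℂ) r
  induction n with
  | zero => simpa using h
  | succ i ih =>
    have := GB_succ (a + (i:ℤ)) b (h1 i) (h2 i)
    rw [show (a + ((i:ℤ) + 1 : ℤ) : ℚ) = a + (i:ℤ) + 1 by push_cast; ring, this]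
    exact (hr _).mul ih
  | pred i ih =>
    have := GB_succ (a + (-(i:ℤ) - 1 : ℤ)) b (h1 _) (h2 _)
    rw [show (a + (-(i:ℤ) - 1 : ℤ) + 1 : ℚ) = a + (-(i:ℤ) : ℤ) by push_cast; ring] at this
    set r : ℚ := (a + (-(i:ℤ) - 1 : ℤ)) / (a + (-(i:ℤ) - 1 : ℤ) + b) with hrd
    have hr0 : r ≠ 0 := div_ne_zero (h1 _) (h2 _)
    have hr0' : (r:ℂ) ≠ 0 := by exact_mod_cast hr0
    have e : GB (a + (-(i:ℤ) - 1 : ℤ)) b = ((r⁻¹ : ℚ) : ℂ) * GB (a + (-(i:ℤ) : ℤ)) b := by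
      rw [this]; push_cast; rw [inv_mul_cancel_left₀ hr0']
    rw [e]
    exact (hr _).mul ih

lemma not_alg_frac (N p q : ℕ) (hp : 0 < p) (hpN : p < N) (hq : 0 < q) (hqN : q < N) (hpq : p + q ≠ N) :
    ¬ IsAlgebraic ℚ (Bc ((p:ℝ)/N) ((q:ℝ)/N)) := by
  intro h
  set B := Bc ((p:ℝ)/N) ((q:ℝ)/N) with hB
  set ξ := Complex.exp (2 * Real.pi * Complex.I / N) with hξ
  have hN : N ≠ 0 := by omega
  have hξi : IsIntegral ℚ ξ := ((Complex.isPrimitiveRoot_exp N hN).isIntegral (Nat.pos_of_ne_zero hN)).tower_top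
  let F := IntermediateField.adjoin ℚ ({ξ, B} : Set ℂ)
  have hfd : FiniteDimensional ℚ F := by
    refine IntermediateField.finiteDimensional_adjoin ?_
    rintro x (rfl | rfl)
    · exact hξi
    · exact h.isIntegral
  have : NumberField F := { to_charZero := inferInstance, to_finiteDimensional := hfd }
  have m1 : ξ ∈ F := IntermediateField.subset_adjoin _ _ (by simp)
  have m2 : B ∈ F := IntermediateField.subset_adjoin _ _ (by simp)
  exact core (K := F) (algebraMap F ℂ) N p q hp hpN hq hqN hpq ⟨ξ, m1⟩ ⟨B, m2⟩ rfl rfl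

lemma fin_red (a b : ℚ) (ha0 : 0 < a) (ha1 : a < 1) (hb0 : 0 < b) (hb1 : b < 1) (hab : a + b ≠ 1) : ¬ IsAlgebraic ℚ (GB a b) := by
  set N := a.den * b.den with hN
  have hp : 0 < a.num := Rat.num_pos.2 ha0
  have hq : 0 < b.num := Rat.num_pos.2 hb0
  obtain ⟨x, hx⟩ := Int.eq_ofNat_of_zero_le hp.le
  obtain ⟨y, hy⟩ := Int.eq_ofNat_of_zero_le hq.le
  have hda : (0:ℚ) < a.den := by exact_mod_cast a.den_pos
  have hdb : (0:ℚ) < b.den := by exact_mod_cast b.den_pos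
  have ea : a = x / a.den := by
    conv_lhs => rw [← Rat.num_div_den a, hx]
    simp
  have eb : b = y / b.den := by
    conv_lhs => rw [← Rat.num_div_den b, hy]
    simp
  have ea' : a = ((x * b.den : ℕ) : ℚ) / (N : ℕ) := by
    rw [hN]; push_cast; rw [mul_div_mul_right _ _ hdb.ne']; exact ea
  have eb' : b = ((y * a.den : ℕ) : ℚ) / (N : ℕ) := by
    rw [hN]; push_cast; rw [mul_comm (a.den:ℚ), mul_div_mul_right _ _ hda.ne']; exact eb
  have hN0 : (0:ℚ) < (N:ℕ) := by rw [hN]; push_cast; positivity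
  generalize x * b.den = p at ea'
  generalize y * a.den = q at eb'
  clear_value N
  have h1 : 0 < p := by
    rw [ea'] at ha0; exact_mod_cast (div_pos_iff_of_pos_right hN0).1 ha0
  have h2 : 0 < q := by
    rw [eb'] at hb0; exact_mod_cast (div_pos_iff_of_pos_right hN0).1 hb0
  have h3 : p < N := by
    rw [ea', div_lt_one hN0] at ha1; exact_mod_cast ha1
  have h4 : q < N := by
    rw [eb', div_lt_one hN0] at hb1; exact_mod_cast hb1
  have h5 : p + q ≠ N := by
    intro h
    apply hab
    rw [ea', eb', ← add_div, div_eq_one_iff_eq hN0.ne']; exact_mod_cast h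
  have hR1 : (0:ℝ) < (p:ℝ)/N := by
    have : 0 < N := by omega
    positivity
  have hR2 : (0:ℝ) < (q:ℝ)/N := by
    have : 0 < N := by omega
    positivity
  have key : GB a b = Bc ((p:ℝ)/N) ((q:ℝ)/N) := by
    rw [Bc_eq_beta hR1 hR2]
    have c1 : (a:ℂ) = (((p:ℝ)/N : ℝ) : ℂ) := by rw [ea']; push_cast; rfl
    have c2 : (b:ℂ) = (((q:ℝ)/N : ℝ) : ℂ) := by rw [eb']; push_cast; rfl
    unfold GB
    rw [c1, c2, Complex.Gamma_mul_Gamma_eq_betaIntegral (by simpa using hR1) (by simpa using hR2)]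
    rw [mul_div_cancel_left₀]
    apply Complex.Gamma_ne_zero_of_re_pos
    rw [← Complex.ofReal_add, Complex.ofReal_re]; positivity
  rw [key]
  exact not_alg_frac N p q h1 h3 h2 h4 h5

lemma fract_pos' (a : ℚ) (ha : ¬ ∃ m : ℤ, a = (m : ℚ)) : 0 < a + ((-⌊a⌋ : ℤ) : ℚ) ∧ a + ((-⌊a⌋ : ℤ) : ℚ) < 1 := by
  have h1 := Int.floor_le a
  have h2 := Int.lt_floor_add_one a
  push_cast
  refine ⟨?_, by linarith⟩
  rcases h1.lt_or_eq with h | h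
  · linarith
  · exact absurd ⟨_, h.symm⟩ ha
end SB
end

theorem schneider_beta_transcendental
    (a b : ℚ)
    (ha : ¬ ∃ m : ℤ, a = (m : ℚ))
    (hb : ¬ ∃ m : ℤ, b = (m : ℚ))
    (hab : ¬ ∃ m : ℤ, a + b = (m : ℚ)) :
    Transcendental ℚ
      (Complex.Gamma (a : ℂ) * Complex.Gamma (b : ℂ) /
        Complex.Gamma ((a : ℂ) + (b : ℂ))) := by
  intro h
  have h0 : IsAlgebraic ℚ (SB.GB a b) := h
  have h1 := SB.GB_shift a b ha hab h0 (-⌊a⌋)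
  rw [SB.GB_comm] at h1
  have h2 := SB.GB_shift b (a + ((-⌊a⌋ : ℤ) : ℚ)) hb (by
    rintro ⟨m, hm⟩
    exact hab ⟨m + ⌊a⌋, by push_cast at hm ⊢; linarith⟩) h1 (-⌊b⌋)
  rw [SB.GB_comm] at h2
  obtain ⟨a0, a1⟩ := SB.fract_pos' a ha
  obtain ⟨b0, b1⟩ := SB.fract_pos' b hb
  refine SB.fin_red _ _ a0 a1 b0 b1 ?_ h2
  intro hm
  exact hab ⟨1 + ⌊a⌋ + ⌊b⌋, by push_cast at hm ⊢; linarith⟩
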